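/- arXiv:1706.08290 — 2 statements merged into one kernel-verified Lean document; each statement's English description precedes it below -/
import Mathlib

section
/- If G is a finite nonsolvable group, then n(G) > 2.7, i.e., β(G) < |G|/2.7. -/
/-!  Definition of the Noether number `β(G)` of a group `G`, over the field `ℂ`
(of characteristic 0).  A finite-dimensional `ℂG`-module is (up to isomorphism)
given by a representation `ρ : Representation ℂ G (Fin n → ℂ)`; the algebra of
polynomial invariants is realised inside `MvPolynomial (Fin n) ℂ` as the
common equalizer of the substitution maps induced by the group elements. -/

/-- The algebra endomorphism of the polynomial ring induced by the linear action of
`g : G` on the underlying space (substitution of the variables by linear forms). -/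
noncomputable def Representation.polySubst {G : Type*} [Group G] {n : ℕ}
    (ρ : Representation ℂ G (Fin n → ℂ)) (g : G) :
    MvPolynomial (Fin n) ℂ →ₐ[ℂ] MvPolynomial (Fin n) ℂ :=
  MvPolynomial.aeval fun i =>
    ∑ j, MvPolynomial.C (LinearMap.toMatrix' (ρ g) i j) * MvPolynomial.X j

/-- The subalgebra of `G`-invariant polynomials. -/
noncomputable def Representation.invariantAlgebra {G : Type*} [Group G] {n : ℕ}
    (ρ : Representation ℂ G (Fin n → ℂ)) : Subalgebra ℂ (MvPolynomial (Fin n) ℂ) :=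
  ⨅ g : G, AlgHom.equalizer (ρ.polySubst g) (AlgHom.id ℂ (MvPolynomial (Fin n) ℂ))

/-- The invariant algebra is generated by its elements of (total) degree at most `d`. -/
def Representation.InvariantsGeneratedInDegree {G : Type*} [Group G] {n : ℕ}
    (ρ : Representation ℂ G (Fin n → ℂ)) (d : ℕ) : Prop :=
  Algebra.adjoin ℂ {f : MvPolynomial (Fin n) ℂ | f ∈ ρ.invariantAlgebra ∧ f.totalDegree ≤ d}
    = ρ.invariantAlgebra

/-- The Noether number `β(G)`: the smallest degree bound `d` such that for every
finite-dimensional `ℂG`-module the algebra of polynomial invariants is generated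
by its elements of degree at most `d`.  (Equivalently, the maximum over all
finite-dimensional modules `V` of the minimal generating degree `β(G,V)`.) -/
noncomputable def noetherNumber (G : Type*) [Group G] : ℕ :=
  sInf {d : ℕ | ∀ (n : ℕ) (ρ : Representation ℂ G (Fin n → ℂ)),
    ρ.InvariantsGeneratedInDegree d}

/-- The Noether index `n(G) = |G| / β(G)`, as a real number. -/
noncomputable def noetherIndex (G : Type*) [Group G] : ℝ :=
  (Nat.card G : ℝ) / (noetherNumber G : ℝ)

section InvariantTheory

variable {A : Type} [CommRing A] [Algebra ℂ A] {G : Type} [Group G]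

/-- The elements of `I` fixed by the action `ρ`. -/
def invariantPart (ρ : G →* (A →ₐ[ℂ] A)) (I : Submodule ℂ A) : Submodule ℂ A where
  carrier := {a | a ∈ I ∧ ∀ g, ρ g a = a}
  add_mem' := fun ha hb => ⟨I.add_mem ha.1 hb.1, fun g => by rw [map_add, ha.2, hb.2]⟩
  zero_mem' := ⟨I.zero_mem, fun g => map_zero _⟩
  smul_mem' := fun c _ ha => ⟨I.smul_mem c ha.1, fun g => by rw [map_smul, ha.2]⟩

theorem mem_invariantPart {ρ : G →* (A →ₐ[ℂ] A)} {I : Submodule ℂ A} {a : A} :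
    a ∈ invariantPart ρ I ↔ a ∈ I ∧ ∀ g, ρ g a = a := Iff.rfl

theorem invariantPart_le (ρ : G →* (A →ₐ[ℂ] A)) (I : Submodule ℂ A) : invariantPart ρ I ≤ I :=
  fun _ ha => ha.1

/-- The sum of all translates of an element under the action of a finite group. -/
noncomputable def groupTrace (ρ : G →* (A →ₐ[ℂ] A)) : A →ₗ[ℂ] A :=
  ∑ᶠ g, (ρ g).toLinearMap

theorem groupTrace_apply [Fintype G] (ρ : G →* (A →ₐ[ℂ] A)) (a : A) :
    groupTrace ρ a = ∑ g, ρ g a := by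
  simp [groupTrace, finsum_eq_sum_of_fintype, LinearMap.sum_apply]

theorem map_groupTrace [Finite G] (ρ : G →* (A →ₐ[ℂ] A)) (g : G) (a : A) :
    ρ g (groupTrace ρ a) = groupTrace ρ a := by
  have := Fintype.ofFinite G
  simp only [groupTrace_apply, map_sum]
  exact Fintype.sum_equiv (Equiv.mulLeft g) _ _ fun h => by simp

theorem groupTrace_map [Finite G] (ρ : G →* (A →ₐ[ℂ] A)) (g : G) (a : A) :
    groupTrace ρ (ρ g a) = groupTrace ρ a := by
  have := Fintype.ofFinite G
  simp only [groupTrace_apply]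
  exact Fintype.sum_equiv (Equiv.mulRight g) _ _ fun h => by simp

theorem groupTrace_mul [Finite G] (ρ : G →* (A →ₐ[ℂ] A)) {a : A} (ha : ∀ g, ρ g a = a) (b : A) :
    groupTrace ρ (a * b) = a * groupTrace ρ b := by
  have := Fintype.ofFinite G
  simp [groupTrace_apply, map_mul, ha, Finset.mul_sum]

theorem groupTrace_of_invariant [Finite G] (ρ : G →* (A →ₐ[ℂ] A)) {a : A} (ha : ∀ g, ρ g a = a) :
    groupTrace ρ a = (Nat.card G : ℂ) • a := by
  have := Fintype.ofFinite G
  simp [groupTrace_apply, ha, Nat.cast_smul_eq_nsmul]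

/-- An action stabilises a submodule. -/
def StableUnder (ρ : G →* (A →ₐ[ℂ] A)) (I : Submodule ℂ A) : Prop :=
  ∀ g, ∀ a ∈ I, ρ g a ∈ I

theorem StableUnder.groupTrace_mem [Finite G] {ρ : G →* (A →ₐ[ℂ] A)} {I : Submodule ℂ A}
    (hI : StableUnder ρ I) {a : A} (ha : a ∈ I) : groupTrace ρ a ∈ invariantPart ρ I := by
  have := Fintype.ofFinite G
  refine ⟨?_, fun g => map_groupTrace ρ g a⟩
  rw [groupTrace_apply]
  exact I.sum_mem fun g _ => hI g a ha

theorem Submodule.pow_le_of_prod_mem {M N : Submodule ℂ A} {n : ℕ}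
    (h : ∀ a : Fin n → A, (∀ i, a i ∈ M) → ∏ i, a i ∈ N) : M ^ n ≤ N := by
  rw [Submodule.pow_eq_span_pow_set, Submodule.span_le]
  intro x hx
  obtain ⟨f, rfl⟩ := Set.mem_pow.1 hx
  rw [List.prod_ofFn]
  exact h (fun i => f i) fun i => (f i).2

/-- `I` is an ideal of `A`, phrased for complex subspaces. -/
def IsIdealLike (I : Submodule ℂ A) : Prop := ⊤ * I ≤ I

theorem IsIdealLike.mul_mem {I : Submodule ℂ A} (hI : IsIdealLike I) (a : A) {b : A} (hb : b ∈ I) :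
    a * b ∈ I :=
  hI (Submodule.mul_mem_mul Submodule.mem_top hb)

theorem IsIdealLike.pow {I : Submodule ℂ A} (hI : IsIdealLike I) (n : ℕ) :
    IsIdealLike (I ^ (n + 1)) := by
  unfold IsIdealLike
  rw [pow_succ', ← mul_assoc]
  exact mul_le_mul_left hI _

theorem StableUnder.pow {ρ : G →* (A →ₐ[ℂ] A)} {I : Submodule ℂ A}
    (hI : StableUnder ρ I) (n : ℕ) : StableUnder ρ (I ^ n) := by
  intro g a ha
  have h : (I ^ n).map (ρ g).toLinearMap ≤ I ^ n := by
    rw [Submodule.map_pow]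
    refine pow_le_pow_left' ?_ n
    rintro _ ⟨b, hb, rfl⟩
    exact hI g b hb
  exact h ⟨a, ha, rfl⟩

theorem map_eq_of_mem_invariantPart_pow {ρ : G →* (A →ₐ[ℂ] A)} {I : Submodule ℂ A} {n : ℕ} {a : A}
    (ha : a ∈ invariantPart ρ I ^ n) (g : G) : ρ g a = a := by
  have h : invariantPart ρ I ^ n ≤ LinearMap.eqLocus (ρ g).toLinearMap LinearMap.id := by
    refine Submodule.pow_le_of_prod_mem fun b hb => ?_
    simp only [LinearMap.mem_eqLocus, AlgHom.toLinearMap_apply, map_prod, LinearMap.id_apply]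
    exact Finset.prod_congr rfl fun i _ => (hb i).2 g
  exact h ha

theorem groupTrace_mem_pow_succ [Finite G] {ρ : G →* (A →ₐ[ℂ] A)} {I : Submodule ℂ A}
    (hI : StableUnder ρ I) {k : ℕ} {a : A} (ha : a ∈ invariantPart ρ I ^ k * I) :
    groupTrace ρ a ∈ invariantPart ρ I ^ (k + 1) := by
  refine Submodule.mul_induction_on ha (fun b hb c hc => ?_) fun x y hx hy => ?_
  · rw [groupTrace_mul ρ (map_eq_of_mem_invariantPart_pow hb), pow_succ]
    exact Submodule.mul_mem_mul hb (hI.groupTrace_mem hc)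
  · rw [map_add]
    exact Submodule.add_mem _ hx hy

variable (G) in
/-- For every action of `G` on an algebra, averages of products of `d + 1` elements of an invariant
ideal are sums of `k + 1`-fold products of invariants of that ideal. -/
def HasNoetherBound (k d : ℕ) : Prop :=
  ∀ (A : Type) [CommRing A] [Algebra ℂ A] (ρ : G →* (A →ₐ[ℂ] A)) (I : Submodule ℂ A),
    IsIdealLike I → StableUnder ρ I → ∀ x ∈ I ^ (d + 1),
      groupTrace ρ x ∈ invariantPart ρ I ^ (k + 1)

theorem hasNoetherBound_of_subsingleton [Subsingleton G] (k : ℕ) : HasNoetherBound G k k := by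
  intro A _ _ ρ I _ _ x hx
  have hone : ∀ (g : G) (a : A), ρ g a = a := fun g a => by
    rw [Subsingleton.elim g 1, map_one]; rfl
  have : invariantPart ρ I = I := by
    ext a
    simp [mem_invariantPart, hone]
  rw [this, groupTrace_of_invariant ρ fun g => hone g x]
  exact Submodule.smul_mem _ _ hx

/-- The averaging identity behind the Noether bound. -/
theorem prod_mem_invariantPart_mul_top [Finite G] (H : Subgroup G) (ρ : G →* (A →ₐ[ℂ] A))
    {I : Submodule ℂ A} (hI : IsIdealLike I) (hρ : StableUnder ρ I) [Fintype (G ⧸ H)]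
    (a : G ⧸ H → A) (ha : ∀ i, a i ∈ invariantPart (ρ.comp H.subtype) I) :
    ∏ i, a i ∈ invariantPart ρ I * ⊤ := by
  classical
  have := Fintype.ofFinite G
  have hzero : ∀ h : G, ∏ i, (ρ h (ρ (Quotient.out i) (a i)) + -a i) = 0 := by
    intro h
    refine Finset.prod_eq_zero (Finset.mem_univ (QuotientGroup.mk h⁻¹)) ?_
    have hmem : h * Quotient.out (QuotientGroup.mk h⁻¹ : G ⧸ H) ∈ H := by
      have := QuotientGroup.eq.1 (QuotientGroup.out_eq' (QuotientGroup.mk h⁻¹ : G ⧸ H)).symm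
      simpa using this
    have := (ha (QuotientGroup.mk h⁻¹)).2 ⟨_, hmem⟩
    simp only [MonoidHom.comp_apply, Subgroup.subtype_apply, map_mul, AlgHom.mul_apply] at this
    rw [this, add_neg_cancel]
  have hsum : ∑ t ∈ (Finset.univ : Finset (G ⧸ H)).powerset,
      groupTrace ρ (∏ i ∈ t, ρ (Quotient.out i) (a i)) * ∏ i ∈ Finset.univ \ t, -a i = 0 := by
    have := Finset.sum_eq_zero fun h (_ : h ∈ (Finset.univ : Finset G)) => hzero h
    simp only [Finset.prod_add] at this
    rw [Finset.sum_comm] at this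
    rw [← this]
    refine Finset.sum_congr rfl fun t _ => ?_
    rw [groupTrace_apply, Finset.sum_mul]
    exact Finset.sum_congr rfl fun g _ => by rw [map_prod]; rfl
  rw [← Finset.add_sum_erase _ _ (Finset.empty_mem_powerset _)] at hsum
  have hrest : ∑ t ∈ (Finset.univ : Finset (G ⧸ H)).powerset.erase ∅,
      groupTrace ρ (∏ i ∈ t, ρ (Quotient.out i) (a i)) * ∏ i ∈ Finset.univ \ t, -a i
        ∈ invariantPart ρ I * ⊤ := by
    refine Submodule.sum_mem _ fun t ht => Submodule.mul_mem_mul ?_ Submodule.mem_top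
    refine hρ.groupTrace_mem ?_
    obtain ⟨i, hi⟩ := Finset.nonempty_iff_ne_empty.2 (Finset.ne_of_mem_erase ht)
    rw [← Finset.mul_prod_erase t _ hi, mul_comm]
    exact hI.mul_mem _ (hρ _ _ (ha i).1)
  have hcard : (Nat.card G : ℂ) ≠ 0 := by exact_mod_cast Nat.card_pos.ne'
  have hneg : groupTrace ρ (∏ i ∈ (∅ : Finset (G ⧸ H)), ρ (Quotient.out i) (a i)) *
      ∏ i ∈ Finset.univ \ ∅, -a i =
      ((Nat.card G : ℂ) * (-1) ^ (Fintype.card (G ⧸ H))) • ∏ i, a i := by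
    rw [Finset.prod_empty, groupTrace_of_invariant ρ (fun g => map_one (ρ g)), Finset.sdiff_empty,
      Finset.prod_neg, smul_mul_assoc, one_mul, mul_smul, Finset.card_univ]
    congr 1
    rw [Algebra.smul_def]; simp
  rw [hneg] at hsum
  have hunit : ((Nat.card G : ℂ) * (-1) ^ (Fintype.card (G ⧸ H))) ≠ 0 :=
    mul_ne_zero hcard (pow_ne_zero _ (by norm_num))
  rw [← Submodule.smul_mem_iff _ hunit, eq_neg_of_add_eq_zero_left hsum]
  exact Submodule.neg_mem _ hrest

theorem groupTrace_groupTrace_subgroup [Finite G] (H : Subgroup G) (ρ : G →* (A →ₐ[ℂ] A)) (x : A) :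
    groupTrace ρ (groupTrace (ρ.comp H.subtype) x) = (Nat.card H : ℂ) • groupTrace ρ x := by
  have := Fintype.ofFinite H
  rw [groupTrace_apply (ρ.comp H.subtype), map_sum]
  simp [groupTrace_map, Nat.cast_smul_eq_nsmul]

theorem IsIdealLike.top_pow_mul_le {I : Submodule ℂ A} (hI : IsIdealLike I) (k : ℕ) :
    ⊤ ^ k * I ≤ I := by
  induction k with
  | zero => simp
  | succ k ih =>
    rw [pow_succ, mul_assoc]
    exact (mul_le_mul_right hI _).trans ih

theorem HasNoetherBound.of_subgroup [Finite G] (H : Subgroup G) {k d : ℕ}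
    (h : HasNoetherBound H (k * H.index) d) : HasNoetherBound G k d := by
  intro A _ _ ρ I hI hρ x hx
  have := Fintype.ofFinite (G ⧸ H)
  have hH := h A (ρ.comp H.subtype) I hI (fun g => hρ g) x hx
  have hm : invariantPart (ρ.comp H.subtype) I ^ H.index ≤ invariantPart ρ I * ⊤ := by
    refine Submodule.pow_le_of_prod_mem fun a ha => ?_
    have e : G ⧸ H ≃ Fin H.index := Finite.equivFin _
    rw [← e.prod_comp]
    exact prod_mem_invariantPart_mul_top H ρ hI hρ (fun i => a (e i)) fun i => ha _
  have hle : invariantPart (ρ.comp H.subtype) I ^ (k * H.index + 1) ≤ invariantPart ρ I ^ k * I := by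
    rw [mul_comm k, pow_succ, pow_mul]
    calc _ ≤ (invariantPart ρ I * ⊤) ^ k * I :=
          mul_le_mul' (pow_le_pow_left' hm k) (invariantPart_le _ I)
      _ = invariantPart ρ I ^ k * (⊤ ^ k * I) := by rw [mul_pow, mul_assoc]
      _ ≤ invariantPart ρ I ^ k * I := mul_le_mul' le_rfl (hI.top_pow_mul_le k)
  have := groupTrace_mem_pow_succ hρ (hle hH)
  rw [groupTrace_groupTrace_subgroup] at this
  exact (Submodule.smul_mem_iff _ (by exact_mod_cast Nat.card_pos.ne')).1 this

end InvariantTheory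

section Quotient

variable {A : Type} [CommRing A] [Algebra ℂ A] {G Q : Type} [Group G] [Group Q]

/-- The subalgebra fixed by a subgroup. -/
def fixedSubalgebra (ρ : G →* (A →ₐ[ℂ] A)) (N : Subgroup G) : Subalgebra ℂ A where
  carrier := {a | ∀ n ∈ N, ρ n a = a}
  mul_mem' := fun ha hb n hn => by rw [map_mul, ha n hn, hb n hn]
  add_mem' := fun ha hb n hn => by rw [map_add, ha n hn, hb n hn]
  algebraMap_mem' := fun c n _ => (ρ n).commutes c

theorem map_mem_fixedSubalgebra (ρ : G →* (A →ₐ[ℂ] A)) (N : Subgroup G) [N.Normal] (g : G) {a : A}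
    (ha : a ∈ fixedSubalgebra ρ N) : ρ g a ∈ fixedSubalgebra ρ N := by
  intro n hn
  have h := ha _ (‹N.Normal›.conj_mem n hn g⁻¹)
  rw [inv_inv] at h
  calc ρ n (ρ g a) = ρ (g * (g⁻¹ * n * g)) a := by
        rw [← AlgHom.mul_apply, ← map_mul]; congr 2; group
    _ = ρ g a := by rw [map_mul, AlgHom.mul_apply, h]

/-- The action of the group on the fixed subalgebra of a normal subgroup. -/
def fixedAction (ρ : G →* (A →ₐ[ℂ] A)) (N : Subgroup G) [N.Normal] :
    G →* (fixedSubalgebra ρ N →ₐ[ℂ] fixedSubalgebra ρ N) where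
  toFun g := ((ρ g).comp (fixedSubalgebra ρ N).val).codRestrict _
    fun a => map_mem_fixedSubalgebra ρ N g a.2
  map_one' := by
    ext a
    simp
  map_mul' g h := by
    ext a
    exact congrArg (fun φ : A →ₐ[ℂ] A => φ a) (map_mul ρ g h)

/-- The action of a quotient group on the fixed subalgebra of the kernel. -/
noncomputable def quotientAction (ρ : G →* (A →ₐ[ℂ] A)) (π : G →* Q)
    (hπ : Function.Surjective π) :
    Q →* (fixedSubalgebra ρ π.ker →ₐ[ℂ] fixedSubalgebra ρ π.ker) :=
  (QuotientGroup.lift π.ker (fixedAction ρ π.ker) fun n hn => by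
    ext a
    exact a.2 n hn).comp (QuotientGroup.quotientKerEquivOfSurjective π hπ).symm.toMonoidHom

theorem coe_quotientAction (ρ : G →* (A →ₐ[ℂ] A)) (π : G →* Q)
    (hπ : Function.Surjective π) (g : G) (a : fixedSubalgebra ρ π.ker) :
    (quotientAction ρ π hπ (π g) a : A) = ρ g a := by
  have : (QuotientGroup.quotientKerEquivOfSurjective π hπ).symm (π g) = QuotientGroup.mk g := by
    rw [MulEquiv.symm_apply_eq]
    rfl
  simp only [quotientAction, MonoidHom.comp_apply, MulEquiv.toMonoidHom_eq_coe,
    MonoidHom.coe_coe, this]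
  rfl

theorem HasNoetherBound.of_surjective [Finite G] [Finite Q] (π : G →* Q)
    (hπ : Function.Surjective π) {k e d : ℕ} (hN : HasNoetherBound π.ker e d)
    (hQ : HasNoetherBound Q k e) : HasNoetherBound G k d := by
  intro A _ _ ρ I hI hρ x hx
  let B := fixedSubalgebra ρ π.ker
  let IB : Submodule ℂ B := I.comap B.val.toLinearMap
  have hy := hN A (ρ.comp π.ker.subtype) I hI (fun g => hρ g) x hx
  have hmap : invariantPart (ρ.comp π.ker.subtype) I ≤ IB.map B.val.toLinearMap :=
    fun a ha => ⟨⟨a, fun n hn => ha.2 ⟨n, hn⟩⟩, ha.1, rfl⟩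
  have hy' := pow_le_pow_left' hmap (e + 1) hy
  rw [← Submodule.map_pow] at hy'
  obtain ⟨y, hyI, hyx⟩ := hy'
  replace hyx : (y : A) = groupTrace (ρ.comp π.ker.subtype) x := hyx
  have hIB : IsIdealLike IB := by
    refine Submodule.mul_le.2 fun a _ b hb => hI.mul_mem _ hb
  have hρB : StableUnder (quotientAction ρ π hπ) IB := by
    intro q a ha
    obtain ⟨g, rfl⟩ := hπ q
    change (quotientAction ρ π hπ (π g) a : A) ∈ I
    rw [coe_quotientAction]
    exact hρ g _ ha
  have hz := hQ B (quotientAction ρ π hπ) IB hIB hρB y hyI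
  have hmap' : (invariantPart (quotientAction ρ π hπ) IB).map B.val.toLinearMap ≤
      invariantPart ρ I := by
    rintro _ ⟨a, ha, rfl⟩
    refine ⟨ha.1, fun g => ?_⟩
    have := congrArg Subtype.val (ha.2 (π g))
    rwa [coe_quotientAction] at this
  have hz' : ((groupTrace (quotientAction ρ π hπ) y : B) : A) ∈ invariantPart ρ I ^ (k + 1) := by
    refine pow_le_pow_left' hmap' (k + 1) ?_
    rw [← Submodule.map_pow]
    exact ⟨_, hz, rfl⟩
  have hQsum : groupTrace ρ ((groupTrace (quotientAction ρ π hπ) y : B) : A) =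
      (Nat.card Q : ℂ) • groupTrace ρ (y : A) := by
    have := Fintype.ofFinite Q
    rw [groupTrace_apply (quotientAction ρ π hπ), AddSubmonoidClass.coe_finsetSum, map_sum]
    have : ∀ q, groupTrace ρ (quotientAction ρ π hπ q y : A) = groupTrace ρ (y : A) := by
      intro q
      obtain ⟨g, rfl⟩ := hπ q
      rw [coe_quotientAction, groupTrace_map]
    simp [this, Nat.cast_smul_eq_nsmul]
  rw [groupTrace_of_invariant ρ (map_eq_of_mem_invariantPart_pow hz'), hyx,
    groupTrace_groupTrace_subgroup] at hQsum
  have h1 : (Nat.card Q : ℂ) • (Nat.card π.ker : ℂ) • groupTrace ρ x ∈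
      invariantPart ρ I ^ (k + 1) := by
    rw [← hQsum]
    exact Submodule.smul_mem _ _ hz'
  rw [Submodule.smul_mem_iff _ (by exact_mod_cast Nat.card_pos.ne'),
    Submodule.smul_mem_iff _ (by exact_mod_cast Nat.card_pos.ne')] at h1
  exact h1

theorem hasNoetherBound_mul_card [Finite G] (k : ℕ) : HasNoetherBound G k (k * Nat.card G) := by
  refine HasNoetherBound.of_subgroup ⊥ ?_
  rw [Subgroup.index_bot]
  exact hasNoetherBound_of_subsingleton _

/-- A bound for a quotient of a subgroup gives a bound for the whole group. -/
theorem HasNoetherBound.of_subquotient [Finite G] [Finite Q] (H : Subgroup G) (π : H →* Q)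
    (hπ : Function.Surjective π) {e : ℕ} (hQ : HasNoetherBound Q H.index e) :
    HasNoetherBound G 1 (e * Nat.card π.ker) := by
  refine HasNoetherBound.of_subgroup H ?_
  rw [one_mul]
  exact HasNoetherBound.of_surjective π hπ (hasNoetherBound_mul_card e) hQ

end Quotient

section PolynomialInvariants

open MvPolynomial

variable {G : Type} [Group G] {n : ℕ} (ρ : Representation ℂ G (Fin n → ℂ))

theorem polySubst_mul (g h : G) :
    ρ.polySubst (g * h) = (ρ.polySubst h).comp (ρ.polySubst g) := by
  refine MvPolynomial.algHom_ext fun i => ?_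
  simp only [Representation.polySubst, AlgHom.comp_apply, aeval_X, map_sum, map_mul,
    Module.End.mul_eq_comp, LinearMap.toMatrix'_comp, Matrix.mul_apply,
    Finset.sum_mul, Finset.mul_sum, algHom_C, algebraMap_eq, mul_assoc]
  exact Finset.sum_comm

theorem polySubst_one : ρ.polySubst 1 = AlgHom.id ℂ _ := by
  refine MvPolynomial.algHom_ext fun i => ?_
  simp [Representation.polySubst, Module.End.one_eq_id, Pi.single_apply]

/-- The substitution action, made into a left action. -/
noncomputable def substAction : G →* (MvPolynomial (Fin n) ℂ →ₐ[ℂ] MvPolynomial (Fin n) ℂ) where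
  toFun g := ρ.polySubst g⁻¹
  map_one' := by rw [inv_one, polySubst_one]; rfl
  map_mul' g h := by rw [mul_inv_rev, polySubst_mul]; rfl

theorem mem_invariantAlgebra_iff {f : MvPolynomial (Fin n) ℂ} :
    f ∈ ρ.invariantAlgebra ↔ ∀ g, substAction ρ g f = f := by
  simp only [Representation.invariantAlgebra, Algebra.mem_iInf, AlgHom.mem_equalizer]
  exact ⟨fun h g => h g⁻¹, fun h g => by simpa [substAction] using h g⁻¹⟩

theorem isHomogeneous_substAction (g : G) {m : ℕ} {f : MvPolynomial (Fin n) ℂ}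
    (hf : f.IsHomogeneous m) : (substAction ρ g f).IsHomogeneous m := by
  have := hf.aeval (fun i => ∑ j, C (LinearMap.toMatrix' (ρ g⁻¹) i j) * X j) (n := 1)
    fun i => IsHomogeneous.sum _ _ _ fun j _ => by
      simpa using (isHomogeneous_C _ _).mul (isHomogeneous_X ℂ j)
  rwa [one_mul] at this

theorem substAction_homogeneousComponent (g : G) (m : ℕ) (f : MvPolynomial (Fin n) ℂ) :
    substAction ρ g (homogeneousComponent m f) = homogeneousComponent m (substAction ρ g f) := by
  conv_rhs => rw [← sum_homogeneousComponent f, map_sum, map_sum]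
  have : ∀ i, homogeneousComponent m (substAction ρ g (homogeneousComponent i f)) =
      if m = i then substAction ρ g (homogeneousComponent i f) else 0 := fun i =>
    homogeneousComponent_of_mem
      (isHomogeneous_substAction ρ g (homogeneousComponent_isHomogeneous i f))
  simp only [this, Finset.sum_ite_eq, Finset.mem_range]
  split_ifs with h
  · rfl
  · rw [homogeneousComponent_eq_zero m f (by omega), map_zero]

variable (n) in
/-- Polynomials without constant term. -/
noncomputable def augmentation : Submodule ℂ (MvPolynomial (Fin n) ℂ) :=
  LinearMap.ker (lcoeff ℂ (0 : Fin n →₀ ℕ))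

theorem mem_augmentation {f : MvPolynomial (Fin n) ℂ} :
    f ∈ augmentation n ↔ constantCoeff f = 0 := Iff.rfl

theorem isIdealLike_augmentation : IsIdealLike (augmentation n) :=
  Submodule.mul_le.2 fun a _ b hb => by
    rw [mem_augmentation] at hb ⊢
    rw [map_mul, hb, mul_zero]

theorem stableUnder_augmentation : StableUnder (substAction ρ) (augmentation n) := by
  intro g a ha
  rw [mem_augmentation] at ha ⊢
  rw [← ha]
  clear ha
  induction a using MvPolynomial.induction_on with
  | C r => rw [← algebraMap_eq, AlgHom.commutes]
  | add p q hp hq => rw [map_add, map_add, map_add, hp, hq]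
  | mul_X p i hp =>
    have hX : substAction ρ g (X i) =
        ∑ j, C (LinearMap.toMatrix' (ρ g⁻¹) i j) * X j := aeval_X _ _
    rw [map_mul, map_mul, map_mul, hX, map_sum]
    simp

theorem monomial_mem_augmentation_pow (s : Fin n →₀ ℕ) :
    monomial s (1 : ℂ) ∈ augmentation n ^ s.degree := by
  induction s using Finsupp.induction_linear with
  | zero => simp [Submodule.one_le.1 le_rfl]
  | add s t hs ht =>
    have : monomial (s + t) (1 : ℂ) = monomial s 1 * monomial t 1 := by simp
    rw [this, map_add, pow_add]
    exact Submodule.mul_mem_mul hs ht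
  | single i k =>
    rw [Finsupp.degree_single, ← X_pow_eq_monomial]
    exact Submodule.pow_mem_pow _ (by simp [mem_augmentation]) k

theorem IsIdealLike.pow_le_pow {A : Type} [CommRing A] [Algebra ℂ A] {I : Submodule ℂ A}
    (hI : IsIdealLike I) {m k : ℕ} (h : k + 1 ≤ m) : I ^ m ≤ I ^ (k + 1) := by
  obtain ⟨j, rfl⟩ := Nat.exists_eq_add_of_le h
  rw [add_comm, pow_add]
  exact (mul_le_mul_left le_top _).trans (hI.pow k)

theorem IsHomogeneous.mem_augmentation_pow {f : MvPolynomial (Fin n) ℂ} {m d : ℕ}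
    (hf : f.IsHomogeneous m) (hd : d + 1 ≤ m) : f ∈ augmentation n ^ (d + 1) := by
  rw [f.as_sum]
  refine Submodule.sum_mem _ fun s hs => ?_
  have hdeg : s.degree = m := by
    rw [Finsupp.degree_eq_weight_one]
    exact hf (mem_support_iff.1 hs)
  have h1 : monomial s (coeff s f) = coeff s f • monomial s (1 : ℂ) := by simp [smul_monomial]
  rw [h1]
  refine Submodule.smul_mem _ _ ?_
  exact isIdealLike_augmentation.pow_le_pow (hdeg ▸ hd) (monomial_mem_augmentation_pow s)

theorem HasNoetherBound.invariantsGeneratedInDegree [Finite G] {d : ℕ} (h : HasNoetherBound G 1 d) :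
    ρ.InvariantsGeneratedInDegree d := by
  set R := Algebra.adjoin ℂ
    {f : MvPolynomial (Fin n) ℂ | f ∈ ρ.invariantAlgebra ∧ f.totalDegree ≤ d} with hR
  have key : ∀ m, ∀ f : MvPolynomial (Fin n) ℂ, f.IsHomogeneous m →
      (∀ g, substAction ρ g f = f) → f ∈ R := by
    intro m
    induction m using Nat.strong_induction_on with
    | _ m ih =>
    intro f hf hinv
    rcases le_or_gt m d with hmd | hmd
    · exact Algebra.subset_adjoin
        ⟨(mem_invariantAlgebra_iff ρ).2 hinv, hf.totalDegree_le.trans hmd⟩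
    have hcomp : ∀ x ∈ invariantPart (substAction ρ) (augmentation n) ^ 2,
        homogeneousComponent m x ∈ R := by
      intro x hx
      rw [pow_two] at hx
      refine Submodule.mul_induction_on hx (fun a ha b hb => ?_) fun x y hx hy => ?_
      · have hc : ∀ a ∈ invariantPart (substAction ρ) (augmentation n), ∀ i,
            (∀ g, substAction ρ g (homogeneousComponent i a) = homogeneousComponent i a) ∧
            (i = 0 → homogeneousComponent i a = 0) := by
          intro a ha i
          refine ⟨fun g => by rw [substAction_homogeneousComponent, ha.2], ?_⟩
          rintro rfl
          have h0 : coeff 0 a = 0 := ha.1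
          rw [homogeneousComponent_zero, h0, C_0]
        rw [← sum_homogeneousComponent a, ← sum_homogeneousComponent b, Finset.sum_mul_sum,
          map_sum]
        refine Subalgebra.sum_mem _ fun i _ => ?_
        rw [map_sum]
        refine Subalgebra.sum_mem _ fun j _ => ?_
        rw [homogeneousComponent_of_mem ((homogeneousComponent_isHomogeneous i a).mul
          (homogeneousComponent_isHomogeneous j b))]
        split_ifs with hij
        · rcases Nat.eq_zero_or_pos i with hi | hi
          · rw [(hc a ha i).2 hi, zero_mul]; exact Subalgebra.zero_mem _
          rcases Nat.eq_zero_or_pos j with hj | hj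
          · rw [(hc b hb j).2 hj, mul_zero]; exact Subalgebra.zero_mem _
          exact Subalgebra.mul_mem _
            (ih i (by omega) _ (homogeneousComponent_isHomogeneous i a) (hc a ha i).1)
            (ih j (by omega) _ (homogeneousComponent_isHomogeneous j b) (hc b hb j).1)
        · exact Subalgebra.zero_mem _
      · rw [map_add]
        exact Subalgebra.add_mem _ hx hy
    have h1 := hcomp _ (h _ (substAction ρ) _ isIdealLike_augmentation
      (stableUnder_augmentation ρ) f (IsHomogeneous.mem_augmentation_pow hf hmd))
    rw [groupTrace_of_invariant _ hinv, map_smul, homogeneousComponent_eq_self hf] at h1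
    have h2 := Subalgebra.smul_mem _ h1 (Nat.card G : ℂ)⁻¹
    rwa [inv_smul_smul₀ (by exact_mod_cast Nat.card_pos.ne')] at h2
  refine le_antisymm (Algebra.adjoin_le fun f hf => hf.1) fun f hf => ?_
  rw [mem_invariantAlgebra_iff] at hf
  rw [← sum_homogeneousComponent f]
  exact Subalgebra.sum_mem _ fun i _ => key i _ (homogeneousComponent_isHomogeneous i f)
    fun g => by rw [substAction_homogeneousComponent, hf]

theorem HasNoetherBound.noetherNumber_le [Finite G] {d : ℕ} (h : HasNoetherBound G 1 d) :
    noetherNumber G ≤ d :=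
  Nat.sInf_le fun _ ρ => h.invariantsGeneratedInDegree ρ

theorem noetherNumber_pos (G : Type) [Group G] [Finite G] : 0 < noetherNumber G := by
  have hne : {d : ℕ | ∀ (n : ℕ) (ρ : Representation ℂ G (Fin n → ℂ)),
      ρ.InvariantsGeneratedInDegree d}.Nonempty :=
    ⟨_, fun _ ρ => (hasNoetherBound_mul_card 1).invariantsGeneratedInDegree ρ⟩
  refine Nat.pos_of_ne_zero fun h0 => ?_
  have h := Nat.sInf_mem hne 1 (Representation.trivial ℂ G (Fin 1 → ℂ))
  have h0' : sInf {d : ℕ | ∀ (n : ℕ) (ρ : Representation ℂ G (Fin n → ℂ)),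
      ρ.InvariantsGeneratedInDegree d} = 0 := h0
  rw [h0'] at h
  have hX : (X 0 : MvPolynomial (Fin 1) ℂ) ∈
      (Representation.trivial ℂ G (Fin 1 → ℂ)).invariantAlgebra := by
    rw [mem_invariantAlgebra_iff]
    intro g
    simp [substAction, Representation.polySubst]
  rw [← show _ = _ from h] at hX
  have hle : Algebra.adjoin ℂ {f : MvPolynomial (Fin 1) ℂ |
      f ∈ (Representation.trivial ℂ G (Fin 1 → ℂ)).invariantAlgebra ∧ f.totalDegree ≤ 0} ≤ ⊥ := by
    refine Algebra.adjoin_le fun f hf => ?_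
    rw [totalDegree_eq_zero_iff_eq_C.1 (Nat.le_zero.1 hf.2)]
    exact Subalgebra.algebraMap_mem _ _
  obtain ⟨c, hc⟩ := Algebra.mem_bot.1 (hle hX)
  have := congrArg totalDegree hc
  rw [algebraMap_eq, totalDegree_C, totalDegree_X] at this
  omega

end PolynomialInvariants

section ZeroSum

open Finset

theorem exists_zero_sum_of_card {p r : ℕ} [Fact p.Prime] {ι : Type} (s : Finset ι)
    (f : ι → Fin r → ZMod p) (hs : r * (p - 1) < #s) :
    ∃ t ⊆ s, t.Nonempty ∧ ∑ i ∈ t, f i = 0 := by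
  classical
  have hp : p - 1 ≠ 0 := by have := (Fact.out : p.Prime).two_le; omega
  let P : Fin r → MvPolynomial s (ZMod p) := fun j =>
    ∑ i : s, MvPolynomial.C (f i j) * MvPolynomial.X i ^ (p - 1)
  have hdeg : ∀ j, (P j).totalDegree ≤ p - 1 := by
    intro j
    refine MvPolynomial.totalDegree_finsetSum_le fun i _ => ?_
    refine (MvPolynomial.totalDegree_mul _ _).trans ?_
    rw [MvPolynomial.totalDegree_C, zero_add]
    exact (MvPolynomial.totalDegree_X_pow _ _).le
  have hlt : ∑ j, (P j).totalDegree < Fintype.card s := by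
    refine (Finset.sum_le_sum fun j _ => hdeg j).trans_lt ?_
    simpa using hs
  have hdvd := char_dvd_card_solutions_of_fintype_sum_lt p hlt
  have heval : ∀ (x : s → ZMod p) j, MvPolynomial.eval x (P j) =
      ∑ i : s, f i j * x i ^ (p - 1) := by
    intro x j
    simp [P]
  let z : {x : s → ZMod p // ∀ j, MvPolynomial.eval x (P j) = 0} := ⟨0, fun j => by
    rw [heval]; simp [hp]⟩
  have hcard : 1 < Fintype.card {x : s → ZMod p // ∀ j, MvPolynomial.eval x (P j) = 0} :=
    (Fact.out : p.Prime).one_lt.trans_le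
      (Nat.le_of_dvd (Fintype.card_pos_iff.2 ⟨z⟩) (by convert hdvd))
  obtain ⟨⟨x, hx⟩, hxz⟩ := Fintype.exists_ne_of_one_lt_card hcard z
  have hx0 : x ≠ 0 := fun h => hxz (Subtype.ext h)
  obtain ⟨i₀, hi₀⟩ := Function.ne_iff.1 hx0
  refine ⟨(univ.filter fun i : s => x i ≠ 0).map ⟨Subtype.val, Subtype.val_injective⟩, ?_, ?_, ?_⟩
  · intro i hi
    simp only [mem_map] at hi
    obtain ⟨j, -, rfl⟩ := hi
    exact j.2
  · exact ⟨i₀, by simpa using hi₀⟩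
  · ext j
    have := hx j
    rw [heval] at this
    rw [sum_map, sum_filter, Finset.sum_apply, Pi.zero_apply]
    refine Eq.trans ?_ this
    refine Finset.sum_congr rfl fun i _ => ?_
    by_cases hi : x i = 0
    · simp [hi, hp]
    · simp [hi, ZMod.pow_card_sub_one_eq_one hi]

theorem exists_zero_sum_ssubset_of_card {p r : ℕ} [Fact p.Prime] {ι : Type} [DecidableEq ι]
    (s : Finset ι) (f : ι → Fin r → ZMod p) (hs : r * (p - 1) + 1 < #s) :
    ∃ t ⊆ s, t.Nonempty ∧ (s \ t).Nonempty ∧ ∑ i ∈ t, f i = 0 := by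
  obtain ⟨i, hi⟩ := card_pos.1 (Nat.zero_lt_of_lt hs)
  obtain ⟨t, hts, ht, h0⟩ := exists_zero_sum_of_card (s.erase i) f (by
    rw [card_erase_of_mem hi]; omega)
  refine ⟨t, hts.trans (erase_subset _ _), ht, ⟨i, mem_sdiff.2 ⟨hi, fun h => ?_⟩⟩, h0⟩
  exact notMem_erase i s (hts h)

theorem exists_short_zero_sum_plane {p : ℕ} [Fact p.Prime] {ι : Type} (s : Finset ι)
    (f : ι → Fin 2 → ZMod p) (hs : 3 * p - 2 ≤ #s) :
    ∃ t ⊆ s, t.Nonempty ∧ #t ≤ p ∧ ∑ i ∈ t, f i = 0 := by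
  classical
  have hp := (Fact.out : p.Prime).two_le
  obtain ⟨s', hs's, hs'⟩ := exists_subset_card_eq hs
  obtain ⟨t, hts, ht, h0⟩ := exists_zero_sum_of_card s'
    (fun i => Fin.cons 1 (f i) : ι → Fin 3 → ZMod p) (by omega)
  have hsum : ∑ i ∈ t, f i = 0 := by
    ext j
    have := congrFun h0 j.succ
    simpa [Finset.sum_apply] using this
  have hcard : p ∣ #t := by
    have := congrFun h0 0
    rw [← ZMod.natCast_eq_zero_iff]
    simpa [Finset.sum_apply] using this
  have hle : #t ≤ 3 * p - 2 := hs' ▸ card_le_card hts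
  obtain ⟨c, hc⟩ := hcard
  have hc3 : c < 3 := by
    by_contra! h
    have := Nat.mul_le_mul_left p h
    omega
  by_cases h1 : #t ≤ p
  · exact ⟨t, hts.trans hs's, ht, h1, hsum⟩
  have hc2 : c = 2 := by
    interval_cases c <;> omega
  subst hc2
  obtain ⟨u, hut, hu, hu', hu0⟩ := exists_zero_sum_ssubset_of_card t f (by omega)
  have hadd := card_sdiff_add_card_eq_card hut
  by_cases h2 : #u ≤ p
  · exact ⟨u, hut.trans (hts.trans hs's), hu, h2, hu0⟩
  · refine ⟨t \ u, sdiff_subset.trans (hts.trans hs's), hu', by omega, ?_⟩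
    have := sum_sdiff (f := f) hut
    rwa [hu0, add_zero, hsum] at this

theorem exists_short_zero_sum_cube {ι : Type} (s : Finset ι)
    (f : ι → Fin 3 → ZMod 2) (hs : 9 ≤ #s) :
    ∃ t ⊆ s, t.Nonempty ∧ #t ≤ 2 ∧ ∑ i ∈ t, f i = 0 := by
  classical
  obtain ⟨x, hx, y, hy, hxy, h⟩ := exists_ne_map_eq_of_card_lt_of_maps_to
    (s := s) (t := univ) (f := f) (by simp [Fintype.card_pi]; omega) (by simp)
  refine ⟨{x, y}, by simp [insert_subset_iff, hx, hy], by simp, card_le_two, ?_⟩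
  rw [sum_pair hxy, h]
  ext j
  exact CharTwo.add_self_eq_zero _

end ZeroSum

section ElementaryAbelian

open Finset
open scoped Pointwise

variable {A : Type} [CommRing A] [Algebra ℂ A] {p r : ℕ} [NeZero p]

/-- `a` is an eigenvector of weight `χ` for an elementary abelian group. -/
def IsWeightVector (ρ : Multiplicative (Fin r → ZMod p) →* (A →ₐ[ℂ] A)) (χ : Fin r → ZMod p)
    (a : A) : Prop :=
  ∀ v, ρ (Multiplicative.ofAdd v) a = ZMod.stdAddChar (χ ⬝ᵥ v) • a

theorem stdAddChar_sum {ι : Type} (s : Finset ι) (f : ι → ZMod p) :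
    (ZMod.stdAddChar (∑ i ∈ s, f i) : ℂ) = ∏ i ∈ s, ZMod.stdAddChar (f i) := by
  classical
  induction s using Finset.induction_on with
  | empty => simp
  | insert i s hi ih => rw [sum_insert hi, prod_insert hi, AddChar.map_add_eq_mul, ih]

theorem IsWeightVector.prod {ρ : Multiplicative (Fin r → ZMod p) →* (A →ₐ[ℂ] A)} {ι : Type}
    {s : Finset ι} {χ : ι → Fin r → ZMod p} {a : ι → A}
    (h : ∀ i ∈ s, IsWeightVector ρ (χ i) (a i)) :
    IsWeightVector ρ (∑ i ∈ s, χ i) (∏ i ∈ s, a i) := by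
  intro v
  rw [map_prod, Finset.prod_congr rfl fun i hi => h i hi v, sum_dotProduct, Finset.prod_smul,
    stdAddChar_sum]

theorem sum_stdAddChar_dotProduct (v : Fin r → ZMod p) :
    ∑ χ : Fin r → ZMod p, (ZMod.stdAddChar (χ ⬝ᵥ v) : ℂ) =
      if v = 0 then (p : ℂ) ^ r else 0 := by
  classical
  have hprod : ∀ χ : Fin r → ZMod p, (ZMod.stdAddChar (χ ⬝ᵥ v) : ℂ) =
      ∏ j, ZMod.stdAddChar (χ j * v j) := by
    intro χ
    rw [dotProduct, stdAddChar_sum]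
  simp only [hprod]
  have := (Finset.prod_univ_sum (fun _ : Fin r => (univ : Finset (ZMod p)))
    fun j c => (ZMod.stdAddChar (c * v j) : ℂ))
  rw [Fintype.piFinset_univ] at this
  rw [← this]
  have hone : ∀ j, ∑ c : ZMod p, (ZMod.stdAddChar (c * v j) : ℂ) = if v j = 0 then (p : ℂ) else 0 := by
    intro j
    simpa using AddChar.sum_mulShift (v j) (ZMod.isPrimitive_stdAddChar p)
  simp only [hone]
  split_ifs with h
  · simp [h]
  · obtain ⟨j, hj⟩ := Function.ne_iff.1 h
    exact Finset.prod_eq_zero (mem_univ j) (if_neg hj)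

theorem mem_span_weightVectors (ρ : Multiplicative (Fin r → ZMod p) →* (A →ₐ[ℂ] A))
    {I : Submodule ℂ A} (hρ : StableUnder ρ I) {a : A} (ha : a ∈ I) :
    a ∈ Submodule.span ℂ {x | x ∈ I ∧ ∃ χ, IsWeightVector ρ χ x} := by
  let P : (Fin r → ZMod p) → A := fun χ =>
    ∑ v, (ZMod.stdAddChar (χ ⬝ᵥ -v) : ℂ) • ρ (Multiplicative.ofAdd v) a
  have hP : ∀ χ, P χ ∈ Submodule.span ℂ {x | x ∈ I ∧ ∃ χ, IsWeightVector ρ χ x} := by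
    refine fun χ => Submodule.subset_span ⟨I.sum_mem fun v _ => I.smul_mem _ (hρ _ _ ha), χ, ?_⟩
    intro w
    simp only [P, map_sum, Finset.smul_sum, map_smul]
    refine Fintype.sum_equiv (Equiv.addLeft w) _ _ fun v => ?_
    rw [← AlgHom.mul_apply, ← map_mul, ← ofAdd_add, smul_smul, ← AddChar.map_add_eq_mul,
      ← dotProduct_add]
    simp
  have hsum : ∑ χ, P χ = ((p : ℂ) ^ r) • a := by
    simp only [P]
    rw [Finset.sum_comm]
    simp only [← Finset.sum_smul, sum_stdAddChar_dotProduct]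
    simp
  have hp : (p : ℂ) ^ r ≠ 0 := pow_ne_zero _ (by exact_mod_cast NeZero.ne p)
  rw [← Submodule.smul_mem_iff _ hp, ← hsum]
  exact Submodule.sum_mem _ fun χ _ => hP χ

theorem IsWeightVector.mem_invariantPart {ρ : Multiplicative (Fin r → ZMod p) →* (A →ₐ[ℂ] A)}
    {I : Submodule ℂ A} {a : A} (h : IsWeightVector ρ 0 a) (ha : a ∈ I) :
    a ∈ invariantPart ρ I :=
  ⟨ha, fun g => by simpa using h g.toAdd⟩

theorem IsIdealLike.prod_mem {I : Submodule ℂ A} (hI : IsIdealLike I) {ι : Type} {s : Finset ι}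
    (hs : s.Nonempty) {a : ι → A} (ha : ∀ i ∈ s, a i ∈ I) : ∏ i ∈ s, a i ∈ I := by
  classical
  obtain ⟨i, hi⟩ := hs
  rw [← Finset.prod_erase_mul s _ hi]
  exact hI.mul_mem _ (ha i hi)

theorem prod_weightVectors_mem {ρ : Multiplicative (Fin r → ZMod p) →* (A →ₐ[ℂ] A)}
    {I : Submodule ℂ A} (hI : IsIdealLike I) {ℓ c : ℕ} {ι : Type} {a : ι → A}
    {χ : ι → Fin r → ZMod p} (ha : ∀ i, a i ∈ I) (hχ : ∀ i, IsWeightVector ρ (χ i) (a i))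
    (hshort : ∀ s : Finset ι, 2 * ℓ + c ≤ #s →
      ∃ t ⊆ s, t.Nonempty ∧ #t ≤ ℓ ∧ ∑ i ∈ t, χ i = 0)
    (hsplit : ∀ s : Finset ι, ℓ + c ≤ #s →
      ∃ t ⊆ s, t.Nonempty ∧ (∃ i ∈ s, i ∉ t) ∧ ∑ i ∈ t, χ i = 0)
    (k : ℕ) (s : Finset ι) (hs : ℓ * (k + 1) + c ≤ #s) (h0 : ∑ i ∈ s, χ i = 0) :
    ∏ i ∈ s, a i ∈ invariantPart ρ I ^ (k + 2) := by
  classical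
  have hJ : ∀ t : Finset ι, t.Nonempty → ∑ i ∈ t, χ i = 0 → ∏ i ∈ t, a i ∈ invariantPart ρ I := by
    intro t ht ht0
    refine IsWeightVector.mem_invariantPart ?_ (hI.prod_mem ht fun i _ => ha i)
    rw [← ht0]
    exact IsWeightVector.prod fun i _ => hχ i
  have hcompl : ∀ s t : Finset ι, t ⊆ s → ∑ i ∈ s, χ i = 0 → ∑ i ∈ t, χ i = 0 →
      ∑ i ∈ s \ t, χ i = 0 := by
    intro s t hts hs ht
    have := sum_sdiff (f := χ) hts
    rwa [ht, add_zero, hs] at this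
  induction k generalizing s with
  | zero =>
    obtain ⟨t, hts, ht, ⟨i, hi, hit⟩, ht0⟩ := hsplit s (by simpa using hs)
    rw [← prod_sdiff hts, zero_add, pow_two]
    exact Submodule.mul_mem_mul (hJ _ ⟨i, mem_sdiff.2 ⟨hi, hit⟩⟩ (hcompl s t hts h0 ht0))
      (hJ t ht ht0)
  | succ k ih =>
    have h1 : ℓ * (k + 1 + 1) = ℓ * (k + 1) + ℓ := by ring
    have h2 : ℓ * (k + 1) = ℓ * k + ℓ := by ring
    obtain ⟨t, hts, ht, htl, ht0⟩ := hshort s (by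
      have := Nat.zero_le (ℓ * k)
      omega)
    have hcard := card_sdiff_add_card_eq_card hts
    rw [← prod_sdiff hts, pow_succ]
    exact Submodule.mul_mem_mul (ih _ (by omega) (hcompl s t hts h0 ht0)) (hJ t ht ht0)

theorem groupTrace_eq_zero_of_weight {ρ : Multiplicative (Fin r → ZMod p) →* (A →ₐ[ℂ] A)}
    {χ : Fin r → ZMod p} {a : A} (h : IsWeightVector ρ χ a) (hχ : χ ≠ 0) :
    groupTrace ρ a = 0 := by
  rw [groupTrace_apply, ← (Multiplicative.ofAdd (α := Fin r → ZMod p)).sum_comp]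
  simp only [h _]
  rw [← Finset.sum_smul]
  have := sum_stdAddChar_dotProduct χ
  rw [if_neg hχ] at this
  simp only [dotProduct_comm χ, this, zero_smul]

theorem hasNoetherBound_elementaryAbelian {ℓ c : ℕ} (hc : 0 < c)
    (hshort : ∀ {ι : Type} (s : Finset ι) (χ : ι → Fin r → ZMod p), 2 * ℓ + c ≤ #s →
      ∃ t ⊆ s, t.Nonempty ∧ #t ≤ ℓ ∧ ∑ i ∈ t, χ i = 0)
    (hsplit : ∀ {ι : Type} (s : Finset ι) (χ : ι → Fin r → ZMod p), ℓ + c ≤ #s →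
      ∃ t ⊆ s, t.Nonempty ∧ (∃ i ∈ s, i ∉ t) ∧ ∑ i ∈ t, χ i = 0)
    {k : ℕ} (hk : 0 < k) :
    HasNoetherBound (Multiplicative (Fin r → ZMod p)) k (ℓ * k + c - 1) := by
  intro A _ _ ρ I hI hρ x hx
  obtain ⟨k, rfl⟩ := Nat.exists_eq_add_of_le' hk
  rw [Nat.sub_add_cancel (by omega)] at hx
  have hle : I ≤ Submodule.span ℂ {x | x ∈ I ∧ ∃ χ, IsWeightVector ρ χ x} :=
    fun a ha => mem_span_weightVectors ρ hρ ha
  have hx' := pow_le_pow_left' hle _ hx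
  rw [Submodule.span_pow] at hx'
  suffices h : Submodule.span ℂ ({x | x ∈ I ∧ ∃ χ, IsWeightVector ρ χ x} ^ (ℓ * (k + 1) + c)) ≤
      (invariantPart ρ I ^ (k + 1 + 1)).comap (groupTrace ρ) from h hx'
  rw [Submodule.span_le]
  intro y hy
  obtain ⟨a, rfl⟩ := Set.mem_pow.1 hy
  rw [List.prod_ofFn]
  choose χ hχ using fun i => (a i).2.2
  change groupTrace ρ _ ∈ invariantPart ρ I ^ (k + 1 + 1)
  by_cases h0 : ∑ i, χ i = 0
  · have hmem := prod_weightVectors_mem hI (fun i => (a i).2.1) hχ (fun s => hshort s χ)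
      (fun s => hsplit s χ) k univ (by simp) h0
    rw [groupTrace_of_invariant ρ (map_eq_of_mem_invariantPart_pow hmem)]
    exact Submodule.smul_mem _ _ hmem
  · rw [groupTrace_eq_zero_of_weight (IsWeightVector.prod fun i _ => hχ i) h0]
    exact Submodule.zero_mem _

theorem hasNoetherBound_plane {p : ℕ} [Fact p.Prime] {k : ℕ} (hk : 0 < k) :
    HasNoetherBound (Multiplicative (Fin 2 → ZMod p)) k (p * k + p - 1) := by
  classical
  have hp := (Fact.out : p.Prime).two_le
  refine hasNoetherBound_elementaryAbelian (by omega)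
    (fun s χ hs => exists_short_zero_sum_plane s χ (by omega)) (fun s χ hs => ?_) hk
  classical
  obtain ⟨t, hts, ht, ⟨i, hi⟩, h0⟩ := exists_zero_sum_ssubset_of_card s χ (by omega)
  exact ⟨t, hts, ht, ⟨i, (mem_sdiff.1 hi).1, (mem_sdiff.1 hi).2⟩, h0⟩

theorem hasNoetherBound_cube {k : ℕ} (hk : 0 < k) :
    HasNoetherBound (Multiplicative (Fin 3 → ZMod 2)) k (2 * k + 4) := by
  classical
  refine hasNoetherBound_elementaryAbelian (c := 5) (by omega)
    (fun s χ hs => exists_short_zero_sum_cube s χ (by omega)) (fun s χ hs => ?_) hk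
  classical
  obtain ⟨t, hts, ht, ⟨i, hi⟩, h0⟩ := exists_zero_sum_ssubset_of_card s χ (by omega)
  exact ⟨t, hts, ht, ⟨i, (mem_sdiff.1 hi).1, (mem_sdiff.1 hi).2⟩, h0⟩

end ElementaryAbelian

/-- Endomorphisms of an algebra satisfying the relations of the tetrahedral group, with a stable
ideal. -/
structure TetrahedralAction (A : Type) [CommRing A] [Algebra ℂ A] where
  α : A →ₐ[ℂ] A
  β : A →ₐ[ℂ] A
  σ : A →ₐ[ℂ] A
  I : Submodule ℂ A
  α_α : ∀ x, α (α x) = x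
  β_β : ∀ x, β (β x) = x
  α_β : ∀ x, α (β x) = β (α x)
  σ_α : ∀ x, σ (α x) = β (σ x)
  σ_β : ∀ x, σ (β x) = α (β (σ x))
  σ_σ_σ : ∀ x, σ (σ (σ x)) = x
  ideal : IsIdealLike I
  α_mem : ∀ x ∈ I, α x ∈ I
  β_mem : ∀ x ∈ I, β x ∈ I
  σ_mem : ∀ x ∈ I, σ x ∈ I

namespace TetrahedralAction

variable {A : Type} [CommRing A] [Algebra ℂ A] (T : TetrahedralAction A)

/-- The sign attached to a residue modulo two. -/
def sgn (a : ZMod 2) : ℂ := if a = 0 then 1 else -1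

theorem sgn_add (a b : ZMod 2) : sgn (a + b) = sgn a * sgn b := by
  have h : (1 : ZMod 2) + 1 = 0 := by decide
  have ha : a = 0 ∨ a = 1 := by revert a; decide
  have hb : b = 0 ∨ b = 1 := by revert b; decide
  rcases ha with rfl | rfl <;> rcases hb with rfl | rfl <;> simp [sgn, h]

/-- Elements of `I ^ j` of given weight for the four-group. -/
def weightPart (χ : ZMod 2 × ZMod 2) (j : ℕ) : Submodule ℂ A where
  carrier := {x | x ∈ T.I ^ j ∧ T.α x = sgn χ.1 • x ∧ T.β x = sgn χ.2 • x}
  add_mem' := fun hx hy => ⟨Submodule.add_mem _ hx.1 hy.1, by rw [map_add, hx.2.1, hy.2.1, smul_add],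
    by rw [map_add, hx.2.2, hy.2.2, smul_add]⟩
  zero_mem' := ⟨Submodule.zero_mem _, by simp, by simp⟩
  smul_mem' := fun c x hx => ⟨Submodule.smul_mem _ _ hx.1, by rw [map_smul, hx.2.1, smul_comm],
    by rw [map_smul, hx.2.2, smul_comm]⟩

variable {T}

theorem mul_mem {χ ψ : ZMod 2 × ZMod 2} {i j : ℕ} {x y : A} (hx : x ∈ T.weightPart χ i)
    (hy : y ∈ T.weightPart ψ j) : x * y ∈ T.weightPart (χ + ψ) (i + j) := by
  refine ⟨?_, ?_, ?_⟩
  · rw [pow_add]; exact Submodule.mul_mem_mul hx.1 hy.1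
  · rw [map_mul, hx.2.1, hy.2.1, Prod.fst_add, sgn_add, smul_mul_smul_comm]
  · rw [map_mul, hx.2.2, hy.2.2, Prod.snd_add, sgn_add, smul_mul_smul_comm]

theorem map_pow_mem {φ : A →ₐ[ℂ] A} (h : ∀ x ∈ T.I, φ x ∈ T.I) {j : ℕ} {x : A}
    (hx : x ∈ T.I ^ j) : φ x ∈ T.I ^ j := by
  have h : (T.I ^ j).map φ.toLinearMap ≤ T.I ^ j := by
    rw [Submodule.map_pow]
    refine pow_le_pow_left' ?_ j
    rintro _ ⟨b, hb, rfl⟩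
    exact h b hb
  exact h ⟨x, hx, rfl⟩

theorem σ_mem_weightPart {χ : ZMod 2 × ZMod 2} {j : ℕ} {x : A} (hx : x ∈ T.weightPart χ j) :
    T.σ x ∈ T.weightPart (χ.1 + χ.2, χ.1) j := by
  have hβ : T.β (T.σ x) = sgn χ.1 • T.σ x := by rw [← T.σ_α, hx.2.1, map_smul]
  refine ⟨map_pow_mem T.σ_mem hx.1, ?_, hβ⟩
  have h1 := T.σ_β x
  rw [hx.2.2, hβ, map_smul, map_smul] at h1
  have hs : sgn χ.1 * sgn χ.1 = 1 := by unfold sgn; split_ifs <;> norm_num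
  change T.α (T.σ x) = sgn (χ.1 + χ.2) • T.σ x
  rw [sgn_add, mul_smul, h1, smul_smul, hs, one_smul]

variable (T) in
/-- Powers of the endomorphism of order three. -/
def S (s : ZMod 3) : A →ₐ[ℂ] A := T.σ ^ s.val

theorem S_zero (x : A) : T.S 0 x = x := rfl

theorem S_one (x : A) : T.S 1 x = T.σ x := rfl

theorem S_two (x : A) : T.S 2 x = T.σ (T.σ x) := rfl

theorem S_S (s t : ZMod 3) (x : A) : T.S s (T.S t x) = T.S (s + t) x := by
  have h0 : ∀ y, T.S 0 y = y := S_zero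
  have h1 : ∀ y, T.S 1 y = T.σ y := S_one
  have h2 : ∀ y, T.S 2 y = T.σ (T.σ y) := S_two
  have e1 : (1 : ZMod 3) + 1 = 2 := by decide
  have e2 : (1 : ZMod 3) + 2 = 0 := by decide
  have e3 : (2 : ZMod 3) + 1 = 0 := by decide
  have e4 : (2 : ZMod 3) + 2 = 1 := by decide
  have hs : s = 0 ∨ s = 1 ∨ s = 2 := by revert s; decide
  have ht : t = 0 ∨ t = 1 ∨ t = 2 := by revert t; decide
  rcases hs with rfl | rfl | rfl <;> rcases ht with rfl | rfl | rfl <;>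
    simp [h0, h1, h2, e1, e2, e3, e4, T.σ_σ_σ]

theorem S_mem {s : ZMod 3} {j : ℕ} {x : A} (hx : x ∈ T.weightPart 0 j) :
    T.S s x ∈ T.weightPart 0 j := by
  have hs : s = 0 ∨ s = 1 ∨ s = 2 := by revert s; decide
  rcases hs with rfl | rfl | rfl
  · exact hx
  · exact σ_mem_weightPart hx
  · exact σ_mem_weightPart (σ_mem_weightPart hx)

theorem S_one_mem {j : ℕ} {x : A} (hx : x ∈ T.weightPart (0, 1) j) :
    T.S 1 x ∈ T.weightPart (1, 0) j := σ_mem_weightPart hx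

theorem S_two_mem {j : ℕ} {x : A} (hx : x ∈ T.weightPart (0, 1) j) :
    T.S 2 x ∈ T.weightPart (1, 1) j := σ_mem_weightPart (σ_mem_weightPart hx)

theorem weightPart_anti {χ : ZMod 2 × ZMod 2} {i j : ℕ} (hj : 1 ≤ j) (hij : j ≤ i) {x : A}
    (hx : x ∈ T.weightPart χ i) : x ∈ T.weightPart χ j := by
  obtain ⟨k, rfl⟩ := Nat.exists_eq_add_of_le' hj
  obtain ⟨l, rfl⟩ := Nat.exists_eq_add_of_le' hij
  refine ⟨?_, hx.2⟩
  have h := hx.1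
  rw [pow_add] at h
  exact (mul_le_mul_left le_top _).trans (T.ideal.pow k) h

variable (T) in
/-- The invariants in the ideal. -/
def K : Submodule ℂ A where
  carrier := {x | x ∈ T.I ∧ T.α x = x ∧ T.β x = x ∧ T.σ x = x}
  add_mem' := fun ⟨h1, h2, h3, h4⟩ ⟨k1, k2, k3, k4⟩ => ⟨Submodule.add_mem _ h1 k1,
    by rw [map_add, h2, k2], by rw [map_add, h3, k3], by rw [map_add, h4, k4]⟩
  zero_mem' := ⟨Submodule.zero_mem _, by simp, by simp, by simp⟩
  smul_mem' := fun c x ⟨h1, h2, h3, h4⟩ => ⟨Submodule.smul_mem _ _ h1,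
    by rw [map_smul, h2], by rw [map_smul, h3], by rw [map_smul, h4]⟩

variable (T) in
/-- Products of an invariant with an element of trivial weight and length `J`. -/
def decomposables (J : ℕ) : Submodule ℂ A := T.K * T.weightPart 0 J

theorem relation {J i l : ℕ} (hJ : 1 ≤ J) (hi : 1 ≤ i) (hl : J ≤ l) {h r : A}
    (hh : h ∈ T.weightPart 0 i) (hr : r ∈ T.weightPart 0 l) :
    T.S 0 h * r + T.S 1 h * r + T.S 2 h * r ∈ T.decomposables J := by
  rw [← add_mul, ← add_mul]
  refine Submodule.mul_mem_mul ?_ (weightPart_anti hJ hl hr)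
  have hmem : T.S 0 h + T.S 1 h + T.S 2 h ∈ T.weightPart 0 1 :=
    weightPart_anti le_rfl hi (Submodule.add_mem _ (Submodule.add_mem _ (S_mem hh) (S_mem hh))
      (S_mem hh))
  refine ⟨by simpa using hmem.1, by simpa [sgn] using hmem.2.1, by simpa [sgn] using hmem.2.2, ?_⟩
  simp only [S_zero, S_one, S_two, map_add, T.σ_σ_σ]
  ring

theorem S_mem_decomposables {J : ℕ} (s : ZMod 3) {x : A} (hx : x ∈ T.decomposables J) :
    T.S s x ∈ T.decomposables J := by
  refine Submodule.mul_induction_on hx (fun k hk y hy => ?_) fun x y hx hy => ?_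
  · have : T.S s k = k := by
      have hs : s = 0 ∨ s = 1 ∨ s = 2 := by revert s; decide
      rcases hs with rfl | rfl | rfl
      · rfl
      · exact hk.2.2.2
      · rw [S_two, hk.2.2.2, hk.2.2.2]
    rw [map_mul, this]
    exact Submodule.mul_mem_mul hk (S_mem hy)
  · rw [map_add]
    exact Submodule.add_mem _ hx hy

variable (T) in
/-- Reduction modulo decomposable elements. -/
def red (J : ℕ) : A →ₗ[ℂ] A ⧸ T.decomposables J := (T.decomposables J).mkQ

theorem red_eq_zero {J : ℕ} {x : A} : T.red J x = 0 ↔ x ∈ T.decomposables J :=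
  Submodule.Quotient.mk_eq_zero _

theorem eq_of_line_sums {V : Type} [AddCommGroup V] [Module ℂ V] (f : ZMod 3 → ZMod 3 → V)
    (hrow : ∀ i, f i 0 + f i 1 + f i 2 = 0) (hcol : ∀ j, f 0 j + f 1 j + f 2 j = 0)
    (hdiag : ∀ c, f 0 c + f 1 (c + 1) + f 2 (c + 2) = 0) (i j : ZMod 3) :
    f i j = f 0 (i + j) := by
  have e1 : (1 : ZMod 3) + 1 = 2 := by decide
  have e2 : (1 : ZMod 3) + 2 = 0 := by decide
  have e3 : (2 : ZMod 3) + 1 = 0 := by decide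
  have e4 : (2 : ZMod 3) + 2 = 1 := by decide
  have d0 := hdiag 0
  have d1 := hdiag 1
  have d2 := hdiag 2
  simp only [e1, e2, e3, e4, zero_add] at d0 d1 d2
  have r0 := hrow 0
  have r1 := hrow 1
  have r2 := hrow 2
  have c0 := hcol 0
  have c1 := hcol 1
  have c2 := hcol 2
  have hi : i = 0 ∨ i = 1 ∨ i = 2 := by revert i; decide
  have hj : j = 0 ∨ j = 1 ∨ j = 2 := by revert j; decide
  rcases hi with rfl | rfl | rfl <;> rcases hj with rfl | rfl | rfl <;>
    simp only [e1, e2, e3, e4, zero_add, add_zero]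
  · linear_combination (norm := module) (1 / 3 : ℂ) • (r1 + c0 + d2 - r0 - c1 - d1)
  · linear_combination (norm := module) (1 / 3 : ℂ) • (r1 + c1 + d0 - r0 - c2 - d2)
  · linear_combination (norm := module) (1 / 3 : ℂ) • (r1 + c2 + d1 - r0 - c0 - d0)
  · linear_combination (norm := module) (1 / 3 : ℂ) • (r2 + c0 + d1 - r0 - c2 - d2)
  · linear_combination (norm := module) (1 / 3 : ℂ) • (r2 + c1 + d2 - r0 - c0 - d0)
  · linear_combination (norm := module) (1 / 3 : ℂ) • (r2 + c2 + d0 - r0 - c1 - d1)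

/-- Modulo decomposables, shifts can be moved between two factors of trivial weight. -/
theorem red_shift {J i j l : ℕ} (hJ : 1 ≤ J) (hi : 1 ≤ i) (hj : 1 ≤ j) (hl : J ≤ l) {p q r : A}
    (hp : p ∈ T.weightPart 0 i) (hq : q ∈ T.weightPart 0 j) (hr : r ∈ T.weightPart 0 l)
    (s t : ZMod 3) : T.red J (T.S s p * T.S t q * r) = T.red J (p * T.S (s + t) q * r) := by
  have hmul : ∀ {a b : ℕ} {x y : A}, x ∈ T.weightPart 0 a → y ∈ T.weightPart 0 b →
      x * y ∈ T.weightPart 0 (a + b) := fun hx hy => mul_mem hx hy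
  refine eq_of_line_sums (fun s t => T.red J (T.S s p * T.S t q * r)) (fun s => ?_) (fun t => ?_)
    (fun c => ?_) s t
  · simp only [← map_add]
    rw [red_eq_zero]
    have := relation hJ hj (by omega) hq (hmul (S_mem (s := s) hp) hr) (J := J)
    convert this using 1
    ring
  · simp only [← map_add]
    rw [red_eq_zero]
    have := relation hJ hi (by omega) hp (hmul (S_mem (s := t) hq) hr) (J := J)
    convert this using 1
    ring
  · simp only [← map_add]
    rw [red_eq_zero]
    have := relation hJ (by omega) hl (hmul hp (S_mem (s := c) hq)) hr (J := J)
    convert this using 1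
    simp only [map_mul, S_S, zero_add, add_comm c 1, add_comm c 2]

theorem mem_of_three_red {J : ℕ} {x y z w : A} (hy : T.red J y = T.red J x)
    (hz : T.red J z = T.red J x) (hw : T.red J w = T.red J x)
    (h : y + z + w ∈ T.decomposables J) : x ∈ T.decomposables J := by
  rw [← red_eq_zero, map_add, map_add, hy, hz, hw] at h
  rw [← red_eq_zero]
  have h3 : (3 : ℂ) • T.red J x = 0 := by rw [← h]; module
  exact (smul_eq_zero.1 h3).resolve_left (by norm_num)

theorem mul_mem₀ {i j : ℕ} {x y : A} (hx : x ∈ T.weightPart 0 i)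
    (hy : y ∈ T.weightPart 0 j) : x * y ∈ T.weightPart 0 (i + j) := mul_mem hx hy

theorem red_shift_zero {J i j l : ℕ} (hJ : 1 ≤ J) (hi : 1 ≤ i) (hj : 1 ≤ j) (hl : J ≤ l)
    {p q r : A} (hp : p ∈ T.weightPart 0 i) (hq : q ∈ T.weightPart 0 j)
    (hr : r ∈ T.weightPart 0 l) {s t : ZMod 3} (hst : s + t = 0) :
    T.red J (T.S s p * T.S t q * r) = T.red J (p * q * r) := by
  rw [red_shift hJ hi hj hl hp hq hr, hst, S_zero]

theorem red_eq_mul {J i j l : ℕ} (hJ : 1 ≤ J) (hi : 1 ≤ i) (hj : 1 ≤ j) (hl : J ≤ l)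
    {p q r : A} (hp : p ∈ T.weightPart 0 i) (hq : q ∈ T.weightPart 0 j)
    (hr : r ∈ T.weightPart 0 l) {s t : ZMod 3} (hst : s + t = 0) {x y : A}
    (hx : x = T.S s p * T.S t q * r) (hy : y = p * q * r) : T.red J x = T.red J y := by
  rw [hx, hy, red_shift_zero hJ hi hj hl hp hq hr hst]

theorem mul_three_mem {J i j k l : ℕ} (hJ : 1 ≤ J) (hi : 1 ≤ i) (hj : 1 ≤ j) (hk : 1 ≤ k)
    (hijk : i + j + k ≤ 4) (hl : J + 4 ≤ i + j + k + l) {p q h r : A}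
    (hp : p ∈ T.weightPart 0 i) (hq : q ∈ T.weightPart 0 j) (hh : h ∈ T.weightPart 0 k)
    (hr : r ∈ T.weightPart 0 l) : p * q * h * r ∈ T.decomposables J := by
  have key : ∀ s : ZMod 3, s + s + s = 0 →
      T.red J (T.S s p * T.S s q * T.S s h * r) = T.red J (p * q * h * r) := by
    intro s hs
    calc T.red J (T.S s p * T.S s q * T.S s h * r)
        = T.red J (T.S s p * T.S s q * (T.S s h * r)) := by congr 1; ring
      _ = T.red J (p * T.S (s + s) q * (T.S s h * r)) :=
          red_shift hJ hi hj (by omega) hp hq (mul_mem₀ (S_mem hh) hr) s s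
      _ = T.red J (T.S (s + s) q * T.S s h * (p * r)) := by congr 1; ring
      _ = T.red J (q * h * (p * r)) :=
          red_shift_zero hJ hj hk (by omega) hq hh (mul_mem₀ hp hr) hs
      _ = _ := by congr 1; ring
  refine mem_of_three_red rfl (key 1 (by decide)) (key 2 (by decide)) ?_
  have := relation hJ (by omega) (by omega) (mul_mem₀ (mul_mem₀ hp hq) hh) hr (J := J)
  simpa only [map_mul, S_zero] using this

theorem pair_mem {i j : ℕ} {x y : A} (hx : x ∈ T.weightPart (0, 1) i)
    (hy : y ∈ T.weightPart (0, 1) j) : x * y ∈ T.weightPart 0 (i + j) := mul_mem hx hy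

theorem triple_mem {i j k : ℕ} {x y z : A} (hx : x ∈ T.weightPart (0, 1) i)
    (hy : y ∈ T.weightPart (0, 1) j) (hz : z ∈ T.weightPart (0, 1) k) :
    x * T.S 1 y * T.S 2 z ∈ T.weightPart 0 (i + j + k) :=
  mul_mem (mul_mem hx (S_one_mem hy)) (S_two_mem hz)

theorem triple_relation {J l : ℕ} (hJ : 1 ≤ J) (hl : J ≤ l) {x y z r : A}
    (hx : x ∈ T.weightPart (0, 1) 1) (hy : y ∈ T.weightPart (0, 1) 1)
    (hz : z ∈ T.weightPart (0, 1) 1) (hr : r ∈ T.weightPart 0 l) :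
    x * T.S 1 y * T.S 2 z * r + T.S 1 x * T.S 2 y * z * r + T.S 2 x * y * T.S 1 z * r ∈
      T.decomposables J := by
  have := relation hJ (by norm_num) hl (triple_mem hx hy hz) hr
  have e1 : (1 : ZMod 3) + 1 = 2 := by decide
  have e2 : (1 : ZMod 3) + 2 = 0 := by decide
  have e3 : (2 : ZMod 3) + 1 = 0 := by decide
  have e4 : (2 : ZMod 3) + 2 = 1 := by decide
  simpa only [map_mul, S_S, zero_add, e1, e2, e3, e4, S_zero] using this

theorem six_mul_mem {J k l : ℕ} (hJ : 1 ≤ J) (hl : J ≤ 2 + k + l) {x₁ x₂ x₃ x₄ x₅ x₆ h r : A}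
    (h₁ : x₁ ∈ T.weightPart (0, 1) 1) (h₂ : x₂ ∈ T.weightPart (0, 1) 1)
    (h₃ : x₃ ∈ T.weightPart (0, 1) 1) (h₄ : x₄ ∈ T.weightPart (0, 1) 1)
    (h₅ : x₅ ∈ T.weightPart (0, 1) 1) (h₆ : x₆ ∈ T.weightPart (0, 1) 1)
    (hh : h ∈ T.weightPart 0 k) (hr : r ∈ T.weightPart 0 l) :
    x₁ * x₂ * x₃ * x₄ * x₅ * x₆ * h * r ∈ T.decomposables J := by
  have hmr : ∀ {x y : A}, x ∈ T.weightPart (0, 1) 1 → y ∈ T.weightPart (0, 1) 1 →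
      x * y * h * r ∈ T.weightPart 0 (2 + k + l) :=
    fun hx hy => mul_mem₀ (mul_mem₀ (pair_mem hx hy) hh) hr
  have hrest : T.S 0 x₄ * T.S 1 x₅ * T.S 2 x₆ * h * r ∈ T.weightPart 0 (1 + 1 + 1 + k + l) :=
    mul_mem₀ (mul_mem₀ (triple_mem h₄ h₅ h₆) hh) hr
  refine mem_of_three_red ?_ ?_ ?_ (triple_relation hJ (by omega) h₁ h₂ h₃ hrest)
  · exact red_eq_mul hJ (by norm_num) (by norm_num) hl (pair_mem h₂ h₅) (pair_mem h₃ h₆)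
      (hmr h₁ h₄) (s := 1) (t := 2) (by decide) (by simp only [map_mul, S_zero]; ring) (by ring)
  · exact red_eq_mul hJ (by norm_num) (by norm_num) hl (pair_mem h₁ h₅) (pair_mem h₂ h₆)
      (hmr h₃ h₄) (s := 1) (t := 2) (by decide) (by simp only [map_mul, S_zero]; ring) (by ring)
  · exact red_eq_mul hJ (by norm_num) (by norm_num) hl (pair_mem h₁ h₆) (pair_mem h₃ h₅)
      (hmr h₂ h₄) (s := 2) (t := 1) (by decide) (by simp only [map_mul, S_zero]; ring) (by ring)

theorem three_pairs_mul_mem {J k l : ℕ} (hJ : 1 ≤ J) (hk : 1 ≤ k) (hk' : k ≤ 2)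
    (hl : J + 4 ≤ 6 + k + l) {x₁ x₂ x₃ x₄ x₅ x₆ h r : A}
    (h₁ : x₁ ∈ T.weightPart (0, 1) 1) (h₂ : x₂ ∈ T.weightPart (0, 1) 1)
    (h₃ : x₃ ∈ T.weightPart (0, 1) 1) (h₄ : x₄ ∈ T.weightPart (0, 1) 1)
    (h₅ : x₅ ∈ T.weightPart (0, 1) 1) (h₆ : x₆ ∈ T.weightPart (0, 1) 1)
    (hh : h ∈ T.weightPart 0 k) (hr : r ∈ T.weightPart 0 l) (a b c : ZMod 3) :
    T.S a (x₁ * x₂) * T.S b (x₃ * x₄) * T.S c (x₅ * x₆) * h * r ∈ T.decomposables J := by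
  have p := pair_mem h₁ h₂
  have q := pair_mem h₃ h₄
  have w := pair_mem h₅ h₆
  rw [← red_eq_zero]
  calc T.red J (T.S a (x₁ * x₂) * T.S b (x₃ * x₄) * T.S c (x₅ * x₆) * h * r)
      = T.red J (T.S a (x₁ * x₂) * T.S 0 h * (T.S b (x₃ * x₄) * T.S c (x₅ * x₆) * r)) := by
        rw [S_zero]; congr 1; ring
    _ = T.red J (x₁ * x₂ * T.S (a + 0) h * (T.S b (x₃ * x₄) * T.S c (x₅ * x₆) * r)) :=
        red_shift hJ (by norm_num) hk (by omega) p hh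
          (mul_mem₀ (mul_mem₀ (S_mem q) (S_mem w)) hr) a 0
    _ = T.red J (T.S b (x₃ * x₄) * T.S (a + 0) h * (x₁ * x₂ * T.S c (x₅ * x₆) * r)) := by
        congr 1; ring
    _ = T.red J (x₃ * x₄ * T.S (b + (a + 0)) h * (x₁ * x₂ * T.S c (x₅ * x₆) * r)) :=
        red_shift hJ (by norm_num) hk (by omega) q hh (mul_mem₀ (mul_mem₀ p (S_mem w)) hr) _ _
    _ = T.red J (T.S c (x₅ * x₆) * T.S (b + (a + 0)) h * (x₁ * x₂ * (x₃ * x₄) * r)) := by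
        congr 1; ring
    _ = T.red J (x₅ * x₆ * T.S (c + (b + (a + 0))) h * (x₁ * x₂ * (x₃ * x₄) * r)) :=
        red_shift hJ (by norm_num) hk (by omega) w hh (mul_mem₀ (mul_mem₀ p q) hr) _ _
    _ = T.red J (x₁ * x₂ * x₃ * x₄ * x₅ * x₆ * T.S (c + (b + (a + 0))) h * r) := by
        congr 1; ring
    _ = 0 := red_eq_zero.2 (six_mul_mem hJ (by omega) h₁ h₂ h₃ h₄ h₅ h₆ (S_mem hh) hr)

theorem red_exchange {J l : ℕ} (hJ : 1 ≤ J) (hl : J ≤ 3 + l) {x y z w e f c r : A}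
    (hx : x ∈ T.weightPart (0, 1) 1) (hy : y ∈ T.weightPart (0, 1) 1)
    (hz : z ∈ T.weightPart (0, 1) 1) (hw : w ∈ T.weightPart (0, 1) 1)
    (he : e ∈ T.weightPart (0, 1) 1) (hf : f ∈ T.weightPart (0, 1) 1)
    (hc : c ∈ T.weightPart (0, 1) 1) (hr : r ∈ T.weightPart 0 l) :
    T.red J (T.S 1 x * T.S 2 y * (c * z * w * e * f * r)) =
      T.red J (T.S 1 z * T.S 2 w * (c * x * y * e * f * r)) := by
  have hm : ∀ {u v : A}, u ∈ T.weightPart (0, 1) 1 → v ∈ T.weightPart (0, 1) 1 →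
      c * T.S 1 u * T.S 2 v * r ∈ T.weightPart 0 (1 + 1 + 1 + l) :=
    fun hu hv => mul_mem₀ (triple_mem hc hu hv) hr
  have h1 := red_shift_zero hJ (by norm_num) (by norm_num) hl (pair_mem he hz) (pair_mem hf hw)
    (hm hx hy) (s := 1) (t := 2) (by decide)
  have h2 := red_shift_zero hJ (by norm_num) (by norm_num) hl (pair_mem hx he) (pair_mem hy hf)
    (hm hz hw) (s := 1) (t := 2) (by decide)
  calc _ = T.red J (e * z * (f * w) * (c * T.S 1 x * T.S 2 y * r)) := by congr 1; ring
    _ = _ := h1.symm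
    _ = T.red J (T.S 1 (x * e) * T.S 2 (y * f) * (c * T.S 1 z * T.S 2 w * r)) := by
        simp only [map_mul]; congr 1; ring
    _ = _ := h2
    _ = _ := by congr 1; ring

theorem seven_mul_mem {J l : ℕ} (hJ : 1 ≤ J) (hl : J ≤ 3 + l) {x₁ x₂ x₃ x₄ x₅ x₆ x₇ r : A}
    (h₁ : x₁ ∈ T.weightPart (0, 1) 1) (h₂ : x₂ ∈ T.weightPart (0, 1) 1)
    (h₃ : x₃ ∈ T.weightPart (0, 1) 1) (h₄ : x₄ ∈ T.weightPart (0, 1) 1)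
    (h₅ : x₅ ∈ T.weightPart (0, 1) 1) (h₆ : x₆ ∈ T.weightPart (0, 1) 1)
    (h₇ : x₇ ∈ T.weightPart (0, 1) 1) (hr : r ∈ T.weightPart 0 l) :
    x₁ * T.S 1 x₂ * T.S 2 x₃ * x₄ * x₅ * x₆ * x₇ * r ∈ T.decomposables J := by
  have hrest : x₄ * x₅ * (x₆ * x₇) * r ∈ T.weightPart 0 (2 + 2 + l) :=
    mul_mem₀ (mul_mem₀ (pair_mem h₄ h₅) (pair_mem h₆ h₇)) hr
  have hcomm : ∀ {x y : A}, x = y → T.red J x = T.red J y := fun h => by rw [h]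
  have hbase := red_exchange hJ hl h₂ h₃ h₅ h₇ h₄ h₆ h₁ hr
  have h12 := red_exchange hJ hl h₁ h₂ h₅ h₇ h₄ h₆ h₃ hr
  have h31 := red_exchange hJ hl h₃ h₁ h₅ h₇ h₄ h₆ h₂ hr
  refine mem_of_three_red ?_ ?_ ?_ (triple_relation hJ (by omega) h₁ h₂ h₃ hrest)
  · exact hcomm (by ring)
  · refine (hcomm (by ring)).trans (h12.trans ((hcomm (by ring)).trans (hbase.symm.trans
      (hcomm (by ring)))))
  · refine (hcomm (by ring)).trans (h31.trans ((hcomm (by ring)).trans (hbase.symm.trans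
      (hcomm (by ring)))))

theorem triple_mul_pairs_mem {J l : ℕ} (hJ : 1 ≤ J) (hl : J ≤ 3 + l)
    {x₁ x₂ x₃ x₄ x₅ x₆ x₇ r : A}
    (h₁ : x₁ ∈ T.weightPart (0, 1) 1) (h₂ : x₂ ∈ T.weightPart (0, 1) 1)
    (h₃ : x₃ ∈ T.weightPart (0, 1) 1) (h₄ : x₄ ∈ T.weightPart (0, 1) 1)
    (h₅ : x₅ ∈ T.weightPart (0, 1) 1) (h₆ : x₆ ∈ T.weightPart (0, 1) 1)
    (h₇ : x₇ ∈ T.weightPart (0, 1) 1) (hr : r ∈ T.weightPart 0 l) (s t : ZMod 3) :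
    x₁ * T.S 1 x₂ * T.S 2 x₃ * T.S s (x₄ * x₅) * T.S t (x₆ * x₇) * r ∈ T.decomposables J := by
  have p := pair_mem h₄ h₅
  have q := pair_mem h₆ h₇
  have hm : x₁ * T.S 1 x₂ * T.S 2 x₃ * r ∈ T.weightPart 0 (1 + 1 + 1 + l) :=
    mul_mem₀ (triple_mem h₁ h₂ h₃) hr
  obtain ⟨u, hu⟩ : ∃ u : ZMod 3, u + u = s + t := by revert s t; decide
  have hred : T.red J (x₁ * T.S 1 x₂ * T.S 2 x₃ * T.S s (x₄ * x₅) * T.S t (x₆ * x₇) * r) =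
      T.red J (T.S u (x₄ * x₅) * T.S u (x₆ * x₇) * (x₁ * T.S 1 x₂ * T.S 2 x₃ * r)) := by
    rw [red_shift hJ (by norm_num) (by norm_num) hl p q hm, hu,
      ← red_shift hJ (by norm_num) (by norm_num) hl p q hm]
    congr 1
    ring
  rw [← red_eq_zero, hred, red_eq_zero]
  have hneg : ∀ y, T.S u (T.S (-u) y) = y := fun y => by rw [S_S, add_neg_cancel, S_zero]
  have hmove : T.S u (T.S (-u) (x₁ * T.S 1 x₂ * T.S 2 x₃) * x₄ * x₅ * x₆ * x₇ * T.S (-u) r) =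
      T.S u (x₄ * x₅) * T.S u (x₆ * x₇) * (x₁ * T.S 1 x₂ * T.S 2 x₃ * r) := by
    rw [map_mul, map_mul, map_mul, map_mul, map_mul, hneg, hneg, map_mul (T.S u) x₄,
      map_mul (T.S u) x₆]
    ring
  rw [← hmove]
  refine S_mem_decomposables u ?_
  have hr' : T.S (-u) r ∈ T.weightPart 0 l := S_mem hr
  have e1 : (1 : ZMod 3) + 1 = 2 := by decide
  have e2 : (1 : ZMod 3) + 2 = 0 := by decide
  have e3 : (2 : ZMod 3) + 1 = 0 := by decide
  have e4 : (2 : ZMod 3) + 2 = 1 := by decide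
  have e5 : -(1 : ZMod 3) = 2 := by decide
  have e6 : -(2 : ZMod 3) = 1 := by decide
  have hu' : u = 0 ∨ u = 1 ∨ u = 2 := by clear * -; revert u; decide
  rcases hu' with rfl | rfl | rfl
  · rw [neg_zero] at hr' ⊢
    exact seven_mul_mem hJ hl h₁ h₂ h₃ h₄ h₅ h₆ h₇ hr'
  · rw [e5] at hr' ⊢
    convert seven_mul_mem hJ hl h₂ h₃ h₁ h₄ h₅ h₆ h₇ hr' using 1
    simp only [map_mul, S_S, e3, e4, S_zero]
    ring
  · rw [e6] at hr' ⊢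
    convert seven_mul_mem hJ hl h₃ h₁ h₂ h₄ h₅ h₆ h₇ hr' using 1
    simp only [map_mul, S_S, e1, e2, S_zero]
    ring

end TetrahedralAction

theorem Submodule.mul_sup_pow_le {A : Type} [CommRing A] [Algebra ℂ A] {a b M : Submodule ℂ A}
    {n : ℕ} {c : Submodule ℂ A} (h : ∀ i j, i + j = n → c * (a ^ i * b ^ j) ≤ M) :
    c * (a ⊔ b) ^ n ≤ M := by
  induction n generalizing c with
  | zero => simpa using h 0 0 rfl
  | succ n ih =>
    rw [pow_succ', ← mul_assoc, ← Submodule.add_eq_sup, mul_add, add_mul, Submodule.add_eq_sup,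
      Submodule.add_eq_sup, sup_le_iff]
    constructor
    · refine ih fun i j hij => (le_of_eq ?_).trans (h (i + 1) j (by omega))
      ring
    · refine ih fun i j hij => (le_of_eq ?_).trans (h i (j + 1) (by omega))
      ring

namespace TetrahedralAction

variable {A : Type} [CommRing A] [Algebra ℂ A] {T : TetrahedralAction A}

theorem weightPart_mul_le {χ ψ : ZMod 2 × ZMod 2} {i j : ℕ} :
    T.weightPart χ i * T.weightPart ψ j ≤ T.weightPart (χ + ψ) (i + j) :=
  Submodule.mul_le.2 fun _ hx _ hy => mul_mem hx hy

theorem weightPart_pow_le {χ : ZMod 2 × ZMod 2} {i : ℕ} (n : ℕ) :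
    T.weightPart χ i ^ n ≤ T.weightPart (n • χ) (n * i) := by
  induction n with
  | zero =>
    rw [pow_zero, Submodule.one_le]
    exact ⟨by simpa using (Submodule.one_le (P := (1 : Submodule ℂ A))).1 le_rfl,
      by simp [sgn], by simp [sgn]⟩
  | succ n ih =>
    rw [pow_succ, succ_nsmul, add_mul, one_mul]
    exact (mul_le_mul' ih le_rfl).trans weightPart_mul_le

variable (T) in
/-- Four times the projection to trivial weight. -/
def proj : A →ₗ[ℂ] A :=
  (LinearMap.id + T.α.toLinearMap) ∘ₗ (LinearMap.id + T.β.toLinearMap)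

theorem proj_apply (x : A) : T.proj x = x + T.β x + (T.α x + T.α (T.β x)) := by
  simp [proj]

theorem proj_weightPart {χ : ZMod 2 × ZMod 2} {n : ℕ} {x : A} (hx : x ∈ T.weightPart χ n) :
    T.proj x = if χ = 0 then (4 : ℂ) • x else 0 := by
  rw [proj_apply, hx.2.2, map_smul, hx.2.1]
  obtain ⟨a, b⟩ := χ
  have h2 : ∀ a : ZMod 2, a = 0 ∨ a = 1 := by decide
  have ha := h2 a
  have hb := h2 b
  rcases ha with rfl | rfl <;> rcases hb with rfl | rfl <;> simp [sgn]
  module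

variable (T) in
/-- The span of the products of two elements of the same nontrivial weight. -/
def pairs : Submodule ℂ A :=
  Submodule.span ℂ {y | ∃ s : ZMod 3, ∃ x₁ ∈ T.weightPart (0, 1) 1, ∃ x₂ ∈ T.weightPart (0, 1) 1,
    y = T.S s (x₁ * x₂)}

variable (T) in
/-- The shifts of the elements of weight `(0, 1)`. -/
def shifted (s : ZMod 3) : Submodule ℂ A := (T.weightPart (0, 1) 1).map (T.S s).toLinearMap

theorem pairs_le : T.pairs ≤ T.weightPart 0 2 := by
  refine Submodule.span_le.2 ?_
  rintro _ ⟨s, x₁, h₁, x₂, h₂, rfl⟩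
  exact S_mem (pair_mem h₁ h₂)

theorem shifted_sq_le (s : ZMod 3) : T.shifted s ^ 2 ≤ T.pairs := by
  rw [sq, Submodule.mul_le]
  rintro _ ⟨x, hx, rfl⟩ _ ⟨y, hy, rfl⟩
  exact Submodule.subset_span ⟨s, x, hx, y, hy, (map_mul (T.S s) x y).symm⟩

theorem shifted_zero_le : T.shifted 0 ≤ T.weightPart (0, 1) 1 := by
  rintro _ ⟨x, hx, rfl⟩
  exact hx

theorem shifted_one_le : T.shifted 1 ≤ T.weightPart (1, 0) 1 := by
  rintro _ ⟨x, hx, rfl⟩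
  exact S_one_mem hx

theorem shifted_two_le : T.shifted 2 ≤ T.weightPart (1, 1) 1 := by
  rintro _ ⟨x, hx, rfl⟩
  exact S_two_mem hx

theorem ideal_le :
    T.I ≤ T.weightPart 0 1 ⊔ T.shifted 0 ⊔ (T.shifted 1 ⊔ T.shifted 2) := by
  intro x hx
  have key : ∀ a b : ZMod 2,
      (x + sgn b • T.β x) + sgn a • T.α (x + sgn b • T.β x) ∈ T.weightPart (a, b) 1 := by
    intro a b
    have hs : ∀ c, sgn c * sgn c = 1 := fun c => by unfold sgn; split_ifs <;> norm_num
    refine ⟨?_, ?_, ?_⟩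
    · have h1 := Submodule.add_mem _ hx (Submodule.smul_mem _ (sgn b) (T.β_mem x hx))
      simpa using Submodule.add_mem _ h1 (Submodule.smul_mem _ (sgn a) (T.α_mem _ h1))
    · simp only [map_add, map_smul, T.α_α, smul_add, smul_smul, ← mul_assoc, hs, one_mul, one_smul]
      module
    · simp only [map_add, map_smul, T.β_β, ← T.α_β, smul_add, smul_smul, hs, one_smul,
        mul_comm (sgn b) (sgn a), mul_left_comm (sgn b), mul_one]
      module
  have h00 := key 0 0
  have h01 := key 0 1
  have h10 := key 1 0
  have h11 := key 1 1
  have m01 := Submodule.mem_map_of_mem (f := (T.S 0).toLinearMap) h01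
  have m10 := Submodule.mem_map_of_mem (f := (T.S 1).toLinearMap)
    (show _ ∈ T.weightPart (0, 1) 1 from σ_mem_weightPart (σ_mem_weightPart h10))
  have m11 := Submodule.mem_map_of_mem (f := (T.S 2).toLinearMap)
    (show _ ∈ T.weightPart (0, 1) 1 from σ_mem_weightPart h11)
  simp only [AlgHom.toLinearMap_apply] at m01 m10 m11
  rw [S_zero] at m01
  rw [S_one, T.σ_σ_σ] at m10
  rw [S_two, T.σ_σ_σ] at m11
  have := Submodule.add_mem_sup (Submodule.add_mem_sup h00 m01) (Submodule.add_mem_sup m10 m11)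
  have h4 := Submodule.smul_mem _ (4⁻¹ : ℂ) this
  refine Eq.mp (congrArg (· ∈ _) ?_) h4
  simp only [sgn, if_true, one_ne_zero, if_false, map_add, map_smul]
  module

theorem pairs_pow_three_mul_le {J k : ℕ} {H R : Submodule ℂ A} {l : ℕ} (hJ : 1 ≤ J) (hk : 1 ≤ k)
    (hk' : k ≤ 2) (hl : J + 4 ≤ 6 + k + l) (hH : H ≤ T.weightPart 0 k)
    (hR : R ≤ T.weightPart 0 l) : T.pairs ^ 3 * H * R ≤ T.decomposables J := by
  refine Submodule.mul_le.2 fun m hm r hr => ?_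
  refine Submodule.mul_induction_on hm (fun p hp h hh => ?_)
    fun x y hx hy => by rw [add_mul]; exact Submodule.add_mem _ hx hy
  rw [pow_succ, sq, pairs, Submodule.span_mul_span, Submodule.span_mul_span] at hp
  refine Submodule.span_induction (p := fun p _ => p * h * r ∈ T.decomposables J) ?_ (by simp)
    (fun x y _ _ hx hy => by rw [add_mul, add_mul]; exact Submodule.add_mem _ hx hy)
    (fun c x _ hx => by rw [smul_mul_assoc, smul_mul_assoc]; exact Submodule.smul_mem _ _ hx) hp
  rintro _ ⟨_, ⟨_, ⟨a, x₁, h₁, x₂, h₂, rfl⟩, _, ⟨b, x₃, h₃, x₄, h₄, rfl⟩, rfl⟩, _,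
    ⟨c, x₅, h₅, x₆, h₆, rfl⟩, rfl⟩
  exact three_pairs_mul_mem hJ hk hk' hl h₁ h₂ h₃ h₄ h₅ h₆ (hH hh) (hR hr) a b c

theorem shifted_mul_pairs_le {J l : ℕ} {R : Submodule ℂ A} (hJ : 1 ≤ J) (hl : J ≤ 3 + l)
    (hR : R ≤ T.weightPart 0 l) :
    T.shifted 0 * T.shifted 1 * T.shifted 2 * T.pairs ^ 2 * R ≤ T.decomposables J := by
  refine Submodule.mul_le.2 fun m hm r hr => ?_
  refine Submodule.mul_induction_on hm (fun q hq p hp => ?_)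
    fun x y hx hy => by rw [add_mul]; exact Submodule.add_mem _ hx hy
  rw [sq, pairs, Submodule.span_mul_span] at hp
  refine Submodule.span_induction (p := fun p _ => q * p * r ∈ T.decomposables J) ?_ (by simp)
    (fun x y _ _ hx hy => by rw [mul_add, add_mul]; exact Submodule.add_mem _ hx hy)
    (fun c x _ hx => by rw [mul_smul_comm, smul_mul_assoc]; exact Submodule.smul_mem _ _ hx) hp
  rintro _ ⟨_, ⟨s, x₄, h₄, x₅, h₅, rfl⟩, _, ⟨t, x₆, h₆, x₇, h₇, rfl⟩, rfl⟩
  refine Submodule.mul_induction_on hq (fun q hq z hz => ?_)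
    fun x y hx hy => by rw [add_mul, add_mul]; exact Submodule.add_mem _ hx hy
  refine Submodule.mul_induction_on hq (fun x hx y hy => ?_)
    fun x y hx hy => by rw [add_mul, add_mul, add_mul]; exact Submodule.add_mem _ hx hy
  obtain ⟨x₁, h₁, rfl⟩ := hx
  obtain ⟨x₂, h₂, rfl⟩ := hy
  obtain ⟨x₃, h₃, rfl⟩ := hz
  have := triple_mul_pairs_mem hJ hl h₁ h₂ h₃ h₄ h₅ h₆ h₇ (hR hr) s t
  simpa only [AlgHom.toLinearMap_apply, S_zero, mul_assoc] using this

theorem mul_three_le {J i j k l : ℕ} (hJ : 1 ≤ J) (hi : 1 ≤ i) (hj : 1 ≤ j) (hk : 1 ≤ k)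
    (hijk : i + j + k ≤ 4) (hl : J + 4 ≤ i + j + k + l) :
    T.weightPart 0 i * T.weightPart 0 j * T.weightPart 0 k * T.weightPart 0 l ≤
      T.decomposables J := by
  refine Submodule.mul_le.2 fun m hm r hr => ?_
  refine Submodule.mul_induction_on hm (fun m hm h hh => ?_)
    fun x y hx hy => by rw [add_mul]; exact Submodule.add_mem _ hx hy
  refine Submodule.mul_induction_on hm (fun p hp q hq => ?_)
    fun x y hx hy => by rw [add_mul, add_mul]; exact Submodule.add_mem _ hx hy
  exact mul_three_mem hJ hi hj hk hijk hl hp hq hh hr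

theorem weightPart_zero_pow_le (v i : ℕ) : T.weightPart 0 i ^ v ≤ T.weightPart 0 (v * i) := by
  simpa using weightPart_pow_le (T := T) (χ := 0) (i := i) v

theorem weightPart_zero_mul_le {M N : Submodule ℂ A} {i j k : ℕ} (hM : M ≤ T.weightPart 0 i)
    (hN : N ≤ T.weightPart 0 j) (hk : i + j = k) : M * N ≤ T.weightPart 0 k := by
  subst hk
  simpa using (mul_le_mul' hM hN).trans weightPart_mul_le

theorem pairs_pow_le (r : ℕ) : T.pairs ^ r ≤ T.weightPart 0 (r * 2) :=
  (pow_le_pow_left' pairs_le r).trans (weightPart_zero_pow_le r 2)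

theorem monomial_le_of_even {J v r : ℕ} (hJ : 3 ≤ J) (hn : v + 2 * r = J + 4) :
    T.weightPart 0 1 ^ v * T.pairs ^ r ≤ T.decomposables J := by
  rcases Nat.lt_or_ge v 3 with hv | hv
  · interval_cases v
    · obtain ⟨r, rfl⟩ := Nat.exists_eq_add_of_le' (show 4 ≤ r by omega)
      refine (le_of_eq ?_).trans (pairs_pow_three_mul_le (by omega) (by norm_num) le_rfl
        (by omega) pairs_le (pairs_pow_le r))
      ring
    · obtain ⟨r, rfl⟩ := Nat.exists_eq_add_of_le' (show 3 ≤ r by omega)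
      refine (le_of_eq ?_).trans (pairs_pow_three_mul_le (by omega) le_rfl (by norm_num)
        (by omega) le_rfl (pairs_pow_le r))
      ring
    · obtain ⟨r, rfl⟩ := Nat.exists_eq_add_of_le' (show 1 ≤ r by omega)
      refine le_trans ?_ (mul_three_le (by omega) le_rfl le_rfl (by norm_num : 1 ≤ 2) le_rfl
        (show J + 4 ≤ 1 + 1 + 2 + r * 2 by omega))
      rw [sq, add_comm, pow_add, pow_one, ← mul_assoc]
      exact mul_le_mul' (mul_le_mul' le_rfl pairs_le) (pairs_pow_le r)
  · obtain ⟨v, rfl⟩ := Nat.exists_eq_add_of_le hv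
    refine le_trans ?_ (mul_three_le (by omega) le_rfl le_rfl le_rfl (by norm_num)
        (show J + 4 ≤ 1 + 1 + 1 + (v * 1 + r * 2) by omega))
    rw [pow_add, pow_three', mul_assoc _ (_ ^ v)]
    exact mul_le_mul' le_rfl
      (weightPart_zero_mul_le (weightPart_zero_pow_le v 1) (pairs_pow_le r) rfl)

theorem shifted_mul_le : T.shifted 0 * T.shifted 1 * T.shifted 2 ≤ T.weightPart 0 3 :=
  (mul_le_mul' ((mul_le_mul' shifted_zero_le shifted_one_le).trans weightPart_mul_le)
    shifted_two_le).trans weightPart_mul_le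

theorem monomial_le_of_odd {J v r : ℕ} (hJ : 3 ≤ J) (hn : v + 2 * r + 3 = J + 4) :
    T.weightPart 0 1 ^ v * T.pairs ^ r * (T.shifted 0 * T.shifted 1 * T.shifted 2) ≤
      T.decomposables J := by
  by_cases hr : 2 ≤ r
  · obtain ⟨r, rfl⟩ := Nat.exists_eq_add_of_le' hr
    refine (le_of_eq ?_).trans (shifted_mul_pairs_le (by omega) (show J ≤ 3 + (v * 1 + r * 2) by
      omega) (weightPart_zero_mul_le (weightPart_zero_pow_le v 1) (pairs_pow_le r) rfl))
    ring
  · by_cases hv : 3 ≤ v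
    · obtain ⟨v, rfl⟩ := Nat.exists_eq_add_of_le hv
      refine le_trans ?_ (mul_three_le (by omega) le_rfl le_rfl le_rfl (by norm_num)
          (show J + 4 ≤ 1 + 1 + 1 + (v * 1 + r * 2 + 3) by omega))
      rw [pow_add, pow_three', mul_assoc _ (_ ^ v), mul_assoc]
      exact mul_le_mul' le_rfl (weightPart_zero_mul_le (weightPart_zero_mul_le
        (weightPart_zero_pow_le v 1) (pairs_pow_le r) rfl) shifted_mul_le rfl)
    · obtain rfl : v = 2 := by omega
      obtain rfl : r = 1 := by omega
      refine le_trans ?_ (mul_three_le (by omega) le_rfl le_rfl (by norm_num : 1 ≤ 2) le_rfl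
        (show J + 4 ≤ 1 + 1 + 2 + 3 by omega))
      rw [sq, pow_one]
      exact mul_le_mul' (mul_le_mul' le_rfl pairs_le) shifted_mul_le

theorem monomial_le_comap {J v e₀ e₁ e₂ : ℕ} (hJ : 3 ≤ J) (hn : v + e₀ + e₁ + e₂ = J + 4) :
    T.weightPart 0 1 ^ v * T.shifted 0 ^ e₀ * (T.shifted 1 ^ e₁ * T.shifted 2 ^ e₂) ≤
      (T.decomposables J).comap T.proj := by
  set M := T.weightPart 0 1 ^ v * T.shifted 0 ^ e₀ * (T.shifted 1 ^ e₁ * T.shifted 2 ^ e₂) with hM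
  have hle : M ≤ T.weightPart (v • 0 + e₀ • (0, 1) + (e₁ • (1, 0) + e₂ • (1, 1)))
      (v * 1 + e₀ * 1 + (e₁ * 1 + e₂ * 1)) := by
    refine (mul_le_mul' ?_ ?_).trans weightPart_mul_le
    · exact (mul_le_mul' (weightPart_pow_le v) ((pow_le_pow_left' shifted_zero_le e₀).trans
        (weightPart_pow_le e₀))).trans weightPart_mul_le
    · exact (mul_le_mul' ((pow_le_pow_left' shifted_one_le e₁).trans
        (weightPart_pow_le e₁)) ((pow_le_pow_left' shifted_two_le e₂).trans
        (weightPart_pow_le e₂))).trans weightPart_mul_le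
  intro x hx
  rw [Submodule.mem_comap, proj_weightPart (hle hx)]
  split_ifs with h0
  · refine Submodule.smul_mem _ _ ?_
    simp only [smul_zero, Prod.smul_mk, Prod.mk_add_mk, zero_add, Prod.mk_eq_zero, nsmul_eq_mul,
      mul_one, ← Nat.cast_add, ZMod.natCast_eq_zero_iff] at h0
    have hsq : ∀ s m, T.shifted s ^ (2 * m) ≤ T.pairs ^ m := fun s m => by
      rw [pow_mul]; exact pow_le_pow_left' (shifted_sq_le s) m
    obtain ⟨m₀, h₀⟩ := Nat.even_or_odd' e₀
    obtain ⟨m₁, h₁⟩ := Nat.even_or_odd' e₁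
    obtain ⟨m₂, h₂⟩ := Nat.even_or_odd' e₂
    by_cases hpar : e₀ = 2 * m₀
    · obtain rfl : e₁ = 2 * m₁ := by omega
      obtain rfl : e₂ = 2 * m₂ := by omega
      subst hpar
      refine monomial_le_of_even hJ (show v + 2 * (m₀ + m₁ + m₂) = J + 4 by omega) ?_
      refine ((mul_le_mul' (mul_le_mul' le_rfl (hsq 0 m₀)) (mul_le_mul' (hsq 1 m₁)
        (hsq 2 m₂))).trans (le_of_eq ?_)) hx
      ring
    · obtain rfl : e₀ = 2 * m₀ + 1 := by omega
      obtain rfl : e₁ = 2 * m₁ + 1 := by omega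
      obtain rfl : e₂ = 2 * m₂ + 1 := by omega
      refine monomial_le_of_odd hJ (show v + 2 * (m₀ + m₁ + m₂) + 3 = J + 4 by omega) ?_
      rw [hM, pow_succ, pow_succ, pow_succ] at hx
      refine ((mul_le_mul' (mul_le_mul' le_rfl (mul_le_mul' (hsq 0 m₀) le_rfl)) (mul_le_mul'
        (mul_le_mul' (hsq 1 m₁) le_rfl) (mul_le_mul' (hsq 2 m₂) le_rfl))).trans (le_of_eq ?_)) hx
      ring
  · exact Submodule.zero_mem _

theorem weightPart_zero_le_decomposables {J : ℕ} (hJ : 3 ≤ J) :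
    T.weightPart 0 (J + 4) ≤ T.decomposables J := by
  have hle : T.I ^ (J + 4) ≤ (T.decomposables J).comap T.proj := by
    refine (pow_le_pow_left' ideal_le _).trans ?_
    rw [← one_mul (_ ^ _)]
    refine Submodule.mul_sup_pow_le fun i j hij => ?_
    rw [one_mul]
    refine Submodule.mul_sup_pow_le fun e₁ e₂ he => ?_
    rw [mul_comm, ← one_mul ((_ ⊔ _) ^ i), ← mul_assoc]
    refine Submodule.mul_sup_pow_le fun v e₀ he' => ?_
    rw [mul_one, mul_comm]
    exact monomial_le_comap hJ (by omega)
  intro x hx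
  have h := hle hx.1
  rw [Submodule.mem_comap, proj_weightPart hx, if_pos rfl] at h
  have := Submodule.smul_mem _ (4⁻¹ : ℂ) h
  rwa [smul_smul, inv_mul_cancel₀ (by norm_num), one_smul] at this

theorem weightPart_zero_le_pow_mul (k : ℕ) :
    T.weightPart 0 (4 * k + 3) ≤ T.K ^ k * T.weightPart 0 3 := by
  induction k with
  | zero => simp
  | succ k ih =>
    refine (weightPart_zero_le_decomposables (J := 4 * k + 3) (by omega)).trans ?_
    rw [decomposables, pow_succ', mul_assoc]
    exact mul_le_mul' le_rfl ih

end TetrahedralAction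

/-- A quotient of the tetrahedral group: invariants of large degree split off many factors. -/
theorem hasNoetherBound_of_tetrahedral {Q : Type} [Group Q] [Finite Q] {a b g : Q}
    (ha : a * a = 1) (hb : b * b = 1) (hg : g * g * g = 1) (hab : a * b = b * a)
    (hga : g * a = b * g) (hgb : g * b = a * b * g)
    (hgen : Subgroup.closure {a, b, g} = ⊤) (k : ℕ) :
    HasNoetherBound Q k (4 * k + 2) := by
  intro A _ _ ρ I hI hρ x hx
  have happ : ∀ (u v : Q) (y : A), ρ u (ρ v y) = ρ (u * v) y := fun u v y => by
    rw [map_mul]; rfl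
  have hone : ∀ y : A, ρ 1 y = y := fun y => by rw [map_one]; rfl
  let T : TetrahedralAction A :=
    { α := ρ a, β := ρ b, σ := ρ g, I := I
      α_α := fun y => by rw [happ, ha, hone]
      β_β := fun y => by rw [happ, hb, hone]
      α_β := fun y => by rw [happ, happ, hab]
      σ_α := fun y => by rw [happ, happ, hga]
      σ_β := fun y => by rw [happ, happ, happ, hgb, mul_assoc]
      σ_σ_σ := fun y => by rw [happ, happ, hg, hone]
      ideal := hI
      α_mem := hρ a
      β_mem := hρ b
      σ_mem := hρ g }
  have hK : T.K ≤ invariantPart ρ I := by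
    rintro y ⟨hy, h1, h2, h3⟩
    refine ⟨hy, fun q => ?_⟩
    have hq : q ∈ Subgroup.closure {a, b, g} := hgen ▸ Subgroup.mem_top q
    induction hq using Subgroup.closure_induction with
    | mem q hq =>
      rcases hq with rfl | rfl | rfl
      exacts [h1, h2, h3]
    | one => exact hone y
    | mul u v _ _ hu hv => rw [← happ, hv, hu]
    | inv u _ hu =>
      nth_rewrite 1 [← hu]
      rw [happ, inv_mul_cancel, hone]
  have hxJ : x ∈ T.I ^ (4 * k + 3) := hx
  have hproj : T.proj x ∈ T.weightPart 0 (4 * k + 3) := by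
    rw [TetrahedralAction.proj_apply]
    have hβ := TetrahedralAction.map_pow_mem T.β_mem hxJ
    refine ⟨Submodule.add_mem _ (Submodule.add_mem _ hxJ hβ) (Submodule.add_mem _
      (TetrahedralAction.map_pow_mem T.α_mem hxJ) (TetrahedralAction.map_pow_mem T.α_mem hβ)),
      ?_, ?_⟩
    · simp only [map_add, T.α_α, Prod.fst_zero, TetrahedralAction.sgn, if_true, one_smul]
      abel
    · simp only [map_add, T.β_β, ← T.α_β, Prod.snd_zero, TetrahedralAction.sgn, if_true, one_smul]
      abel
  have hmem : T.proj x ∈ invariantPart ρ I ^ k * I := by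
    refine (mul_le_mul' (pow_le_pow_left' hK k) fun y hy => ?_)
      (TetrahedralAction.weightPart_zero_le_pow_mul k hproj)
    simpa using (TetrahedralAction.weightPart_anti le_rfl (by norm_num) hy).1
  have h4 := groupTrace_mem_pow_succ hρ hmem
  have hT : groupTrace ρ (T.proj x) = (4 : ℂ) • groupTrace ρ x := by
    rw [TetrahedralAction.proj_apply]
    simp only [map_add]
    change groupTrace ρ x + groupTrace ρ (ρ b x) +
      (groupTrace ρ (ρ a x) + groupTrace ρ (ρ a (ρ b x))) = _
    simp only [groupTrace_map]
    module
  rw [hT] at h4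
  have := Submodule.smul_mem _ (4⁻¹ : ℂ) h4
  rwa [smul_smul, inv_mul_cancel₀ (by norm_num), one_smul] at this

open Group in
theorem Group.IsSolvable.of_ker_of_range {G G' : Type*} [Group G] [Group G'] (f : G →* G')
    (hk : IsSolvable f.ker) (hr : IsSolvable f.range) : IsSolvable G :=
  isSolvable_of_ker_le_range f.ker.subtype f.rangeRestrict
    (by rw [MonoidHom.ker_rangeRestrict, Subgroup.range_subtype])

open Group in
theorem Group.IsSolvable.of_commutator {G : Type*} [Group G] (h : IsSolvable (commutator G)) :
    IsSolvable G :=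
  isSolvable_of_ker_le_range (commutator G).subtype Abelianization.of
    (by rw [Abelianization.ker_of, Subgroup.range_subtype])

theorem IsPGroup.isSolvable {G : Type*} [Group G] [Finite G] {p : ℕ} [Fact p.Prime]
    (h : IsPGroup p G) : Group.IsSolvable G :=
  have := h.isNilpotent
  inferInstance

theorem Equiv.Perm.isSolvable_fin_four : Group.IsSolvable (Equiv.Perm (Fin 4)) := by
  have hA : Group.IsSolvable (alternatingGroup (Fin 4)) := by
    refine Group.IsSolvable.of_commutator ?_
    rw [← alternatingGroup.kleinFour_eq_commutator (by simp)]
    have := alternatingGroup.kleinFour_isKleinFour (α := Fin 4) (by simp)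
    exact Group.isSolvable_of_comm IsKleinFour.isMulCommutative.is_comm.comm
  exact Group.IsSolvable.of_ker_of_range Equiv.Perm.sign hA inferInstance

theorem Subgroup.isSolvable_of_index_le_four {G : Type*} [Group G] [Finite G] (H : Subgroup G)
    (hH : Group.IsSolvable H) (h : H.index ≤ 4) : Group.IsSolvable G := by
  have hker : Group.IsSolvable (MulAction.toPermHom G (G ⧸ H)).ker := by
    rw [← Subgroup.normalCore_eq_ker]
    exact Group.isSolvable_of_isSolvable_injective
      (Subgroup.inclusion_injective (Subgroup.normalCore_le H))
  refine Group.IsSolvable.of_ker_of_range _ hker ?_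
  have hcard : Nat.card (G ⧸ H) ≤ Nat.card (Fin 4) := by rwa [Nat.card_fin, ← Subgroup.index_eq_card]
  classical
  have := Fintype.ofFinite (G ⧸ H)
  obtain ⟨e⟩ : Nonempty (G ⧸ H ↪ Fin 4) :=
    Function.Embedding.nonempty_of_card_le (by simpa only [Nat.card_eq_fintype_card] using hcard)
  have := Equiv.Perm.isSolvable_fin_four
  have := Group.isSolvable_of_isSolvable_injective (Equiv.Perm.viaEmbeddingHom_injective e)
  infer_instance

theorem Sylow.isSolvable_of_index_five {G : Type*} [Group G] [Finite G] (P : Sylow 3 G)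
    (h : (P : Subgroup G).index = 5) : Group.IsSolvable G := by
  have hker : Group.IsSolvable (MulAction.toPermHom G (G ⧸ (P : Subgroup G))).ker := by
    rw [← Subgroup.normalCore_eq_ker]
    exact (P.2.to_le (Subgroup.normalCore_le _)).isSolvable
  refine Group.IsSolvable.of_ker_of_range _ hker ?_
  set R := (MulAction.toPermHom G (G ⧸ (P : Subgroup G))).range
  have h1 : Nat.card R ∣ Nat.card G := Subgroup.card_range_dvd _
  have h2 : Nat.card R ∣ 8 * 15 := by
    have := Subgroup.card_subgroup_dvd_card R
    rw [Nat.card_perm] at this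
    rw [← Subgroup.index, h] at this
    exact this
  obtain ⟨n, hn⟩ := IsPGroup.iff_card.1 P.2
  rw [← Subgroup.card_mul_index (P : Subgroup G), h, hn] at h1
  have hcop : Nat.Coprime (Nat.card R) 8 := by
    refine Nat.Coprime.coprime_dvd_left h1 (Nat.Coprime.mul_left (Nat.Coprime.pow_left _ ?_) ?_) <;>
      norm_num
  have h15 : Squarefree 15 := by
    rw [show 15 = 3 * 5 from rfl, Nat.squarefree_mul (by norm_num)]
    exact ⟨Nat.prime_three.squarefree, Nat.prime_five.squarefree⟩
  have := IsZGroup.of_squarefree (G := R) (h15.squarefree_of_dvd (hcop.dvd_of_dvd_mul_left h2))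
  infer_instance

/-- A proper subgroup of a `p`-group is killed by a surjection onto the group of order `p`. -/
theorem IsPGroup.exists_hom_of_lt {P : Type*} [Group P] [Finite P] {p : ℕ} [Fact p.Prime]
    (hP : IsPGroup p P) {C : Subgroup P} (hC : C ≠ ⊤) :
    ∃ φ : P →* Multiplicative (ZMod p), Function.Surjective φ ∧ C ≤ φ.ker := by
  obtain ⟨n, hn⟩ := IsPGroup.iff_card.1 hP
  obtain ⟨a, ha⟩ := IsPGroup.iff_card.1 (hP.to_subgroup C)
  have hp := (Fact.out : p.Prime)
  have han : a < n := by
    refine lt_of_not_ge fun hle => hC (Subgroup.eq_top_of_le_card C ?_)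
    rw [ha, hn]
    exact Nat.pow_le_pow_right hp.pos hle
  obtain ⟨n, rfl⟩ := Nat.exists_eq_succ_of_ne_zero (by omega : n ≠ 0)
  obtain ⟨M, hM, hCM⟩ := Sylow.exists_subgroup_card_pow_prime_le p (m := n)
    (hn ▸ pow_dvd_pow p n.le_succ) C ha (by omega)
  have hindex : M.index = p := by
    have := M.card_mul_index
    rw [hM, hn, pow_succ] at this
    exact Nat.eq_of_mul_eq_mul_left (pow_pos hp.pos n) this
  have hN : M.Normal := Subgroup.normal_of_index_eq_minFac_card (by
    rw [hindex, hn, hp.pow_minFac (by omega)])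
  let e : P ⧸ M ≃* Multiplicative (ZMod p) := mulEquivOfPrimeCardEq (p := p) hindex (by simp)
  refine ⟨e.toMonoidHom.comp (QuotientGroup.mk' M),
    e.surjective.comp (QuotientGroup.mk'_surjective M), fun x hx => ?_⟩
  simpa [MonoidHom.mem_ker] using hCM hx

/-- Independent characters of order `p` are jointly surjective. -/
theorem MonoidHom.exists_surjective_of_independent {P : Type*} [Group P] {p r : ℕ} [Fact p.Prime]
    (φ : Fin r → P →* Multiplicative (ZMod p))
    (h : ∀ c : Fin r → ZMod p, (∀ x, ∑ i, c i * (φ i x).toAdd = 0) → c = 0) :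
    ∃ Φ : P →* Multiplicative (Fin r → ZMod p), Function.Surjective Φ := by
  let Φ : P →* Multiplicative (Fin r → ZMod p) :=
    { toFun := fun x => Multiplicative.ofAdd fun i => (φ i x).toAdd
      map_one' := by simp; rfl
      map_mul' := fun x y => by simp only [map_mul, toAdd_mul]; rfl }
  refine ⟨Φ, ?_⟩
  rw [← MonoidHom.range_eq_top]
  by_contra hne
  let W : Submodule (ZMod p) (Fin r → ZMod p) :=
    AddSubgroup.toZModSubmodule p (Subgroup.toAddSubgroup' Φ.range)
  have hW : W < ⊤ := by
    rw [lt_top_iff_ne_top]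
    intro hW
    refine hne ((eq_top_iff).2 fun y _ => ?_)
    have : y.toAdd ∈ W := hW ▸ Submodule.mem_top
    exact this
  obtain ⟨f, hf0, hf⟩ := Submodule.exists_le_ker_of_lt_top W hW
  have hfs : ∀ y, f y = ∑ i, f (Pi.single i 1) * y i := by
    intro y
    conv_lhs => rw [pi_eq_sum_univ' y]
    rw [map_sum]
    exact Finset.sum_congr rfl fun i _ => by rw [map_smul, smul_eq_mul, mul_comm]
  refine hf0 (LinearMap.ext fun y => ?_)
  have hc := h (fun i => f (Pi.single i 1)) fun x => by
    have : (Φ x).toAdd ∈ W := ⟨x, rfl⟩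
    have := hf this
    rw [LinearMap.mem_ker, hfs] at this
    exact this
  rw [hfs]
  exact Finset.sum_eq_zero fun i _ => by rw [congrFun hc i, Pi.zero_apply, zero_mul]

theorem noetherNumber_lt_of_subquotient {G Q : Type} [Group G] [Group Q] [Finite G] [Finite Q]
    (H : Subgroup G) (π : H →* Q) (hπ : Function.Surjective π) {e : ℕ}
    (hQ : HasNoetherBound Q H.index e) (h : 27 * e < 10 * (Nat.card Q * H.index)) :
    27 * noetherNumber G < 10 * Nat.card G := by
  have hle := (HasNoetherBound.of_subquotient H π hπ hQ).noetherNumber_le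
  have hker : Nat.card π.ker * Nat.card Q = Nat.card H := by
    rw [← π.ker.card_mul_index, Subgroup.index_ker, MonoidHom.range_eq_top.2 hπ, Subgroup.card_top]
  rw [← H.card_mul_index, ← hker]
  have hpos : 0 < Nat.card π.ker := Nat.card_pos
  nlinarith [Nat.mul_lt_mul_of_pos_left h hpos]

theorem noetherNumber_lt_of_not_isCyclic_sylow {G : Type} [Group G] [Finite G]
    (hG : ¬ Group.IsSolvable G) {p : ℕ} [hp : Fact p.Prime] (hp2 : p ≠ 2) (P : Sylow p G)
    (hP : ¬ IsCyclic P) : 27 * noetherNumber G < 10 * Nat.card G := by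
  have htop : (⊥ : Subgroup P) ≠ ⊤ := fun h => hP <| by
    have : Subsingleton P := Subgroup.subsingleton_iff.1 (subsingleton_of_bot_eq_top h)
    infer_instance
  obtain ⟨φ₁, hφ₁, -⟩ := P.2.exists_hom_of_lt htop
  obtain ⟨x, hx⟩ := hφ₁ (Multiplicative.ofAdd 1)
  obtain ⟨φ₂, hφ₂, hx₂⟩ := P.2.exists_hom_of_lt (C := Subgroup.zpowers x) fun h =>
    hP ⟨x, fun y => h.ge (Subgroup.mem_top y)⟩
  obtain ⟨y, hy⟩ := hφ₂ (Multiplicative.ofAdd 1)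
  have hx₂' : φ₂ x = 1 := hx₂ (Subgroup.mem_zpowers x)
  obtain ⟨Φ, hΦ⟩ := MonoidHom.exists_surjective_of_independent ![φ₁, φ₂] fun c hc => by
    have h0 : c 0 = 0 := by simpa [Fin.sum_univ_two, hx, hx₂'] using hc x
    have h1 : c 1 = 0 := by simpa [Fin.sum_univ_two, hy, h0] using hc y
    funext i
    fin_cases i
    exacts [h0, h1]
  have hdvd : ¬ p ∣ (P : Subgroup G).index := P.not_dvd_index
  have h4 : 5 ≤ (P : Subgroup G).index := by
    by_contra! hlt
    exact hG (Subgroup.isSolvable_of_index_le_four (P : Subgroup G) P.2.isSolvable (by omega))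
  refine noetherNumber_lt_of_subquotient (P : Subgroup G) Φ hΦ
    (hasNoetherBound_plane (k := (P : Subgroup G).index) (by omega)) ?_
  have hcard : Nat.card (Multiplicative (Fin 2 → ZMod p)) = p ^ 2 := by
    simp [Nat.card_eq_fintype_card, ZMod.card]
  rw [hcard]
  have hp1 := hp.out.two_le
  set m := (P : Subgroup G).index with hm
  by_cases hp3 : p = 3
  · subst hp3
    have : m ≠ 5 := fun h => hG (P.isSolvable_of_index_five h)
    omega
  · have hp5 : 5 ≤ p := by
      by_contra! hlt
      have : p = 4 := by omega
      exact (by norm_num : ¬ Nat.Prime 4) (this ▸ hp.out)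
    obtain ⟨q, rfl⟩ := Nat.exists_eq_add_of_le hp5
    obtain ⟨n, hn⟩ := Nat.exists_eq_add_of_le h4
    rw [hn]
    have : 5 + q - 1 = 4 + q := by omega
    rw [Nat.add_sub_assoc (by omega) , this]
    nlinarith [Nat.zero_le (q * n), Nat.zero_le (q * q * n), Nat.zero_le (q*q)]

theorem ZMod.two_cases (a : ZMod 2) : a = 0 ∨ a = 1 := by revert a; decide

/-- A nontrivial automorphism of odd prime power order of a `2`-group moves some character of
order two. -/
theorem IsPGroup.exists_hom_ne_of_mulAut {U : Type*} [Group U] [Finite U] (hU : IsPGroup 2 U)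
    {θ : MulAut U} {q j : ℕ} [hq : Fact q.Prime] (hq2 : q ≠ 2) (hθ : θ ^ q ^ j = 1) (hθ1 : θ ≠ 1) :
    ∃ φ : U →* Multiplicative (ZMod 2), ∃ x, φ (θ x) ≠ φ x := by
  classical
  let C : Subgroup U := MonoidHom.eqLocus θ.toMonoidHom (MonoidHom.id U)
  have hC : C ≠ ⊤ := fun h => hθ1 <| MulEquiv.ext fun x => by
    have : x ∈ C := h ▸ Subgroup.mem_top x
    exact this
  obtain ⟨φ, hφ, hCφ⟩ := hU.exists_hom_of_lt hC
  refine ⟨φ, ?_⟩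
  by_contra! hinv
  let S : Set U := {x | φ x = Multiplicative.ofAdd 1}
  have hfin : Fintype S := Fintype.ofFinite S
  let f : Function.End S := fun x => ⟨θ x, (hinv x).trans x.2⟩
  have hf : f ^ q ^ j = 1 := by
    have key : ∀ (n : ℕ) (x : S), (((f ^ n) x : S) : U) = (θ ^ n) x := by
      intro n
      induction n with
      | zero => intro x; rfl
      | succ n ih =>
        intro x
        rw [pow_succ', pow_succ', MulAut.mul_apply, ← ih]
        rfl
    funext x
    refine Subtype.ext ?_
    rw [key, hθ]
    rfl
  have hmod := Equiv.Perm.card_fixedPoints_modEq hf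
  obtain ⟨x₀, hx₀⟩ := hφ (Multiplicative.ofAdd 1)
  obtain ⟨n, hn⟩ := IsPGroup.iff_card.1 (hU.to_subgroup φ.ker)
  have hcard : Fintype.card S = 2 ^ n := by
    rw [← hn, ← Nat.card_eq_fintype_card]
    refine Nat.card_congr ⟨fun x => ⟨x₀⁻¹ * x, ?_⟩, fun x => ⟨x₀ * x, ?_⟩, fun x => ?_, fun x => ?_⟩
    · rw [MonoidHom.mem_ker, map_mul, map_inv, hx₀, x.2, inv_mul_cancel]
    · change φ (x₀ * x) = _
      rw [map_mul, hx₀, x.2, mul_one]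
    · simp
    · simp
  have hempty : IsEmpty (Function.fixedPoints f) := by
    refine ⟨fun ⟨x, hx⟩ => ?_⟩
    have hxC : (x : U) ∈ C := congrArg Subtype.val hx
    have h1 : φ x = 1 := hCφ hxC
    have h2 : φ x = Multiplicative.ofAdd 1 := x.2
    rw [h1] at h2
    exact absurd h2 (by decide)
  rw [hcard, Fintype.card_eq_zero, Nat.modEq_zero_iff_dvd] at hmod
  exact hq2 ((Nat.prime_dvd_prime_iff_eq hq.out Nat.prime_two).1 (hq.out.dvd_of_dvd_pow hmod))

theorem MonoidHom.exists_surjective_or_of_mulAut {U : Type*} [Group U] {θ : MulAut U} {n : ℕ}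
    (hn : Odd n) (hθ : θ ^ n = 1) {φ : U →* Multiplicative (ZMod 2)} (hφ : ∃ x, φ (θ x) ≠ φ x) :
    (∀ x, φ (θ (θ x)) = φ x * φ (θ x)) ∨
      ∃ Φ : U →* Multiplicative (Fin 3 → ZMod 2), Function.Surjective Φ := by
  have hadd : ∀ s t : ZMod 2, s + t = 0 → t = s := by decide
  rw [or_iff_not_imp_left]
  intro hne
  refine MonoidHom.exists_surjective_of_independent
    ![φ, φ.comp θ.toMonoidHom, φ.comp (θ * θ).toMonoidHom] fun c hc => ?_
  have hc' : ∀ x, c 0 * (φ x).toAdd + c 1 * (φ (θ x)).toAdd + c 2 * (φ (θ (θ x))).toAdd = 0 :=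
    fun x => by simpa [Fin.sum_univ_three] using hc x
  obtain ⟨z, hz⟩ := hφ
  have hne0 : ¬ ∀ x, (φ x).toAdd = 0 := fun h =>
    hz ((Multiplicative.toAdd.injective ((h _).trans (h _).symm)))
  have hne1 : ¬ ∀ x, (φ x).toAdd + (φ (θ x)).toAdd = 0 := fun h =>
    hz (Multiplicative.toAdd.injective (hadd _ _ (h z)))
  have hsurj : ∀ x, ∃ y, θ y = x := θ.surjective
  rcases ZMod.two_cases (c 0) with h0 | h0 <;> rcases ZMod.two_cases (c 1) with h1 | h1 <;>
    rcases ZMod.two_cases (c 2) with h2 | h2 <;>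
    simp only [h0, h1, h2, zero_mul, one_mul, zero_add, add_zero] at hc'
  · funext i
    fin_cases i
    exacts [h0, h1, h2]
  · refine absurd (fun x => ?_) hne0
    obtain ⟨y, rfl⟩ := hsurj x
    obtain ⟨y, rfl⟩ := hsurj y
    exact hc' y
  · refine absurd (fun x => ?_) hne0
    obtain ⟨y, rfl⟩ := hsurj x
    exact hc' y
  · refine absurd (fun x => ?_) hne1
    obtain ⟨y, rfl⟩ := hsurj x
    exact hc' y
  · exact absurd hc' hne0
  · have hsq : ∀ (k : ℕ) (x : U), φ ((θ ^ (2 * k)) x) = φ x := by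
      intro k
      induction k with
      | zero => intro x; rfl
      | succ k ih =>
        intro x
        rw [mul_add, pow_add, MulAut.mul_apply, ih]
        exact Multiplicative.toAdd.injective (hadd _ _ (hc' x))
    obtain ⟨k, rfl⟩ := hn
    refine absurd ?_ hz
    have h := hsq (k + 1) z
    rwa [mul_add, mul_one, pow_succ, pow_succ, ← pow_succ, hθ, one_mul] at h
  · exact absurd hc' hne1
  · refine absurd (fun x => Multiplicative.toAdd.injective (hadd _ _ (hc' x))) hne

/-- If `V` is a normal `2`-subgroup and `V` together with an element `g` of odd order generates `H`,
then a character `φ` of `V` that generates a two-dimensional space under conjugation by `g` yields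
a quotient of `H` isomorphic to the tetrahedral group. -/
theorem exists_tetrahedral_quotient {H : Type} [Group H] [Finite H] {V : Subgroup H} [V.Normal]
    (hV : IsPGroup 2 V) {g : H} (hgen : V ⊔ Subgroup.zpowers g = ⊤) (hg : Odd (orderOf g))
    {φ : V →* Multiplicative (ZMod 2)} (hφ : ∃ x, φ (MulAut.conjNormal g x) ≠ φ x)
    (hφ2 : ∀ x, φ (MulAut.conjNormal g (MulAut.conjNormal g x)) =
      φ x * φ (MulAut.conjNormal g x)) :
    ∃ (Q : Type) (_ : Group Q) (_ : Finite Q) (π : H →* Q), Function.Surjective π ∧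
      (∀ k, HasNoetherBound Q k (4 * k + 2)) ∧ 12 ≤ Nat.card Q := by
  set θ : MulAut V := MulAut.conjNormal g with hθ
  have hθg : ∀ x : V, ((θ x : V) : H) = g * x * g⁻¹ := fun x => MulAut.conjNormal_apply g x
  have h2 : ∀ s : Multiplicative (ZMod 2), s * s = 1 := by decide
  have h2' : ∀ s t : Multiplicative (ZMod 2), t * (s * t) = s := by decide
  have hcases : ∀ s t p q : Multiplicative (ZMod 2), t ≠ s → (p = 1 ∧ q = 1) ∨
      (p = s ∧ q = t) ∨ (p = t ∧ q = s * t) ∨ (p = s * t ∧ q = t * (s * t)) := by decide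
  have hθ3 : ∀ x, φ (θ (θ (θ x))) = φ x := fun x => by rw [hφ2, hφ2, h2']
  let K : Subgroup V := φ.ker ⊓ (φ.comp θ.toMonoidHom).ker
  have hK : ∀ u : V, u ∈ K ↔ φ u = 1 ∧ φ (θ u) = 1 := fun u => Iff.rfl
  have hKn : K.Normal := inferInstance
  let N : Subgroup H := K.map V.subtype
  have hN : ∀ u : V, (u : H) ∈ N ↔ u ∈ K := fun u => by
    simp only [N, Subgroup.mem_map, Subgroup.coe_subtype, SetLike.coe_eq_coe, exists_eq_right]
  have hNV : N ≤ V := Subgroup.map_subtype_le K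
  have htop : ∀ L : Subgroup H, V ≤ L → g ∈ L → L = ⊤ := fun L h1 h2 => by
    rw [eq_top_iff, ← hgen, sup_le_iff, Subgroup.zpowers_le]
    exact ⟨h1, h2⟩
  have hNn : N.Normal := by
    refine Subgroup.normalizer_eq_top_iff.1 (htop _ (fun v hv => ?_) ?_) <;>
      refine Subgroup.mem_normalizer_fintype ?_
    · rintro _ ⟨u, hu, rfl⟩
      exact (hN (⟨v, hv⟩ * u * ⟨v, hv⟩⁻¹)).2 (hKn.conj_mem u hu _)
    · rintro _ ⟨u, hu, rfl⟩
      have hu' := (hK u).1 hu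
      rw [Subgroup.coe_subtype, ← hθg, SetLike.mem_coe, hN, hK, hφ2, hu'.1, hu'.2]
      simp
  let M : Subgroup H := N ⊔ Subgroup.zpowers (g ^ 3)
  have hNM : N ≤ M := le_sup_left
  have hgM : g ^ 3 ∈ M := le_sup_right (a := N) (Subgroup.mem_zpowers _)
  have hMn : M.Normal := by
    have key : ∀ x : H, x * g ^ 3 * x⁻¹ ∈ M → x ∈ Subgroup.normalizer (M : Set H) := by
      intro x hx
      refine Subgroup.mem_normalizer_fintype fun n hn => ?_
      have : M ≤ M.comap (MulAut.conj x).toMonoidHom := by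
        refine sup_le (fun n hn => hNM (hNn.conj_mem n hn x)) ?_
        rw [Subgroup.zpowers_le]
        exact hx
      exact this hn
    refine Subgroup.normalizer_eq_top_iff.1 (htop _ (fun v hv => key v ?_) (key g ?_))
    · let u : V := ⟨v, hv⟩
      have hu : u * (θ (θ (θ u)))⁻¹ ∈ K := by
        rw [hK]
        simp only [map_mul, map_inv, hθ3, mul_inv_cancel, and_self]
      have : v * g ^ 3 * v⁻¹ = ((u * (θ (θ (θ u)))⁻¹ : V) : H) * g ^ 3 := by
        simp only [Subgroup.coe_mul, Subgroup.coe_inv, hθg, u]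
        group
      rw [this]
      exact mul_mem (hNM ((hN _).2 hu)) hgM
    · rwa [show g * g ^ 3 * g⁻¹ = g ^ 3 by group]
  have hMV : ∀ u : V, (u : H) ∈ M → u ∈ K := by
    intro u hu
    obtain ⟨n, hn, z, hz, hnz⟩ := Subgroup.mem_sup_of_normal_left.1 hu
    have hzV : z ∈ V := by
      rw [eq_inv_mul_of_mul_eq hnz]
      exact mul_mem (inv_mem (hNV hn)) u.2
    obtain ⟨i, hi⟩ := hV ⟨z, hzV⟩
    have h1 : z ^ 2 ^ i = 1 := congrArg Subtype.val hi
    have h2 : z ^ orderOf g = 1 := by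
      obtain ⟨k, rfl⟩ := hz
      rw [← zpow_natCast, ← zpow_mul, ← zpow_natCast g, ← zpow_mul, mul_comm, mul_assoc,
        mul_comm, mul_assoc, zpow_mul, zpow_natCast, pow_orderOf_eq_one, one_zpow]
    have hz1 : z = 1 := by
      rw [← orderOf_eq_one_iff]
      exact Nat.eq_one_of_dvd_coprimes (hg.coprime_two_left.pow_left i)
        (orderOf_dvd_of_pow_eq_one h1) (orderOf_dvd_of_pow_eq_one h2)
    rw [hz1, mul_one] at hnz
    rw [← hN, ← hnz]
    exact hn
  let π : H →* H ⧸ M := QuotientGroup.mk' M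
  have hπ : ∀ u v : V, φ u = φ v → φ (θ u) = φ (θ v) → π u = π v := by
    intro u v h h'
    refine QuotientGroup.eq.2 (hNM ((hN (u⁻¹ * v)).2 ((hK _).2 ?_)))
    simp [h, h']
  have hπ' : ∀ u v : V, π u = π v → φ u = φ v ∧ φ (θ u) = φ (θ v) := by
    intro u v h
    have := (hK _).1 (hMV (u⁻¹ * v) (QuotientGroup.eq.1 h))
    simpa only [map_mul, map_inv, inv_mul_eq_one] using this
  obtain ⟨x, hx⟩ := hφ
  have hga : π g * π x = π (θ x : V) * π g := by
    rw [← map_mul, ← map_mul, hθg]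
    group
  have hgb : π g * π (θ x : V) = π x * π (θ x : V) * π g := by
    rw [← map_mul π (x : H), ← Subgroup.coe_mul, hπ (x * θ x) (θ (θ x)) (by simp [hφ2])
      (by simp [hφ2]), ← map_mul, ← map_mul, hθg (θ x)]
    group
  have hg3 : π g * π g * π g = 1 := by
    rw [← map_mul, ← map_mul]
    refine (QuotientGroup.eq_one_iff _).2 ?_
    rwa [← pow_three']
  have hxx : ∀ u : V, π u * π u = 1 := fun u => by
    rw [← map_mul, ← Subgroup.coe_mul, hπ (u * u) 1 (by simp [h2]) (by simp [h2])]
    simp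
  have hab : π x ≠ π (θ x : V) := fun h => hx (hπ' _ _ h).1.symm
  have ha1 : π x ≠ 1 := fun h => hx <| by
    have := hπ' x 1 (h.trans (map_one π).symm)
    rw [this.1, this.2, map_one, map_one]
  have hb1 : π (θ x : V) ≠ 1 := fun h => ha1 <| by
    rw [h, one_mul] at hga
    exact mul_eq_left.1 hga
  refine ⟨H ⧸ M, inferInstance, inferInstance, π, QuotientGroup.mk'_surjective M,
    hasNoetherBound_of_tetrahedral (hxx x) (hxx (θ x)) hg3 ?_ hga hgb ?_, ?_⟩
  · rw [← map_mul, ← map_mul, ← Subgroup.coe_mul, ← Subgroup.coe_mul]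
    refine hπ _ _ ?_ ?_ <;> simp only [map_mul, mul_comm]
  · set L := Subgroup.closure {π x, π (θ x : V), π g} with hL
    have h1 : π x ∈ L := Subgroup.subset_closure (by simp)
    have h2 : π (θ x : V) ∈ L := Subgroup.subset_closure (by simp)
    have h3 : π g ∈ L := Subgroup.subset_closure (by simp)
    have hcomap : L.comap π = ⊤ := by
      refine htop _ (fun v hv => ?_) h3
      change π v ∈ L
      rcases hcases (φ x) (φ (θ x)) (φ ⟨v, hv⟩) (φ (θ ⟨v, hv⟩)) hx with h | h | h | h
      · rw [show π v = 1 from (hπ ⟨v, hv⟩ 1 (by simp [h.1]) (by simp [h.2])).trans (by simp)]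
        exact one_mem L
      · rwa [show π v = π x from hπ ⟨v, hv⟩ x h.1 h.2]
      · rwa [show π v = π (θ x : V) from hπ ⟨v, hv⟩ (θ x) h.1 (h.2.trans (hφ2 x).symm)]
      · rw [show π v = π (x * θ x : V) from hπ ⟨v, hv⟩ (x * θ x) (by rw [h.1, map_mul])
          (by rw [h.2, map_mul, map_mul, hφ2]), Subgroup.coe_mul, map_mul]
        exact mul_mem h1 h2
    rw [← top_le_iff]
    rintro y -
    obtain ⟨y, rfl⟩ := QuotientGroup.mk'_surjective M y
    exact (hcomap ▸ Subgroup.mem_top y : y ∈ L.comap π)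
  · have hg1 : π g ≠ 1 := fun h => hab <| by rw [h, one_mul, mul_one] at hga; exact hga
    have h3 : 3 ∣ Nat.card (H ⧸ M) := by
      rw [← orderOf_eq_prime (p := 3) (by rw [pow_three', hg3]) hg1]
      exact orderOf_dvd_natCard _
    have h4 : 4 ∣ Nat.card (H ⧸ M) := by
      refine dvd_trans ?_ (Subgroup.card_subgroup_dvd_card (V.map π))
      obtain ⟨n, hn⟩ := IsPGroup.iff_card.1 (hV.map π)
      have hcard : 3 ≤ Nat.card (V.map π) := by
        have := Fintype.ofFinite (V.map π)
        rw [Nat.card_eq_fintype_card]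
        exact Fintype.two_lt_card_iff.2 ⟨1, ⟨π x, x, x.2, rfl⟩, ⟨π (θ x : V), θ x, (θ x).2, rfl⟩,
          fun h => ha1 (congrArg Subtype.val h).symm, fun h => hb1 (congrArg Subtype.val h).symm,
          fun h => hab (congrArg Subtype.val h)⟩
      rw [hn] at hcard ⊢
      have : 2 ≤ n := by
        by_contra! h
        interval_cases n <;> simp at hcard
      exact pow_dvd_pow 2 this
    exact Nat.le_of_dvd Nat.card_pos (Nat.Coprime.mul_dvd_of_dvd_of_dvd (by norm_num) h3 h4)

theorem noetherNumber_lt_of_mem_normalizer {G : Type} [Group G] [Finite G]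
    (hG : ¬ Group.IsSolvable G) {U : Subgroup G} (hU : IsPGroup 2 U) {g : G}
    (hgU : g ∈ Subgroup.normalizer (U : Set G)) {q j : ℕ} [Fact q.Prime] (hq2 : q ≠ 2)
    (hg : orderOf g = q ^ j) {u : G} (hu : u ∈ U) (hne : g * u * g⁻¹ ≠ u) :
    27 * noetherNumber G < 10 * Nat.card G := by
  have hqodd : Odd q := (Fact.out : q.Prime).odd_of_ne_two hq2
  set H : Subgroup G := U ⊔ Subgroup.zpowers g with hH
  have hUH : U ≤ H := le_sup_left
  have hgH : g ∈ H := le_sup_right (a := U) (Subgroup.mem_zpowers g)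
  have hHN : H ≤ Subgroup.normalizer (U : Set G) :=
    sup_le Subgroup.le_normalizer (by rwa [Subgroup.zpowers_le])
  have hVn : (U.subgroupOf H).Normal := (Subgroup.normal_subgroupOf_iff_le_normalizer hUH).2 hHN
  set V : Subgroup H := U.subgroupOf H with hVdef
  set g' : H := ⟨g, hgH⟩ with hg'
  have hV : IsPGroup 2 V := hU.of_equiv (Subgroup.subgroupOfEquivOfLe hUH).symm
  have hgen : V ⊔ Subgroup.zpowers g' = ⊤ := by
    refine Subgroup.map_injective H.subtype_injective ?_
    rw [Subgroup.map_sup, Subgroup.map_subgroupOf_eq_of_le hUH, MonoidHom.map_zpowers,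
      ← MonoidHom.range_eq_map, Subgroup.range_subtype]
    rfl
  have hord : orderOf g' = q ^ j := by rw [← hg, ← Subgroup.orderOf_coe]
  have hHs : Group.IsSolvable H := by
    have hVs : Group.IsSolvable V := hV.isSolvable
    have hQ : Group.IsSolvable (H ⧸ V) := by
      have hmap : (Subgroup.zpowers g').map (QuotientGroup.mk' V) = ⊤ := by
        have := congrArg (Subgroup.map (QuotientGroup.mk' V)) hgen
        rwa [Subgroup.map_sup, QuotientGroup.map_mk'_self, bot_sup_eq,
          Subgroup.map_top_of_surjective _ (QuotientGroup.mk'_surjective V)] at this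
      rw [MonoidHom.map_zpowers] at hmap
      have : IsCyclic (H ⧸ V) := isCyclic_iff_exists_zpowers_eq_top.2 ⟨_, hmap⟩
      exact Group.isSolvable_of_comm IsCyclic.isMulCommutative.is_comm.comm
    exact Group.isSolvable_of_ker_le_range V.subtype (QuotientGroup.mk' V)
      (by rw [QuotientGroup.ker_mk', Subgroup.range_subtype])
  have hindex : 5 ≤ H.index := by
    by_contra! h
    exact hG (H.isSolvable_of_index_le_four hHs (by omega))
  set θ : MulAut V := MulAut.conjNormal g' with hθdef
  have hθ : θ ^ q ^ j = 1 := by rw [hθdef, ← map_pow, ← hord, pow_orderOf_eq_one, map_one]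
  have hθ1 : θ ≠ 1 := fun h => hne <| by
    have h1 : ((θ ⟨⟨u, hUH hu⟩, hu⟩ : V) : H) = ⟨u, hUH hu⟩ := by rw [h]; rfl
    rw [hθdef, MulAut.conjNormal_apply] at h1
    exact congrArg Subtype.val h1
  obtain ⟨φ, hφ⟩ := hV.exists_hom_ne_of_mulAut hq2 hθ hθ1
  rcases MonoidHom.exists_surjective_or_of_mulAut hqodd.pow hθ hφ with h | ⟨Φ, hΦ⟩
  · obtain ⟨Q, _, _, π, hπ, hQ, hcard⟩ :=
      exists_tetrahedral_quotient hV hgen (hord ▸ hqodd.pow) hφ h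
    refine noetherNumber_lt_of_subquotient H π hπ (hQ _) ?_
    nlinarith
  · have hle : 5 ≤ U.index := hindex.trans
      (Nat.le_of_dvd (Nat.pos_of_ne_zero Subgroup.index_ne_zero_of_finite)
        (Subgroup.index_dvd_of_le hUH))
    refine noetherNumber_lt_of_subquotient U
      (Φ.comp (Subgroup.subgroupOfEquivOfLe hUH).symm.toMonoidHom)
      (hΦ.comp (Subgroup.subgroupOfEquivOfLe hUH).symm.surjective)
      (hasNoetherBound_cube (by omega)) ?_
    rw [show Nat.card (Multiplicative (Fin 3 → ZMod 2)) = 8 by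
      rw [Nat.card_congr Multiplicative.toAdd]; simp]
    omega

theorem Subgroup.eq_top_of_forall_exists_sylow_le {G : Type*} [Group G] [Finite G] {L : Subgroup G}
    (h : ∀ p, p.Prime → ∃ P : Sylow p G, (P : Subgroup G) ≤ L) : L = ⊤ := by
  rw [← Subgroup.index_eq_one]
  refine Nat.eq_one_iff_not_exists_prime_dvd.2 fun p hp hdvd => ?_
  have := Fact.mk hp
  obtain ⟨P, hP⟩ := h p hp
  exact P.not_dvd_index (hdvd.trans (Subgroup.index_dvd_of_le hP))

theorem IsPGroup.lt_normalizer_inf {G : Type*} [Group G] [Finite G] {p : ℕ} [Fact p.Prime]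
    {P D : Subgroup G} (hP : IsPGroup p P) (hD : D < P) :
    D < Subgroup.normalizer (D : Set G) ⊓ P := by
  have := hP.isNilpotent
  refine lt_of_le_of_ne (le_inf Subgroup.le_normalizer hD.le) fun heq => ?_
  have hlt : D.subgroupOf P < ⊤ := lt_top_iff_ne_top.2 fun h =>
    hD.not_ge (Subgroup.subgroupOf_eq_top.1 h)
  obtain ⟨x, hx, hxD⟩ := SetLike.exists_of_lt
    (Group.normalizerCondition_of_isNilpotent (D.subgroupOf P) hlt)
  refine hxD ?_
  rw [Subgroup.mem_subgroupOf, heq]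
  refine ⟨Subgroup.mem_normalizer_fintype fun n hn => ?_, x.2⟩
  exact (Subgroup.mem_normalizer_iff.1 hx ⟨n, hD.le hn⟩).1 hn

/-- If odd order elements normalizing `D` centralize it, then the normalizer of `D` is the product
of the centralizer of `D` and a Sylow `2`-subgroup. -/
theorem Subgroup.centralizer_sup_sylow_eq_top {G : Type*} [Group G] [Finite G] {D : Subgroup G}
    (hD : ∀ q, q.Prime → q ≠ 2 → ∀ j, ∀ g ∈ normalizer (D : Set G), orderOf g = q ^ j →
      g ∈ centralizer (D : Set G)) (R : Sylow 2 (normalizer (D : Set G))) :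
    (centralizer (D : Set G)).subgroupOf (normalizer (D : Set G)) ⊔ (R : Subgroup _) = ⊤ := by
  refine eq_top_of_forall_exists_sylow_le fun p hp => ?_
  rcases eq_or_ne p 2 with rfl | hp2
  · exact ⟨R, le_sup_right⟩
  · have := Fact.mk hp
    obtain ⟨P⟩ : Nonempty (Sylow p (normalizer (D : Set G))) := inferInstance
    refine ⟨P, le_sup_of_le_left fun x hx => ?_⟩
    obtain ⟨j, hj⟩ := IsPGroup.iff_orderOf.1 P.2 ⟨x, hx⟩
    exact hD p hp hp2 j x x.2 (by rwa [Subgroup.orderOf_coe, ← Subgroup.orderOf_mk x hx])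

/-- If, in a finite group, odd order elements normalizing a `2`-subgroup centralize it, then any two
Sylow `2`-subgroups are conjugate under the centralizer of their intersection. -/
theorem Sylow.exists_mem_centralizer_smul_eq {G : Type*} [Group G] [Finite G]
    (h : ∀ D : Subgroup G, IsPGroup 2 D → ∀ q, q.Prime → q ≠ 2 → ∀ j,
      ∀ g ∈ Subgroup.normalizer (D : Set G), orderOf g = q ^ j →
      g ∈ Subgroup.centralizer (D : Set G)) (P S : Sylow 2 G) :
    ∃ c ∈ Subgroup.centralizer ((P ⊓ S : Subgroup G) : Set G), c • P = S := by
  obtain ⟨D, hD⟩ : ∃ D, (P ⊓ S : Subgroup G) = D := ⟨_, rfl⟩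
  induction D using WellFoundedGT.induction generalizing P S with
  | ind D ih =>
    rcases eq_or_ne P S with rfl | hne
    · exact ⟨1, one_mem _, one_smul _ _⟩
    have hDP : D < P := by
      refine lt_of_le_of_ne (hD ▸ inf_le_left) fun heq => hne (Sylow.ext ?_)
      exact (P.3 S.2 (inf_eq_left.1 (hD.trans heq))).symm
    have hDS : D < S := by
      refine lt_of_le_of_ne (hD ▸ inf_le_right) fun heq => hne (Sylow.ext ?_)
      exact S.3 P.2 (inf_eq_right.1 (hD.trans heq))
    have hDp : IsPGroup 2 D := P.2.to_le hDP.le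
    set N := Subgroup.normalizer (D : Set G) with hN
    have hsylow : ∀ Q : Sylow 2 G, ∃ R : Sylow 2 N, ∀ x (hx : x ∈ N), x ∈ Q → ⟨x, hx⟩ ∈ R := by
      intro Q
      obtain ⟨R, hR⟩ := (Q.2.comap_of_injective N.subtype N.subtype_injective).exists_le_sylow
      exact ⟨R, fun x hx hxQ => hR hxQ⟩
    obtain ⟨R, hR⟩ := hsylow P
    obtain ⟨R', hR'⟩ := hsylow S
    obtain ⟨n, rfl⟩ := MulAction.exists_smul_eq N R R'
    obtain ⟨c, hc, r, hr, rfl⟩ := Subgroup.mem_sup_of_normal_left.1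
      ((Subgroup.centralizer_sup_sylow_eq_top (h D hDp) R).ge (Subgroup.mem_top n))
    rw [mul_smul, Sylow.smul_eq_iff_mem_normalizer.2 (Subgroup.le_normalizer hr)] at hR'
    obtain ⟨T, hT⟩ := (R.2.map N.subtype).exists_le_sylow
    have hPT : D < (P ⊓ T : Subgroup G) := (P.2.lt_normalizer_inf hDP).trans_le
      (le_inf inf_le_right fun x hx => hT ⟨⟨x, hx.1⟩, hR x hx.1 hx.2, rfl⟩)
    have hTS : D < (((c : G) • T : Sylow 2 G) ⊓ S : Subgroup G) := by
      refine (S.2.lt_normalizer_inf hDS).trans_le (le_inf (fun x hx => ?_) inf_le_right)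
      obtain ⟨y, hy, hyx⟩ := hR' x hx.1 hx.2
      exact ⟨y, hT ⟨y, hy, rfl⟩, congrArg Subtype.val hyx⟩
    obtain ⟨a, ha, hPa⟩ := ih _ hPT P T rfl
    obtain ⟨b, hb, hSb⟩ := ih _ hTS (c • T) S rfl
    refine ⟨b * (c * a), ?_, by rw [mul_smul, mul_smul, hPa]; exact hSb⟩
    rw [hD]
    exact mul_mem (Subgroup.centralizer_le hTS.le hb)
      (mul_mem hc (Subgroup.centralizer_le hPT.le ha))

theorem Sylow.focalSubgroup_le_commutator_of_centralizer {G : Type*} [Group G] [Finite G]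
    (h : ∀ D : Subgroup G, IsPGroup 2 D → ∀ q, q.Prime → q ≠ 2 → ∀ j,
      ∀ g ∈ Subgroup.normalizer (D : Set G), orderOf g = q ^ j →
      g ∈ Subgroup.centralizer (D : Set G)) (P : Sylow 2 G) :
    (P : Subgroup G).focalSubgroup ≤ ⁅(P : Subgroup G), (P : Subgroup G)⁆ := by
  rw [Subgroup.focalSubgroup_def, Subgroup.closure_le]
  rintro _ ⟨hxu, x, hx, u, rfl⟩
  obtain ⟨c, hc, hcP⟩ := Sylow.exists_mem_centralizer_smul_eq h P (u • P)
  have hn : c⁻¹ * u ∈ Subgroup.normalizer (P : Set G) := by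
    rw [← Sylow.smul_eq_iff_mem_normalizer, mul_smul, ← hcP, inv_smul_smul]
  have hy : u * x⁻¹ * u⁻¹ ∈ P := by
    have := mul_mem (inv_mem hx) hxu
    rwa [commutatorElement_def, mul_assoc, mul_assoc, inv_mul_cancel_left, ← mul_assoc] at this
  have hyc := Subgroup.mem_centralizer_iff.1 hc _ ⟨hy, x⁻¹, inv_mem hx, rfl⟩
  obtain ⟨d, hd, r, hr, hdr⟩ := Subgroup.mem_sup_of_normal_left.1
    ((Subgroup.centralizer_sup_sylow_eq_top (h P P.2)
      (P.subtype Subgroup.le_normalizer)).ge (Subgroup.mem_top ⟨_, hn⟩))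
  have hrP : (r : G) ∈ P := hr
  have hdr' : (d : G) * r = c⁻¹ * u := congrArg Subtype.val hdr
  have hdc : (r : G) * x⁻¹ * (r : G)⁻¹ * d = d * (r * x⁻¹ * (r : G)⁻¹) :=
    Subgroup.mem_centralizer_iff.1 hd _ (mul_mem (mul_mem hrP (inv_mem hx)) (inv_mem hrP))
  have key : u * x⁻¹ * u⁻¹ = r * x⁻¹ * (r : G)⁻¹ := by
    have hu : u = c * (d * r) := by rw [hdr', mul_inv_cancel_left]
    have h1 : c⁻¹ * (u * x⁻¹ * u⁻¹) * c = u * x⁻¹ * u⁻¹ := by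
      rw [mul_assoc, hyc, inv_mul_cancel_left]
    rw [← h1, hu, ← mul_inv_cancel_right (r * x⁻¹ * (r : G)⁻¹) (d : G), hdc]
    group
  rw [SetLike.mem_coe, commutatorElement_def, mul_assoc, mul_assoc, ← mul_assoc u, key,
    ← mul_assoc, ← mul_assoc]
  exact Subgroup.commutator_mem_commutator hx hrP

theorem Group.IsSolvable.of_isCyclic_of_centralizer {G : Type*} [Group G] [Finite G]
    (hcyc : ∀ p, p.Prime → p ≠ 2 → ∀ P : Subgroup G, IsPGroup p P → IsCyclic P)
    (hcent : ∀ D : Subgroup G, IsPGroup 2 D → ∀ q, q.Prime → q ≠ 2 → ∀ j,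
      ∀ g ∈ Subgroup.normalizer (D : Set G), orderOf g = q ^ j →
      g ∈ Subgroup.centralizer (D : Set G)) : Group.IsSolvable G := by
  induction hn : Nat.card G using Nat.strong_induction_on generalizing G with
  | _ n ih =>
  obtain ⟨P⟩ : Nonempty (Sylow 2 G) := inferInstance
  rcases eq_or_ne (P : Subgroup G) ⊥ with hP | hP
  · have : IsZGroup G := by
      refine ⟨fun p hp Q => ?_⟩
      rcases eq_or_ne p 2 with rfl | hp2
      · obtain ⟨u, rfl⟩ := MulAction.exists_smul_eq G P Q
        rw [Sylow.coe_subgroup_smul, hP, Subgroup.smul_bot]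
        infer_instance
      · exact hcyc p hp hp2 Q Q.2
    infer_instance
  · refine Group.IsSolvable.of_commutator (ih (Nat.card (commutator G)) ?_ ?_ ?_ rfl)
    · rw [← hn]
      refine lt_of_le_of_ne (Subgroup.card_le_card_group _) fun h => ?_
      have hfocal := P.focalSubgroup_le_commutator_of_centralizer hcent
      rw [← Subgroup.commutator_inf_eq_focalSubgroup, Subgroup.eq_top_of_card_eq _ h,
        top_inf_eq] at hfocal
      have : Nontrivial P := (Subgroup.nontrivial_iff_ne_bot _).2 hP
      have : Group.IsSolvable P := P.2.isSolvable
      refine (Group.IsSolvable.commutator_lt_top_of_nontrivial P).not_ge ?_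
      rw [← Subgroup.map_subtype_le_map_subtype, Subgroup.map_subtype_commutator,
        ← MonoidHom.range_eq_map, Subgroup.range_subtype]
      exact hfocal
    · intro p hp hp2 Q hQ
      have := hcyc p hp hp2 _ (hQ.map (commutator G).subtype)
      exact ((Q.equivMapOfInjective _ (commutator G).subtype_injective).isCyclic).2 this
    · intro D hD q hq hq2 j g hg hgj
      have hmem := hcent _ (hD.map (commutator G).subtype) q hq hq2 j g ?_
        (by rwa [Subgroup.orderOf_coe])
      · rw [Subgroup.mem_centralizer_iff] at hmem ⊢
        exact fun x hx => Subtype.ext (hmem x ⟨x, hx, rfl⟩)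
      · refine Subgroup.mem_normalizer_fintype ?_
        rintro _ ⟨x, hx, rfl⟩
        exact ⟨g * x * g⁻¹, (Subgroup.mem_normalizer_iff.1 hg x).1 hx, rfl⟩

theorem noetherNumber_lt_of_not_isSolvable {G : Type} [Group G] [Finite G]
    (hG : ¬ Group.IsSolvable G) : 27 * noetherNumber G < 10 * Nat.card G := by
  by_contra hlt
  refine hG (Group.IsSolvable.of_isCyclic_of_centralizer ?_ ?_)
  · intro p hp hp2 P hP
    have := Fact.mk hp
    obtain ⟨Q, hQ⟩ := hP.exists_le_sylow
    by_contra hc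
    refine hlt (noetherNumber_lt_of_not_isCyclic_sylow hG hp2 Q fun hQc => hc ?_)
    exact Subgroup.isCyclic_of_le hQ
  · intro D hD q hq hq2 j g hg hgj
    have := Fact.mk hq
    refine Subgroup.mem_centralizer_iff.2 fun u hu => ?_
    by_contra hne
    exact hlt (noetherNumber_lt_of_mem_normalizer hG hD hg hq2 hgj hu
      fun h => hne (mul_inv_eq_iff_eq_mul.1 h).symm)

/-- **Lemma (nonsolvable groups).**  If `G` is a finite nonsolvable group then
`n(G) > 2.7`, i.e. `β(G) < |G|/2.7`. -/
theorem noetherIndex_gt_of_nonsolvable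
    (G : Type) [Group G] [Finite G] (hnonsolv : ¬ IsSolvable G) :
    2.7 < noetherIndex G ∧ (noetherNumber G : ℝ) < (Nat.card G : ℝ) / 2.7 := by
  have hlt : (27 * noetherNumber G : ℝ) < 10 * Nat.card G := by
    exact_mod_cast noetherNumber_lt_of_not_isSolvable hnonsolv
  have hpos : (0 : ℝ) < noetherNumber G := by exact_mod_cast noetherNumber_pos G
  constructor
  · rw [noetherIndex, lt_div_iff₀ hpos]
    linarith
  · rw [lt_div_iff₀ (by norm_num)]
    linarith
end

section
/- Let H be a finite almost simple group whose socle is isomorphic to the alternating group A_k with k ≥ 2^10, i.e., H has a normal subgroup S ≅ A_k with C_H(S) = 1. Then β(H) ≤ 2^{−ε} · |H|^{1−ε} with ε = 1/(10 · log₂ k). -/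
namespace NoetherBound

section Sign

/-- The sign character of `ZMod 2` with values in a ring. -/
def sgn (R : Type*) [Ring R] (z : ZMod 2) : R := if z = 0 then 1 else -1

theorem sgn_add (R : Type*) [Ring R] (z w : ZMod 2) : sgn R (z + w) = sgn R z * sgn R w := by
  have hz : ∀ z : ZMod 2, z = 0 ∨ z = 1 := by decide
  rcases hz z with rfl | rfl <;> rcases hz w with rfl | rfl <;>
    simp [sgn, CharTwo.add_self_eq_zero]

theorem prod_sgn {R ι : Type*} [CommRing R] (U : Finset ι) (s : ι → ZMod 2) :
    ∏ j ∈ U, sgn R (s j) = sgn R (∑ j ∈ U, s j) := by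
  classical
  induction U using Finset.induction_on with
  | empty => simp [sgn]
  | insert j U hj ih => rw [Finset.prod_insert hj, Finset.sum_insert hj, sgn_add, ih]

/-- The Davenport constant of an elementary abelian `2`-group of rank `r` is at most `r + 1`. -/
theorem exists_nonempty_sum_eq_zero {r : ℕ} (s : Fin (r + 1) → Fin r → ZMod 2) :
    ∃ U : Finset (Fin (r + 1)), U.Nonempty ∧ ∑ j ∈ U, s j = 0 := by
  have hdep : ¬ LinearIndependent (ZMod 2) s := fun h => by
    simpa using h.fintype_card_le_finrank
  obtain ⟨g, hg, i, hi⟩ := Fintype.not_linearIndependent_iff.1 hdep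
  refine ⟨Finset.univ.filter fun j => g j ≠ 0, ⟨i, by simpa using hi⟩, ?_⟩
  rw [← hg, Finset.sum_filter]
  refine Finset.sum_congr rfl fun j _ => ?_
  have hz : ∀ z : ZMod 2, z = 0 ∨ z = 1 := by decide
  rcases hz (g j) with h | h <;> simp [h]

end Sign

section Action

variable {K R G : Type*} [Field K] [CommRing R] [Algebra K R] [Group G]

/-- A product of `r + 1` simultaneous `±1`-eigenvectors of `r` automorphisms has a nonempty
subproduct fixed by all of them. -/
theorem exists_nonempty_prod_fixed {r : ℕ} (ψ : G →* (R →ₐ[K] R)) (a : Fin r → G)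
    (l : Fin (r + 1) → R) (hl : ∀ j t, ψ (a t) (l j) = l j ∨ ψ (a t) (l j) = -l j) :
    ∃ U : Finset (Fin (r + 1)), U.Nonempty ∧
      ∀ e ∈ Subgroup.closure (Set.range a), ψ e (∏ j ∈ U, l j) = ∏ j ∈ U, l j := by
  have hs : ∀ j t, ∃ z : ZMod 2, ψ (a t) (l j) = sgn R z * l j := fun j t => by
    rcases hl j t with h | h
    · exact ⟨0, by simp [h, sgn]⟩
    · exact ⟨1, by simp [h, sgn]⟩
  choose s hs using hs
  obtain ⟨U, hU, hsum⟩ := exists_nonempty_sum_eq_zero s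
  refine ⟨U, hU, fun e he => ?_⟩
  induction he using Subgroup.closure_induction with
  | mem x hx =>
    obtain ⟨t, rfl⟩ := hx
    have h0 : ∑ j ∈ U, s j t = 0 := by simpa using congrFun hsum t
    rw [map_prod, Finset.prod_congr rfl fun j _ => hs j t, Finset.prod_mul_distrib, prod_sgn, h0]
    simp [sgn]
  | one => simp
  | mul x y _ _ hx hy => rw [map_mul, AlgHom.mul_apply, hy, hx]
  | inv x _ hx =>
    conv_lhs => rw [← hx]
    rw [← AlgHom.mul_apply, ← map_mul, inv_mul_cancel, map_one, AlgHom.one_apply]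

variable [Fintype G]

/-- The transfer map `p ↦ ∑ g, g • p`. -/
def transfer (ψ : G →* (R →ₐ[K] R)) : R →ₗ[K] R := ∑ g, (ψ g).toLinearMap

theorem transfer_apply (ψ : G →* (R →ₐ[K] R)) (p : R) : transfer ψ p = ∑ g, ψ g p := by
  simp [transfer]

theorem map_transfer (ψ : G →* (R →ₐ[K] R)) (g : G) (p : R) :
    ψ g (transfer ψ p) = transfer ψ p := by
  rw [transfer_apply, map_sum]
  refine (Fintype.sum_equiv (Equiv.mulLeft g) _ _ fun h => ?_)
  simp

theorem transfer_mul_of_fixed (ψ : G →* (R →ₐ[K] R)) (p : R) {q : R} (hq : ∀ g, ψ g q = q) :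
    transfer ψ (p * q) = transfer ψ p * q := by
  simp [transfer_apply, hq, Finset.sum_mul]

theorem transfer_of_fixed (ψ : G →* (R →ₐ[K] R)) {q : R} (hq : ∀ g, ψ g q = q) :
    transfer ψ q = (Fintype.card G : K) • q := by
  simp [transfer_apply, hq, Nat.cast_smul_eq_nsmul]

/-- Benson's trick, relative to a subgroup: a product of fixed elements of `E`, one for each
coset of `E`, lies in the ideal generated by suitable transfers. -/
theorem prod_mem_span_transfer [CharZero K] (ψ : G →* (R →ₐ[K] R)) (E : Subgroup G)
    [Fintype (G ⧸ E)]
    (f : G ⧸ E → R) (hf : ∀ c, ∀ e ∈ E, ψ e (f c) = f c) :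
    ∏ c, f c ∈ Ideal.span {q | ∃ s : Finset (G ⧸ E), s.Nonempty ∧
      q = transfer ψ (∏ c ∈ s, ψ c.out (f c))} := by
  classical
  set J := Ideal.span {q | ∃ s : Finset (G ⧸ E), s.Nonempty ∧
      q = transfer ψ (∏ c ∈ s, ψ c.out (f c))} with hJ
  have hzero : ∀ g : G, ∏ c, (ψ (g * c.out) (f c) + -f c) = 0 := fun g => by
    refine Finset.prod_eq_zero (Finset.mem_univ (QuotientGroup.mk g⁻¹)) ?_
    rw [add_neg_eq_zero]
    refine hf _ _ ?_
    have := QuotientGroup.mk_out_eq_mul E g⁻¹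
    obtain ⟨e, he⟩ := this
    rw [he]
    simp
  have hsum : ∑ s : Finset (G ⧸ E), transfer ψ (∏ c ∈ s, ψ c.out (f c)) *
      ∏ c ∈ Finset.univ \ s, -f c = 0 := by
    rw [← Finset.sum_const_zero (s := (Finset.univ : Finset G)),
      ← Finset.sum_congr rfl fun g _ => hzero g]
    simp_rw [Finset.prod_add, transfer_apply, Finset.sum_mul, Finset.powerset_univ]
    rw [Finset.sum_comm]
    simp [map_prod]
  rw [← Finset.add_sum_erase _ _ (Finset.mem_univ ∅)] at hsum
  have hrest : ∑ s ∈ Finset.univ.erase (∅ : Finset (G ⧸ E)),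
      transfer ψ (∏ c ∈ s, ψ c.out (f c)) * ∏ c ∈ Finset.univ \ s, -f c ∈ J :=
    J.sum_mem fun s hs => J.mul_mem_right _ (Ideal.subset_span
      ⟨s, Finset.nonempty_iff_ne_empty.2 (Finset.ne_of_mem_erase hs), rfl⟩)
  have hmain := (J.neg_mem_iff).2 hrest
  rw [← eq_neg_of_add_eq_zero_left hsum] at hmain
  rw [Finset.prod_empty, transfer_of_fixed ψ (fun g => map_one _), Finset.sdiff_empty,
    Finset.prod_neg, smul_mul_assoc, one_mul] at hmain
  have hcard : (Fintype.card G : K) ≠ 0 := Nat.cast_ne_zero.2 Fintype.card_ne_zero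
  have h1 := J.mul_mem_left (algebraMap K R (Fintype.card G : K)⁻¹) hmain
  rw [← Algebra.smul_def, smul_smul, inv_mul_cancel₀ hcard, one_smul] at h1
  have h2 := J.mul_mem_left ((-1) ^ Finset.card (Finset.univ : Finset (G ⧸ E))) h1
  rwa [← mul_assoc, ← mul_pow, neg_one_mul, neg_neg, one_pow, one_mul] at h2

end Action

section Eigenvectors

variable {K R G : Type*} [Field K] [CharZero K] [CommRing R] [Algebra K R] [Group G]

/-- Commuting involutions on a space are simultaneously diagonalizable. -/
theorem le_span_eigenvectors {r : ℕ} (ψ : G →* (R →ₐ[K] R)) (a : Fin r → G)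
    (hcomm : ∀ t u, Commute (a t) (a u)) (hsq : ∀ t, a t * a t = 1)
    (W : Submodule K R) (hW : ∀ g, ∀ l ∈ W, ψ g l ∈ W) :
    W ≤ Submodule.span K {l | l ∈ W ∧ ∀ t, ψ (a t) l = l ∨ ψ (a t) l = -l} := by
  classical
  suffices h : ∀ T : Finset (Fin r),
      W ≤ Submodule.span K {l | l ∈ W ∧ ∀ t ∈ T, ψ (a t) l = l ∨ ψ (a t) l = -l} by
    simpa using h Finset.univ
  intro T
  induction T using Finset.induction_on with
  | empty => simp
  | insert u T hu ih =>
    refine ih.trans (Submodule.span_le.2 ?_)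
    rintro l ⟨hlW, hl⟩
    have hcomm' : ∀ t, ψ (a t) (ψ (a u) l) = ψ (a u) (ψ (a t) l) := fun t => by
      rw [← AlgHom.mul_apply, ← AlgHom.mul_apply, ← map_mul, ← map_mul, (hcomm t u).eq]
    have hsq' : ψ (a u) (ψ (a u) l) = l := by
      rw [← AlgHom.mul_apply, ← map_mul, hsq, map_one, AlgHom.one_apply]
    have hplus : l + ψ (a u) l ∈
        {l | l ∈ W ∧ ∀ t ∈ insert u T, ψ (a t) l = l ∨ ψ (a t) l = -l} := by
      refine ⟨W.add_mem hlW (hW _ _ hlW), fun t ht => ?_⟩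
      rcases Finset.mem_insert.1 ht with rfl | ht
      · left; rw [map_add, hsq', add_comm]
      · rcases hl t ht with h | h
        · left; rw [map_add, hcomm', h]
        · right; rw [map_add, hcomm', h, map_neg, neg_add]
    have hminus : l - ψ (a u) l ∈
        {l | l ∈ W ∧ ∀ t ∈ insert u T, ψ (a t) l = l ∨ ψ (a t) l = -l} := by
      refine ⟨W.sub_mem hlW (hW _ _ hlW), fun t ht => ?_⟩
      rcases Finset.mem_insert.1 ht with rfl | ht
      · right; rw [map_sub, hsq', neg_sub]
      · rcases hl t ht with h | h
        · left; rw [map_sub, hcomm', h]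
        · right; rw [map_sub, hcomm', h, map_neg, neg_sub']
    have hl2 : l = (2 : K)⁻¹ • ((l + ψ (a u) l) + (l - ψ (a u) l)) := by
      rw [add_add_sub_cancel, ← two_smul K l, smul_smul, inv_mul_cancel₀ two_ne_zero, one_smul]
    rw [SetLike.mem_coe, hl2]
    exact Submodule.smul_mem _ _ (Submodule.add_mem _ (Submodule.subset_span hplus)
      (Submodule.subset_span hminus))

end Eigenvectors

section Polynomial

open MvPolynomial

variable {K σ G : Type*} [Field K]

theorem homogeneousComponent_mul_of_isHomogeneous {p q : MvPolynomial σ K} {e : ℕ}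
    (hq : q.IsHomogeneous e) (d : ℕ) :
    homogeneousComponent d (p * q) =
      if e ≤ d then homogeneousComponent (d - e) p * q else 0 := by
  classical
  let := gradedAlgebra (σ := σ) (R := K)
  have h := DirectSum.coe_decompose_mul_of_right_mem (homogeneousSubmodule σ K) (a := p) d
    ((mem_homogeneousSubmodule e q).2 hq)
  rw [← decomposition.decompose'_apply, ← decomposition.decompose'_apply]
  exact h

theorem map_homogeneousComponent {φ : MvPolynomial σ K →ₐ[K] MvPolynomial σ K}
    (hφ : ∀ d p, IsHomogeneous p d → IsHomogeneous (φ p) d) (d : ℕ) (p : MvPolynomial σ K) :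
    φ (homogeneousComponent d p) = homogeneousComponent d (φ p) := by
  conv_rhs => rw [← sum_homogeneousComponent p, map_sum, map_sum]
  simp_rw [homogeneousComponent_of_mem (hφ _ _ (homogeneousComponent_isHomogeneous _ p))]
  rw [Finset.sum_ite_eq]
  split_ifs with h
  · rfl
  · rw [homogeneousComponent_eq_zero, map_zero]
    simpa [Nat.lt_succ_iff] using h

variable [Group G] [Fintype G]

/-- The positive part, up to degree `D`, of the Hilbert ideal of a group action on a
polynomial ring. -/
noncomputable def hilbertIdeal (ψ : G →* (MvPolynomial σ K →ₐ[K] MvPolynomial σ K)) (D : ℕ) :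
    Ideal (MvPolynomial σ K) :=
  Ideal.span {q | (∀ g, ψ g q = q) ∧ ∃ d, 0 < d ∧ d ≤ D ∧ q.IsHomogeneous d}

theorem isHomogeneous_transfer {ψ : G →* (MvPolynomial σ K →ₐ[K] MvPolynomial σ K)}
    (hψ : ∀ g d p, IsHomogeneous p d → IsHomogeneous (ψ g p) d) {p : MvPolynomial σ K} {d : ℕ}
    (hp : p.IsHomogeneous d) : (transfer ψ p).IsHomogeneous d := by
  rw [transfer_apply]
  exact IsHomogeneous.sum _ _ _ fun g _ => hψ g d p hp

variable [CharZero K]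

/-- A product of sufficiently many linear eigenforms of an elementary abelian `2`-subgroup
lies in the Hilbert ideal. -/
theorem prod_eigenforms_mem_hilbertIdeal
    {ψ : G →* (MvPolynomial σ K →ₐ[K] MvPolynomial σ K)}
    (hψ : ∀ g d p, IsHomogeneous p d → IsHomogeneous (ψ g p) d) {r : ℕ} (a : Fin r → G)
    [Fintype (G ⧸ Subgroup.closure (Set.range a))]
    (l : (G ⧸ Subgroup.closure (Set.range a)) × Fin (r + 1) → MvPolynomial σ K)
    (hl1 : ∀ j, (l j).IsHomogeneous 1) (hl : ∀ j t, ψ (a t) (l j) = l j ∨ ψ (a t) (l j) = -l j) :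
    ∏ j, l j ∈ hilbertIdeal ψ ((Subgroup.closure (Set.range a)).index * (r + 1)) := by
  classical
  have key := fun c => exists_nonempty_prod_fixed ψ a (fun j => l (c, j)) fun j t => hl (c, j) t
  choose U hU hfix using key
  have hhom : ∀ c, (∏ j ∈ U c, l (c, j)).IsHomogeneous (U c).card := fun c => by
    simpa using IsHomogeneous.prod (U c) (fun j => l (c, j)) (fun _ => 1) fun j _ => hl1 (c, j)
  have hcard : ∀ c, (U c).card ≤ r + 1 := fun c => by simpa using (U c).card_le_univ
  have hle : Ideal.span {q | ∃ s : Finset (G ⧸ Subgroup.closure (Set.range a)), s.Nonempty ∧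
      q = transfer ψ (∏ c ∈ s, ψ c.out (∏ j ∈ U c, l (c, j)))} ≤
      hilbertIdeal ψ ((Subgroup.closure (Set.range a)).index * (r + 1)) := by
    refine Ideal.span_mono ?_
    rintro _ ⟨s, hs, rfl⟩
    refine ⟨fun g => map_transfer ψ g _, ∑ c ∈ s, (U c).card,
      Finset.sum_pos (fun c _ => (hU c).card_pos) hs, ?_,
      isHomogeneous_transfer hψ (IsHomogeneous.prod _ _ _ fun c _ => hψ _ _ _ (hhom c))⟩
    refine (Finset.sum_le_card_nsmul s _ (r + 1) fun c _ => hcard c).trans ?_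
    rw [smul_eq_mul, Subgroup.index_eq_card, Nat.card_eq_fintype_card]
    exact Nat.mul_le_mul_right _ s.card_le_univ
  have hmem := hle (prod_mem_span_transfer ψ _ (fun c => ∏ j ∈ U c, l (c, j)) hfix)
  have hsplit : ∏ j, l j = (∏ c, ∏ j ∈ U c, l (c, j)) * ∏ c, ∏ j ∈ (U c)ᶜ, l (c, j) := by
    rw [← Finset.prod_mul_distrib, Fintype.prod_prod_type]
    exact Finset.prod_congr rfl fun c _ => (Finset.prod_mul_prod_compl _ _).symm
  rw [hsplit]
  exact Ideal.mul_mem_right _ _ hmem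

theorem mem_hilbertIdeal_of_isHomogeneous
    {ψ : G →* (MvPolynomial σ K →ₐ[K] MvPolynomial σ K)}
    (hψ : ∀ g d p, IsHomogeneous p d → IsHomogeneous (ψ g p) d) {r : ℕ} (a : Fin r → G)
    (hcomm : ∀ t u, Commute (a t) (a u)) (hsq : ∀ t, a t * a t = 1) {d : ℕ}
    (hd : (Subgroup.closure (Set.range a)).index * (r + 1) ≤ d) {p : MvPolynomial σ K}
    (hp : p.IsHomogeneous d) :
    p ∈ hilbertIdeal ψ ((Subgroup.closure (Set.range a)).index * (r + 1)) := by
  classical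
  have := Fintype.ofFinite (G ⧸ Subgroup.closure (Set.range a))
  set D := (Subgroup.closure (Set.range a)).index * (r + 1) with hD
  set J := hilbertIdeal ψ D with hJ
  have hspan := le_span_eigenvectors ψ a hcomm hsq (homogeneousSubmodule σ K 1)
    fun g l hl => hψ g 1 l hl
  have hcardD : Fintype.card ((G ⧸ Subgroup.closure (Set.range a)) × Fin (r + 1)) = D := by
    rw [hD, Subgroup.index_eq_card, Nat.card_eq_fintype_card, Fintype.card_prod, Fintype.card_fin]
  have hDJ : homogeneousSubmodule σ K 1 ^ D ≤ J.restrictScalars K := by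
    refine (pow_le_pow_left' hspan D).trans ?_
    rw [Submodule.span_pow, Submodule.span_le]
    intro q hq
    obtain ⟨f, rfl⟩ := Set.mem_pow.1 hq
    let e := Fintype.equivFinOfCardEq hcardD
    rw [List.prod_ofFn, ← e.prod_comp]
    exact prod_eigenforms_mem_hilbertIdeal hψ a (fun j => (f (e j) : MvPolynomial σ K))
      (fun j => (f (e j)).2.1) fun j t => (f (e j)).2.2 t
  have hp' : p ∈ homogeneousSubmodule σ K 1 ^ D * homogeneousSubmodule σ K 1 ^ (d - D) := by
    rw [← pow_add, Nat.add_sub_cancel' hd, homogeneousSubmodule_one_pow]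
    exact hp
  have : homogeneousSubmodule σ K 1 ^ D * homogeneousSubmodule σ K 1 ^ (d - D) ≤
      J.restrictScalars K :=
    Submodule.mul_le.2 fun x hx y _ => J.mul_mem_right y (hDJ hx)
  exact this hp'

/-- Noether bound from the Hilbert ideal. -/
theorem fixed_mem_adjoin {ψ : G →* (MvPolynomial σ K →ₐ[K] MvPolynomial σ K)}
    (hψ : ∀ g d p, IsHomogeneous p d → IsHomogeneous (ψ g p) d) {D : ℕ}
    (hJ : ∀ d p, D ≤ d → IsHomogeneous p d → p ∈ hilbertIdeal ψ D)
    {p : MvPolynomial σ K} (hp : ∀ g, ψ g p = p) :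
    p ∈ Algebra.adjoin K {q : MvPolynomial σ K | (∀ g, ψ g q = q) ∧ q.totalDegree ≤ D} := by
  set A := Algebra.adjoin K {q : MvPolynomial σ K | (∀ g, ψ g q = q) ∧ q.totalDegree ≤ D}
  have hhom : ∀ d q, IsHomogeneous q d → (∀ g, ψ g q = q) → q ∈ A := by
    intro d
    induction d using Nat.strong_induction_on with
    | _ d ih =>
      intro q hq hfix
      by_cases hdD : d ≤ D
      · exact Algebra.subset_adjoin ⟨hfix, hq.totalDegree_le.trans hdD⟩
      have hmain : ∀ x ∈ hilbertIdeal ψ D, ∀ y,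
          homogeneousComponent d (transfer ψ (y * x)) ∈ A := by
        intro x hx
        refine Submodule.span_induction ?_ ?_ ?_ ?_ hx
        · rintro x ⟨hxfix, e, he0, heD, hxe⟩ y
          rw [transfer_mul_of_fixed ψ y hxfix, homogeneousComponent_mul_of_isHomogeneous hxe]
          split_ifs with hed
          · refine A.mul_mem (ih (d - e) (by omega) _ (homogeneousComponent_isHomogeneous _ _) ?_)
              (Algebra.subset_adjoin ⟨hxfix, hxe.totalDegree_le.trans heD⟩)
            intro g
            rw [map_homogeneousComponent (hψ g), map_transfer]
          · exact A.zero_mem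
        · simp
        · intro u v _ _ hu hv y
          rw [mul_add, map_add, map_add]
          exact A.add_mem (hu y) (hv y)
        · intro b u _ hu y
          rw [smul_eq_mul, ← mul_assoc]
          exact hu (y * b)
      have hm := hmain q (hJ d q (by omega) hq) 1
      rw [one_mul, transfer_of_fixed ψ hfix, map_smul, homogeneousComponent_eq_self hq] at hm
      have hcard : (Fintype.card G : K) ≠ 0 := Nat.cast_ne_zero.2 Fintype.card_ne_zero
      simpa [smul_smul, inv_mul_cancel₀ hcard] using A.smul_mem hm (Fintype.card G : K)⁻¹
  rw [← sum_homogeneousComponent p]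
  refine A.sum_mem fun d _ => hhom d _ (homogeneousComponent_isHomogeneous _ _) fun g => ?_
  rw [map_homogeneousComponent (hψ g), hp]

end Polynomial

section NoetherNumber

open MvPolynomial

variable {G : Type*} [Group G] {n : ℕ}

/-- The left action on polynomials associated with a representation. -/
noncomputable def substHom (ρ : Representation ℂ G (Fin n → ℂ)) :
    G →* (MvPolynomial (Fin n) ℂ →ₐ[ℂ] MvPolynomial (Fin n) ℂ) where
  toFun g := ρ.polySubst g⁻¹
  map_one' := by
    refine MvPolynomial.algHom_ext fun i => ?_
    simp [Representation.polySubst, Pi.single_apply, apply_ite C, Module.End.one_eq_id]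
  map_mul' g h := by
    refine MvPolynomial.algHom_ext fun i => ?_
    have hmat : LinearMap.toMatrix' (ρ (h⁻¹ * g⁻¹)) =
        LinearMap.toMatrix' (ρ h⁻¹) * LinearMap.toMatrix' (ρ g⁻¹) := by
      rw [map_mul, LinearMap.toMatrix'_mul]
    simp only [Representation.polySubst, AlgHom.mul_apply, aeval_X, mul_inv_rev]
    rw [hmat]
    simp only [Matrix.mul_apply, map_sum, map_mul, aeval_X, Finset.sum_mul, algHom_C,
      algebraMap_eq, Finset.mul_sum]
    rw [Finset.sum_comm]
    simp only [mul_assoc]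

theorem mem_invariantAlgebra_iff (ρ : Representation ℂ G (Fin n → ℂ))
    (p : MvPolynomial (Fin n) ℂ) :
    p ∈ ρ.invariantAlgebra ↔ ∀ g, substHom ρ g p = p := by
  simp only [Representation.invariantAlgebra, Algebra.mem_iInf, AlgHom.mem_equalizer,
    AlgHom.id_apply]
  exact ⟨fun h g => h g⁻¹, fun h g => by simpa [substHom] using h g⁻¹⟩

theorem isHomogeneous_substHom (ρ : Representation ℂ G (Fin n → ℂ)) (g : G) (d : ℕ)
    (p : MvPolynomial (Fin n) ℂ) (hp : p.IsHomogeneous d) :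
    (substHom ρ g p).IsHomogeneous d := by
  have := hp.aeval (fun i => ∑ j, C (LinearMap.toMatrix' (ρ g⁻¹) i j) * X j) (n := 1)
    fun i => IsHomogeneous.sum _ _ _ fun j _ => isHomogeneous_C_mul_X _ _
  rwa [one_mul] at this

/-- A bound for the Noether number in terms of an elementary abelian `2`-subgroup. -/
theorem noetherNumber_le_index_mul [Finite G] {r : ℕ} (a : Fin r → G)
    (hcomm : ∀ t u, Commute (a t) (a u)) (hsq : ∀ t, a t * a t = 1) :
    noetherNumber G ≤ (Subgroup.closure (Set.range a)).index * (r + 1) := by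
  have := Fintype.ofFinite G
  refine Nat.sInf_le fun n ρ => le_antisymm (Algebra.adjoin_le fun p hp => hp.1) fun p hp => ?_
  rw [mem_invariantAlgebra_iff] at hp
  simp only [mem_invariantAlgebra_iff]
  exact fixed_mem_adjoin (isHomogeneous_substHom ρ) (fun d p hd hpd =>
    mem_hilbertIdeal_of_isHomogeneous (isHomogeneous_substHom ρ) a hcomm hsq hd hpd) hp

end NoetherNumber

section Groups

theorem two_pow_le_card_closure {G : Type*} [Group G] [Finite G] {r : ℕ} (a : Fin r → G)
    (ha : ∀ t, a t ∉ Subgroup.closure (a '' {u | u < t})) :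
    2 ^ r ≤ Nat.card (Subgroup.closure (Set.range a)) := by
  have key : ∀ j ≤ r, 2 ^ j ≤ Nat.card (Subgroup.closure (a '' {u | u.val < j})) := by
    intro j
    induction j with
    | zero => simp
    | succ j ih =>
      intro hj
      set L := Subgroup.closure (a '' {u | u.val < j})
      set M := Subgroup.closure (a '' {u | u.val < j + 1})
      have hLM : L ≤ M := Subgroup.closure_mono (Set.image_mono fun u hu => Nat.lt_succ_of_lt hu)
      have hmem : a ⟨j, hj⟩ ∈ M := Subgroup.subset_closure ⟨_, Nat.lt_succ_self j, rfl⟩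
      have hnot : a ⟨j, hj⟩ ∉ L := ha ⟨j, hj⟩
      obtain ⟨c, hc⟩ := Subgroup.card_dvd_of_le hLM
      have hc1 : c ≠ 1 := by
        rintro rfl
        refine hnot ?_
        rwa [Subgroup.eq_of_le_of_card_ge hLM (by rw [hc, mul_one])]
      have hc0 : c ≠ 0 := by
        rintro rfl
        exact Nat.card_pos.ne' (hc.trans (mul_zero _))
      rw [hc, pow_succ]
      exact Nat.mul_le_mul (ih (by omega)) (by omega)
  have hr := key r le_rfl
  have : {u : Fin r | u.val < r} = Set.univ := by ext u; simp
  rwa [this, Set.image_univ] at hr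

theorem card_mulAut_le_pow_rank (G : Type*) [Group G] [Finite G] :
    Nat.card (MulAut G) ≤ Nat.card G ^ Group.rank G := by
  obtain ⟨T, hT, hgen⟩ := Group.rank_spec G
  have hinj : Function.Injective fun (φ : MulAut G) (t : T) => φ t := fun φ φ' h => by
    have : φ.toMonoidHom = φ'.toMonoidHom :=
      MonoidHom.eq_of_eqOn_dense hgen fun t ht => congrFun h ⟨t, ht⟩
    exact MulEquiv.toMonoidHom_injective this
  have := Nat.card_le_card_of_injective _ hinj
  rwa [Nat.card_fun, Nat.card_eq_fintype_card (α := T), Fintype.card_coe, hT] at this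

theorem card_le_card_mulAut {G : Type*} [Group G] [Finite G] (S : Subgroup G) [S.Normal]
    (hS : Subgroup.centralizer (S : Set G) = ⊥) : Nat.card G ≤ Nat.card (MulAut S) := by
  refine Nat.card_le_card_of_injective (MulAut.conjNormal : G →* MulAut S) ?_
  rw [injective_iff_map_eq_one]
  intro g hg
  rw [← Subgroup.mem_bot, ← hS, Subgroup.mem_centralizer_iff]
  intro s hs
  have h := MulAut.conjNormal_apply g (⟨s, hs⟩ : S)
  rw [hg, MulAut.one_apply] at h
  exact eq_mul_inv_iff_mul_eq.1 h

theorem rank_perm_fin_le {k : ℕ} (hk : 2 ≤ k) : Group.rank (Equiv.Perm (Fin k)) ≤ 2 := by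
  let z : Fin k := ⟨0, by omega⟩
  have h := Equiv.Perm.closure_cycle_adjacent_swap (isCycle_finRotate_of_le hk)
    (support_finRotate_of_le hk) z
  exact (Group.rank_le (S := {finRotate k, Equiv.swap z (finRotate k z)})
    (by simpa using h)).trans Finset.card_le_two

theorem rank_alternatingGroup_fin_le {k : ℕ} (hk : 2 ≤ k) :
    Group.rank (alternatingGroup (Fin k)) ≤ 4 := by
  have : Nontrivial (Fin k) := Fin.nontrivial_iff_two_le.2 hk
  have h := Subgroup.rank_le_index_mul_rank (alternatingGroup (Fin k))
  rw [alternatingGroup.index_eq_two] at h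
  have := rank_perm_fin_le hk
  omega

/-- A large elementary abelian `2`-subgroup of the alternating group, given by generators. -/
theorem exists_involutions_alternatingGroup {k r : ℕ} (hr : 2 * r + 2 ≤ k) :
    ∃ b : Fin r → alternatingGroup (Fin k), (∀ t u, Commute (b t) (b u)) ∧
      (∀ t, b t * b t = 1) ∧ ∀ t, b t ∉ Subgroup.closure (b '' {u | u < t}) := by
  have hlt : ∀ t : Fin r, 2 * t.val + 3 < k := fun t => by have := t.isLt; omega
  let s : Equiv.Perm (Fin k) := Equiv.swap ⟨0, by omega⟩ ⟨1, by omega⟩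
  let x : Fin r → Fin k := fun t => ⟨2 * t + 2, (Nat.lt_succ_self _).trans (hlt t)⟩
  let y : Fin r → Fin k := fun t => ⟨2 * t + 3, hlt t⟩
  let q : Fin r → Equiv.Perm (Fin k) := fun t => Equiv.swap (x t) (y t)
  have hxy : ∀ t, x t ≠ y t := fun t => by simp [x, y]
  have hsq : ∀ t, Commute s (q t) := fun t =>
    (Equiv.Perm.disjoint_swap_swap (by simp [x, y])).commute
  have hqq : ∀ t u, Commute (q t) (q u) := fun t u => by
    by_cases htu : t = u
    · rw [htu]
    · have := Fin.val_ne_of_ne htu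
      refine (Equiv.Perm.disjoint_swap_swap ?_).commute
      simp [x, y]
      omega
  have hsx : ∀ t, s (x t) = x t := fun t =>
    Equiv.swap_apply_of_ne_of_ne (by simp [x]) (by simp [x])
  have hsy : ∀ t, s (y t) = y t := fun t =>
    Equiv.swap_apply_of_ne_of_ne (by simp [y]) (by simp [y])
  have hq : ∀ t u, u < t → q u (x t) = x t := fun t u hut => by
    have : u.val < t.val := hut
    exact Equiv.swap_apply_of_ne_of_ne (Fin.ne_of_val_ne (by simp only [x]; omega))
      (Fin.ne_of_val_ne (by simp only [x, y]; omega))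
  have hmem : ∀ t, s * q t ∈ alternatingGroup (Fin k) := fun t => by
    rw [Equiv.Perm.mem_alternatingGroup, Equiv.Perm.sign_mul, Equiv.Perm.sign_swap (hxy t),
      Equiv.Perm.sign_swap (by simp), neg_mul_neg, one_mul]
  refine ⟨fun t => ⟨s * q t, hmem t⟩, fun t u => ?_, fun t => ?_, fun t ht => ?_⟩
  · exact Subtype.ext (((Commute.refl s).mul_right (hsq u)).mul_left
      ((hsq t).symm.mul_right (hqq t u)))
  · refine Subtype.ext ?_
    change s * q t * (s * q t) = 1
    rw [(hsq t).symm.mul_mul_mul_comm, Equiv.swap_mul_self, Equiv.swap_mul_self, one_mul]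
  · have hfix : ∀ e ∈ Subgroup.closure
        ((fun t => (⟨s * q t, hmem t⟩ : alternatingGroup (Fin k))) '' {u | u < t}),
        (e : Equiv.Perm (Fin k)) (x t) = x t := by
      intro e he
      induction he using Subgroup.closure_induction with
      | mem e he =>
        obtain ⟨u, hu, rfl⟩ := he
        change s (q u (x t)) = x t
        rw [hq t u hu, hsx]
      | one => rfl
      | mul e e' _ _ h h' => rw [Subgroup.coe_mul, Equiv.Perm.mul_apply, h', h]
      | inv e _ h => rw [Subgroup.coe_inv, Equiv.Perm.inv_eq_iff_eq, h]
    have h := hfix _ ht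
    change s (q t (x t)) = x t at h
    rw [Equiv.swap_apply_left, hsy] at h
    exact hxy t h.symm

end Groups

section Numeric

theorem le_two_pow_div_twenty {k : ℕ} (hk : 2 ^ 10 ≤ k) : k ≤ 2 ^ (k / 20) := by
  have h : ∀ q, 51 ≤ q → 20 * q + 19 ≤ 2 ^ q := fun q hq => by
    induction q, hq using Nat.le_induction with
    | base => norm_num
    | succ q _ ih => rw [pow_succ]; omega
  have := h (k / 20) (by omega)
  omega

/-- If `β · 2 ^ r ≤ N · (r + 1)`, with `N` not too large, then `β` is at most
`2 ^ (-ε) * N ^ (1 - ε)`. -/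
theorem le_rpow_of_mul_two_pow_le {k : ℕ} (hk : 2 ^ 10 ≤ k) {β N : ℕ} (hN : 0 < N)
    (hNk : 2 * N ≤ k ^ (4 * k)) (hβ : β * 2 ^ (k / 2 - 1) ≤ N * (k / 2 - 1 + 1)) :
    (β : ℝ) ≤ (2 : ℝ) ^ (-(1 / (10 * Real.logb 2 (k : ℝ)))) *
        (N : ℝ) ^ (1 - 1 / (10 * Real.logb 2 (k : ℝ))) := by
  have hk0 : (0 : ℝ) < k := by exact_mod_cast (by omega : 0 < k)
  have hk1 : (1 : ℝ) < k := by exact_mod_cast (by omega : 1 < k)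
  have hN0 : (0 : ℝ) < N := by exact_mod_cast hN
  have hlog : 0 < Real.logb 2 k := Real.logb_pos one_lt_two hk1
  set ε : ℝ := 1 / (10 * Real.logb 2 (k : ℝ)) with hε
  have hε0 : 0 ≤ ε := by positivity
  have hkε : (k : ℝ) ^ ε = 2 ^ (1 / 10 : ℝ) := by
    conv_lhs => rw [← Real.rpow_logb two_pos (by norm_num) hk0]
    rw [← Real.rpow_mul two_pos.le]
    congr 1
    rw [hε]
    field_simp
  have h2N : (2 * N : ℝ) ^ ε ≤ 2 ^ ((4 * k : ℝ) / 10) := by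
    have h1 : (2 * N : ℝ) ≤ (k : ℝ) ^ (4 * k) := by exact_mod_cast hNk
    refine (Real.rpow_le_rpow (by positivity) h1 hε0).trans_eq ?_
    rw [← Real.rpow_natCast, ← Real.rpow_mul hk0.le, mul_comm, Real.rpow_mul hk0.le, hkε,
      ← Real.rpow_mul two_pos.le]
    congr 1
    push_cast
    ring
  have hr : (((k / 2 - 1 + 1 : ℕ) : ℝ)) * 2 ^ ((4 * k : ℝ) / 10) ≤ 2 ^ (k / 2 - 1) := by
    have h1 : ((k / 2 - 1 + 1 : ℕ) : ℝ) ≤ 2 ^ ((k / 20 : ℕ) : ℝ) := by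
      rw [Real.rpow_natCast]
      exact_mod_cast (by omega : k / 2 - 1 + 1 ≤ k).trans (le_two_pow_div_twenty hk)
    refine (mul_le_mul_of_nonneg_right h1 (by positivity)).trans ?_
    rw [← Real.rpow_add two_pos, ← Real.rpow_natCast]
    refine Real.rpow_le_rpow_of_exponent_le one_le_two ?_
    have h2 : 20 * (k / 20) ≤ k := Nat.mul_div_le k 20
    have h3 : k ≤ 2 * (k / 2 - 1) + 3 := by omega
    have h2' : (20 : ℝ) * (k / 20 : ℕ) ≤ k := by exact_mod_cast h2
    have h3' : (k : ℝ) ≤ 2 * (k / 2 - 1 : ℕ) + 3 := by exact_mod_cast h3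
    have hk' : (1024 : ℝ) ≤ k := by exact_mod_cast hk
    linarith
  have hβ' : (β : ℝ) * 2 ^ (k / 2 - 1) ≤ N * (k / 2 - 1 + 1 : ℕ) := by exact_mod_cast hβ
  have hrhs : (2 : ℝ) ^ (-ε) * (N : ℝ) ^ (1 - ε) = N / (2 * N : ℝ) ^ ε := by
    rw [Real.mul_rpow two_pos.le hN0.le, Real.rpow_neg two_pos.le, Real.rpow_sub hN0,
      Real.rpow_one]
    field_simp
  rw [hrhs, le_div_iff₀ (by positivity)]
  have hp : (0 : ℝ) < 2 ^ (k / 2 - 1) := by positivity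
  refine le_of_mul_le_mul_right ?_ hp
  calc (β : ℝ) * (2 * N : ℝ) ^ ε * 2 ^ (k / 2 - 1)
      = (β * 2 ^ (k / 2 - 1)) * (2 * N : ℝ) ^ ε := by ring
    _ ≤ (N * (k / 2 - 1 + 1 : ℕ)) * 2 ^ ((4 * k : ℝ) / 10) :=
        mul_le_mul hβ' h2N (by positivity) (by positivity)
    _ = N * ((k / 2 - 1 + 1 : ℕ) * 2 ^ ((4 * k : ℝ) / 10)) := by ring
    _ ≤ N * 2 ^ (k / 2 - 1) := mul_le_mul_of_nonneg_left hr hN0.le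

end Numeric

end NoetherBound

/-- **Almost simple groups with large alternating socle.**  Let `H` be a finite
almost simple group whose socle is isomorphic to `A_k` with `k ≥ 2¹⁰`, i.e. `H`
has a normal subgroup `S ≅ A_k` with `C_H(S) = 1`.  Then
`β(H) ≤ 2^(-ε)·|H|^(1-ε)` with `ε = 1/(10 log₂ k)`. -/
theorem noetherNumber_le_of_alternating_socle
    (k : ℕ) (hk : 2 ^ 10 ≤ k)
    (H : Type) [Group H] [Finite H] (S : Subgroup H) (hN : S.Normal)
    (hiso : Nonempty (↥S ≃* alternatingGroup (Fin k)))
    (hcent : Subgroup.centralizer (S : Set H) = ⊥) :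
    (noetherNumber H : ℝ) ≤
      (2 : ℝ) ^ (-(1 / (10 * Real.logb 2 (k : ℝ)))) *
        (Nat.card H : ℝ) ^ (1 - 1 / (10 * Real.logb 2 (k : ℝ))) := by
  obtain ⟨iso⟩ := hiso
  obtain ⟨b, hcomm, hsq, hb⟩ :=
    NoetherBound.exists_involutions_alternatingGroup (k := k) (r := k / 2 - 1) (by omega)
  let θ : alternatingGroup (Fin k) →* H := S.subtype.comp iso.symm.toMonoidHom
  have hθ : Function.Injective θ := S.subtype_injective.comp iso.symm.injective
  have hcard := NoetherBound.two_pow_le_card_closure (fun t => θ (b t)) fun t ht => by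
    refine hb t ?_
    rwa [← Function.comp_def, Set.image_comp, ← MonoidHom.map_closure,
      Subgroup.mem_map_iff_mem hθ] at ht
  have hβ := NoetherBound.noetherNumber_le_index_mul (fun t => θ (b t))
    (fun t u => (hcomm t u).map θ) fun t => by rw [← map_mul, hsq, map_one]
  have hH : 2 * Nat.card H ≤ k ^ (4 * k) := by
    have : Nontrivial (Fin k) := Fin.nontrivial_iff_two_le.2 (by omega)
    have hS : Nat.card S = Nat.card (alternatingGroup (Fin k)) := Nat.card_congr iso.toEquiv
    have hrank : Group.rank S ≤ 4 :=
      (Group.rank_congr iso).trans_le (NoetherBound.rank_alternatingGroup_fin_le (by omega))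
    have hle : Nat.card H ≤ Nat.card S ^ 4 :=
      ((NoetherBound.card_le_card_mulAut S hcent).trans
        (NoetherBound.card_mulAut_le_pow_rank S)).trans (Nat.pow_le_pow_right Nat.card_pos hrank)
    have h2 : 2 * Nat.card S ≤ k ^ k := by
      rw [hS, two_mul_nat_card_alternatingGroup, Nat.card_perm, Nat.card_eq_fintype_card,
        Fintype.card_fin]
      exact Nat.factorial_le_pow k
    calc 2 * Nat.card H ≤ 2 * Nat.card S ^ 4 := Nat.mul_le_mul_left 2 hle
      _ ≤ (2 * Nat.card S) ^ 4 := by rw [mul_pow]; exact Nat.mul_le_mul_right _ (by norm_num)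
      _ ≤ (k ^ k) ^ 4 := Nat.pow_le_pow_left h2 4
      _ = k ^ (4 * k) := by rw [← pow_mul, mul_comm]
  refine NoetherBound.le_rpow_of_mul_two_pow_le hk Nat.card_pos hH ?_
  rw [← Subgroup.index_mul_card (Subgroup.closure (Set.range fun t => θ (b t)))]
  calc noetherNumber H * 2 ^ (k / 2 - 1)
      ≤ _ * (k / 2 - 1 + 1) * _ := Nat.mul_le_mul hβ hcard
    _ = _ := by ring
end
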